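/- Leading order of the ground state energy in two dimensions (Lieb–Yngvason): Let V:ℝ²→[0,∞] be measurable, radial and compactly supported, with two-dimensional scattering length a>0, and set b(ρ)=1/|log(ρa²)|. Then lim_{ρ→0⁺} e₂⁻(ρ)/(4πρ²b(ρ)) = lim_{ρ→0⁺} e₂⁺(ρ)/(4πρ²b(ρ)) = 1. -/

import Mathlib

open MeasureTheory Filter Real
open scoped ENNReal NNReal

noncomputable section

abbrev Vec (d : ℕ) := Fin d → ℝ

def box (d N : ℕ) (T : ℝ) : Set (Fin N → Vec d) :=
  {x | ∀ i k, x i k ∈ Set.Icc (-T/2) (T/2)}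

def periodize (d : ℕ) (V : Vec d → ℝ≥0∞) (T : ℝ) (z : Vec d) : ℝ≥0∞ :=
  ∑' n : Fin d → ℤ, V (fun k => z k + T * n k)

def kineticE (d N : ℕ) (T : ℝ) (ψ : (Fin N → Vec d) → ℂ) : ℝ≥0∞ :=
  ∑ i : Fin N, ∑ k : Fin d,
    ∫⁻ x in box d N T, (‖fderiv ℝ ψ x (Pi.single i (Pi.single k 1))‖₊ : ℝ≥0∞) ^ 2

def interE (d N : ℕ) (T : ℝ) (V : Vec d → ℝ≥0∞) (ψ : (Fin N → Vec d) → ℂ) : ℝ≥0∞ :=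
  ∑ i : Fin N, ∑ j : Fin N,
    if i < j then
      ∫⁻ x in box d N T, periodize d V T (fun k => x i k - x j k) * (‖ψ x‖₊ : ℝ≥0∞) ^ 2
    else 0

def IsTrialState (d N : ℕ) (T : ℝ) (ψ : (Fin N → Vec d) → ℂ) : Prop :=
  ContDiff ℝ (⊤ : ℕ∞) ψ ∧
  (∀ (x : Fin N → Vec d) (v : Fin N → Fin d → ℤ), ψ (fun i k => x i k + T * v i k) = ψ x) ∧
  (∀ (σ : Equiv.Perm (Fin N)) (x : Fin N → Vec d), ψ (x ∘ σ) = ψ x) ∧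
  ∫⁻ x in box d N T, (‖ψ x‖₊ : ℝ≥0∞) ^ 2 = 1

def gsEnergy (d N : ℕ) (T : ℝ) (V : Vec d → ℝ≥0∞) : ℝ :=
  sInf {e : ℝ | ∃ ψ, IsTrialState d N T ψ ∧
        kineticE d N T ψ + interE d N T V ψ ≠ ⊤ ∧
        (kineticE d N T ψ + interE d N T V ψ).toReal = e}

/-- side length of the thermodynamic box -/
def sideLength (d : ℕ) (ρ : ℝ) (N : ℕ) : ℝ := ((N : ℝ) / ρ) ^ ((1 : ℝ) / d)

def eMinus (d : ℕ) (V : Vec d → ℝ≥0∞) (ρ : ℝ) : ℝ :=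
  liminf (fun N : ℕ => gsEnergy d N (sideLength d ρ N) V / (sideLength d ρ N) ^ d) atTop

def ePlus (d : ℕ) (V : Vec d → ℝ≥0∞) (ρ : ℝ) : ℝ :=
  limsup (fun N : ℕ => gsEnergy d N (sideLength d ρ N) V / (sideLength d ρ N) ^ d) atTop
/-- Variational characterization of the two-dimensional scattering length on a disc
of radius `ℓ`: the set of energies of trial functions equal to `1` near the circle
`{|x| = ℓ}`. -/
def scatSet2 (V : Vec 2 → ℝ≥0∞) (ℓ : ℝ) : Set ℝ≥0∞ :=
  {E | ∃ f : Vec 2 → ℝ, ContDiff ℝ (⊤ : ℕ∞) f ∧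
       (∃ ε > (0 : ℝ), ∀ x : Vec 2, |Real.sqrt (∑ k, (x k) ^ 2) - ℓ| < ε → f x = 1) ∧
       E = ∫⁻ x in {x : Vec 2 | Real.sqrt (∑ k, (x k) ^ 2) < ℓ},
             ((∑ k, ((‖fderiv ℝ f x (Pi.single k 1)‖₊ : ℝ≥0∞)) ^ 2)
               + V x * (‖f x‖₊ : ℝ≥0∞) ^ 2 / 2)}

/-- The effective two-dimensional coupling `b = 1/|log(ρa²)|`. -/
def bParam (a ρ : ℝ) : ℝ := |Real.log (ρ * a ^ 2)|⁻¹

/-- The Euclidean norm on `Vec 2`. -/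
def rad (x : Vec 2) : ℝ := Real.sqrt (∑ k, (x k) ^ 2)

lemma rad_nonneg (x : Vec 2) : 0 ≤ rad x := Real.sqrt_nonneg _

lemma rad_sq (x : Vec 2) : rad x ^ 2 = x 0 ^ 2 + x 1 ^ 2 := by
  rw [rad, Real.sq_sqrt (by positivity), Fin.sum_univ_two]

lemma continuous_rad : Continuous rad := by unfold rad; fun_prop

lemma rad_polar {r : ℝ} (hr : 0 ≤ r) (θ : ℝ) : rad ![r * cos θ, r * sin θ] = r := by
  rw [rad, Fin.sum_univ_two]
  simp only [Matrix.cons_val_zero, Matrix.cons_val_one]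
  rw [show (r * cos θ) ^ 2 + (r * sin θ) ^ 2 = r ^ 2 by nlinarith [sin_sq_add_cos_sq θ],
    Real.sqrt_sq hr]

lemma lintegral_vec2 (F : Vec 2 → ℝ≥0∞) :
    ∫⁻ x, F x = ∫⁻ p : ℝ × ℝ, F ![p.1, p.2] := by
  have h := (volume_preserving_finTwoArrow ℝ).symm
  rw [← h.lintegral_comp_emb (MeasurableEquiv.measurableEmbedding _)]
  rfl

lemma lintegral_polar (F : Vec 2 → ℝ≥0∞) (hF : Measurable F) (ℓ : ℝ) :
    ∫⁻ x in {x | rad x < ℓ}, F x =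
      ∫⁻ θ in Set.Ioo (-π) π, ∫⁻ r in Set.Ioo 0 ℓ,
        ENNReal.ofReal r * F ![r * cos θ, r * sin θ] := by
  have hm : MeasurableSet {x : Vec 2 | rad x < ℓ} :=
    measurableSet_lt continuous_rad.measurable measurable_const
  have hG : Measurable ({x | rad x < ℓ}.indicator F) := hF.indicator hm
  rw [← lintegral_indicator hm, lintegral_vec2, ← lintegral_comp_polarCoord_symm]
  rw [polarCoord_target, Measure.volume_eq_prod, ← Measure.prod_restrict, lintegral_prod_symm]
  · refine lintegral_congr fun θ => ?_
    rw [← lintegral_indicator measurableSet_Ioi, ← lintegral_indicator measurableSet_Ioo]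
    refine lintegral_congr fun r => ?_
    by_cases hr : 0 < r
    · rw [Set.indicator_of_mem (by simpa using hr)]
      simp only [polarCoord_symm_apply, smul_eq_mul]
      by_cases hl : r < ℓ
      · rw [Set.indicator_of_mem (by simpa [rad_polar hr.le] using hl),
          Set.indicator_of_mem (by simp [hr, hl])]
      · rw [Set.indicator_of_notMem (by simpa [rad_polar hr.le] using hl),
          Set.indicator_of_notMem (by simp [hl]), mul_zero]
    · rw [Set.indicator_of_notMem (by simpa using hr),
          Set.indicator_of_notMem (by simp [hr])]
  · have hc : Continuous fun p : ℝ × ℝ => polarCoord.symm p := by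
      simp only [polarCoord_symm_apply]; fun_prop
    have hc2 : Continuous fun p : ℝ × ℝ => (![p.1, p.2] : Vec 2) := by
      refine continuous_pi fun k => ?_
      fin_cases k <;> simp <;> fun_prop
    exact ((ENNReal.measurable_ofReal.comp measurable_fst).smul
      (hG.comp (hc2.measurable.comp hc.measurable))).aemeasurable

lemma lintegral_radial (G : ℝ → ℝ≥0∞) (hG : Measurable G) (ℓ : ℝ) :
    ∫⁻ x in {x | rad x < ℓ}, G (rad x) =
      ENNReal.ofReal (2 * π) * ∫⁻ r in Set.Ioo 0 ℓ, ENNReal.ofReal r * G r := by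
  rw [lintegral_polar (fun x => G (rad x)) (hG.comp continuous_rad.measurable)]
  have : ∀ θ : ℝ, ∫⁻ r in Set.Ioo 0 ℓ, ENNReal.ofReal r * G (rad ![r * cos θ, r * sin θ]) =
      ∫⁻ r in Set.Ioo 0 ℓ, ENNReal.ofReal r * G r := fun θ =>
    setLIntegral_congr_fun measurableSet_Ioo fun r hr => by
      simp only [rad_polar hr.1.le]
  simp_rw [this]
  rw [lintegral_const, Measure.restrict_apply_univ, Real.volume_Ioo, mul_comm]
  congr 2; ring

lemma hasFDerivAt_rad {x : Vec 2} (hx : 0 < rad x) :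
    HasFDerivAt rad ((1 / (2 * rad x)) •
      (∑ k : Fin 2, (2 * x k) • ContinuousLinearMap.proj (R := ℝ)
          (φ := fun _ : Fin 2 => ℝ) k)) x := by
  have hs : HasFDerivAt (fun x : Vec 2 => ∑ k, (x k) ^ 2)
      (∑ k : Fin 2, (2 * x k) • ContinuousLinearMap.proj (R := ℝ)
          (φ := fun _ : Fin 2 => ℝ) k) x := by
    refine HasFDerivAt.fun_sum fun k _ => ?_
    have h : HasFDerivAt (fun y : Vec 2 => y k)
        (ContinuousLinearMap.proj (R := ℝ) (φ := fun _ : Fin 2 => ℝ) k) x := hasFDerivAt_apply k x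
    refine (h.pow 2).congr_fderiv ?_
    ext
    simp
  have h0 : (∑ k, (x k) ^ 2) ≠ 0 := by
    intro h
    rw [rad, h, Real.sqrt_zero] at hx
    exact lt_irrefl _ hx
  exact hs.sqrt h0

lemma contDiff_comp_rad {H : ℝ → ℝ} (hH : ContDiff ℝ (⊤ : ℕ∞) H) {ε : ℝ} (hε : 0 < ε)
    (H0 : ∀ r, |r| ≤ ε → H r = 0) : ContDiff ℝ (⊤ : ℕ∞) (fun x => H (rad x)) := by
  rw [contDiff_iff_contDiffAt]
  intro x
  by_cases hx : rad x < ε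
  · have : (fun x => H (rad x)) =ᶠ[nhds x] fun _ => 0 := by
      filter_upwards [continuous_rad.continuousAt.eventually_lt continuousAt_const hx] with y hy
      exact H0 _ (by rw [abs_of_nonneg (rad_nonneg _)]; exact hy.le)
    exact contDiffAt_const.congr_of_eventuallyEq this
  · have hx0 : 0 < rad x := lt_of_lt_of_le hε (not_lt.1 hx)
    have h0 : (∑ k, (x k) ^ 2) ≠ 0 := by
      intro h
      rw [rad, h, Real.sqrt_zero] at hx0
      exact lt_irrefl _ hx0
    refine hH.contDiffAt.comp x (ContDiffAt.sqrt ?_ h0)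
    exact ContDiff.contDiffAt (by fun_prop)

lemma grad_comp_rad {H : ℝ → ℝ} (hH : ContDiff ℝ (⊤ : ℕ∞) H) {ε : ℝ} (hε : 0 < ε)
    (H0 : ∀ r, |r| ≤ ε → H r = 0) (x : Vec 2) :
    ∑ k, ‖fderiv ℝ (fun x => H (rad x)) x (Pi.single k 1)‖ₑ ^ 2 = ‖deriv H (rad x)‖ₑ ^ 2 := by
  by_cases hx : rad x < ε
  · have h1 : (fun x => H (rad x)) =ᶠ[nhds x] fun _ => 0 := by
      filter_upwards [continuous_rad.continuousAt.eventually_lt continuousAt_const hx] with y hy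
      exact H0 _ (by rw [abs_of_nonneg (rad_nonneg _)]; exact hy.le)
    have h2 : H =ᶠ[nhds (rad x)] fun _ => 0 := by
      filter_upwards [eventually_lt_nhds hx,
        eventually_gt_nhds (show -ε < rad x by linarith [rad_nonneg x])] with y hy hy'
      exact H0 _ (abs_le.2 ⟨hy'.le, hy.le⟩)
    rw [h1.fderiv_eq, h2.deriv_eq]
    simp
  · have hx0 : 0 < rad x := lt_of_lt_of_le hε (not_lt.1 hx)
    have hd : HasDerivAt H (deriv H (rad x)) (rad x) :=
      (hH.differentiable (by simp)).differentiableAt.hasDerivAt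
    have hc := hd.comp_hasFDerivAt x (hasFDerivAt_rad hx0)
    have hc' : fderiv ℝ (fun x => H (rad x)) x = _ := hc.fderiv
    have key : ∀ k, fderiv ℝ (fun x => H (rad x)) x (Pi.single k 1) =
        deriv H (rad x) * (x k / rad x) := by
      intro k
      rw [hc']
      fin_cases k <;> simp <;> field_simp <;> simp
    simp_rw [key, ← ofReal_norm, norm_mul, Real.norm_eq_abs]
    rw [Fin.sum_univ_two, ← ENNReal.ofReal_pow (by positivity),
      ← ENNReal.ofReal_pow (by positivity),
      ← ENNReal.ofReal_pow (by positivity), ← ENNReal.ofReal_add (by positivity) (by positivity)]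
    congr 1
    rw [mul_pow, mul_pow, sq_abs, sq_abs, sq_abs, div_pow, div_pow, ← mul_add, ← add_div, ← rad_sq,
      div_self (by positivity), mul_one]

/-- The potential as a function of the radius. -/
def radialV (V : Vec 2 → ℝ≥0∞) (r : ℝ) : ℝ≥0∞ := V ![r, 0]

lemma measurable_radialV {V : Vec 2 → ℝ≥0∞} (hV : Measurable V) : Measurable (radialV V) := by
  refine hV.comp (Continuous.measurable (continuous_pi fun k => ?_))
  fin_cases k <;> simp <;> fun_prop

lemma radialV_rad {V : Vec 2 → ℝ≥0∞}
    (hVrad : ∀ x y : Vec 2, ∑ k, (x k) ^ 2 = ∑ k, (y k) ^ 2 → V x = V y) (x : Vec 2) :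
    radialV V (rad x) = V x := by
  refine hVrad _ _ ?_
  simp [Fin.sum_univ_two, rad_sq]

lemma scat_le_radial {V : Vec 2 → ℝ≥0∞} (hVmeas : Measurable V)
    (hVrad : ∀ x y : Vec 2, ∑ k, (x k) ^ 2 = ∑ k, (y k) ^ 2 → V x = V y)
    {H : ℝ → ℝ} (hH : ContDiff ℝ (⊤ : ℕ∞) H) {ε ℓ : ℝ} (hε : 0 < ε)
    (H0 : ∀ r, |r| ≤ ε → H r = 0) (H1 : ∀ r, |r - ℓ| < ε → H r = 1) :
    sInf (scatSet2 V ℓ) ≤ ENNReal.ofReal (2 * π) * ∫⁻ r in Set.Ioo 0 ℓ, ENNReal.ofReal r *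
      (‖deriv H r‖ₑ ^ 2 + radialV V r * ‖H r‖ₑ ^ 2 / 2) := by
  refine sInf_le ⟨fun x => H (rad x), contDiff_comp_rad hH hε H0, ⟨ε, hε, fun x hx => H1 _ hx⟩, ?_⟩
  rw [← lintegral_radial]
  · refine lintegral_congr fun x => ?_
    simp only [← enorm_eq_nnnorm]
    rw [grad_comp_rad hH hε H0, radialV_rad hVrad]
  · have h1 : Measurable (deriv H) := measurable_deriv H
    have h2 : Measurable H := hH.continuous.measurable
    have h3 := measurable_radialV hVmeas
    fun_prop

lemma enorm_sq_real (x : ℝ) : ‖x‖ₑ ^ 2 = ENNReal.ofReal (x ^ 2) := by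
  rw [← ofReal_norm, ← ENNReal.ofReal_pow (norm_nonneg _), Real.norm_eq_abs, sq_abs]

lemma smoothTransition_deriv_eq_zero_of_neg {t : ℝ} (ht : t < 0) :
    deriv Real.smoothTransition t = 0 := by
  have : Real.smoothTransition =ᶠ[nhds t] fun _ => 0 := by
    filter_upwards [eventually_lt_nhds ht] with y hy
    exact Real.smoothTransition.zero_of_nonpos hy.le
  rw [this.deriv_eq]; simp

lemma smoothTransition_deriv_eq_zero_of_one_lt {t : ℝ} (ht : 1 < t) :
    deriv Real.smoothTransition t = 0 := by
  have : Real.smoothTransition =ᶠ[nhds t] fun _ => 1 := by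
    filter_upwards [eventually_gt_nhds ht] with y hy
    exact Real.smoothTransition.one_of_one_le hy.le
  rw [this.deriv_eq]; simp

lemma exists_smoothTransition_deriv_bound :
    ∃ C : ℝ, 0 < C ∧ ∀ t, |deriv Real.smoothTransition t| ≤ C := by
  have hc : Continuous (deriv Real.smoothTransition) :=
    (Real.smoothTransition.contDiff (n := 1)).continuous_deriv le_rfl
  obtain ⟨C, hC⟩ := isCompact_Icc.exists_bound_of_continuousOn (s := Set.Icc (0 : ℝ) 1)
    hc.continuousOn
  refine ⟨max C 1, by positivity, fun t => ?_⟩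
  by_cases h0 : t < 0
  · rw [smoothTransition_deriv_eq_zero_of_neg h0]; simp
  by_cases h1 : 1 < t
  · rw [smoothTransition_deriv_eq_zero_of_one_lt h1]; simp
  exact (hC t ⟨not_lt.1 h0, not_lt.1 h1⟩).trans (le_max_left _ _)

/-- A logarithmic cutoff, vanishing for `|r| ≤ exp (-2 L)` and equal to one for
`r ≥ exp (-L)`. -/
def logCutoff (L r : ℝ) : ℝ := Real.smoothTransition (Real.log (r / exp (-2 * L)) / L)

lemma logCutoff_zero {L r : ℝ} (hL : 0 < L) (hr : |r| ≤ exp (-2 * L)) : logCutoff L r = 0 := by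
  refine Real.smoothTransition.zero_of_nonpos (div_nonpos_of_nonpos_of_nonneg ?_ hL.le)
  rw [← Real.log_abs, abs_div, abs_of_pos (exp_pos _)]
  exact Real.log_nonpos (by positivity) (div_le_one_of_le₀ hr (exp_pos _).le)

lemma logCutoff_arg {L r : ℝ} (hr : 0 < r) : Real.log (r / exp (-2 * L)) = Real.log r + 2 * L := by
  rw [Real.log_div hr.ne' (exp_pos _).ne', Real.log_exp]; ring

lemma logCutoff_one {L r : ℝ} (hL : 0 < L) (hr : exp (-L) ≤ r) : logCutoff L r = 1 := by
  have hr0 : 0 < r := (exp_pos _).trans_le hr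
  refine Real.smoothTransition.one_of_one_le ?_
  rw [logCutoff_arg hr0, one_le_div hL]
  have := Real.log_le_log (exp_pos _) hr
  rw [Real.log_exp] at this
  linarith

lemma contDiff_logCutoff {L : ℝ} (hL : 0 < L) : ContDiff ℝ (⊤ : ℕ∞) (logCutoff L) := by
  rw [contDiff_iff_contDiffAt]
  intro r
  by_cases hr : r = 0
  · have : logCutoff L =ᶠ[nhds r] fun _ => 0 := by
      have h0 : |r| < exp (-2 * L) := by rw [hr, abs_zero]; exact exp_pos _
      filter_upwards [continuous_abs.continuousAt.eventually_lt continuousAt_const h0] with y hy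
      exact logCutoff_zero hL hy.le
    exact contDiffAt_const.congr_of_eventuallyEq this
  · refine Real.smoothTransition.contDiff.contDiffAt.comp r (ContDiffAt.div_const ?_ _)
    refine ContDiffAt.log (by fun_prop) ?_
    have := exp_pos (-2 * L)
    positivity

lemma logCutoff_deriv {L r : ℝ} (hr : 0 < r) :
    deriv (logCutoff L) r =
      deriv Real.smoothTransition ((Real.log r + 2 * L) / L) * (1 / (r * L)) := by
  have h1 : HasDerivAt (fun r => (Real.log r + 2 * L) / L) (1 / (r * L)) r := by
    have := ((Real.hasDerivAt_log hr.ne').add_const (2 * L)).div_const L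
    refine this.congr_deriv ?_
    rw [one_div, mul_inv, div_eq_mul_inv]
  have h2 : HasDerivAt Real.smoothTransition _ ((Real.log r + 2 * L) / L) :=
    ((Real.smoothTransition.contDiff
      (n := 1)).differentiable one_ne_zero).differentiableAt.hasDerivAt
  have h3 : logCutoff L =ᶠ[nhds r] fun r => Real.smoothTransition ((Real.log r + 2 * L) / L) := by
    filter_upwards [eventually_gt_nhds hr] with y hy
    rw [logCutoff, logCutoff_arg hy]
  rw [h3.deriv_eq]
  exact (h2.comp r h1).deriv

lemma logCutoff_deriv_sq_le {C L r : ℝ} (hC : ∀ t, |deriv Real.smoothTransition t| ≤ C)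
    (hL : 0 < L) (hr : 0 < r) :
    (deriv (logCutoff L) r) ^ 2 ≤
      (Set.Icc (exp (-2 * L)) (exp (-L))).indicator (fun r => C ^ 2 / (L ^ 2 * r ^ 2)) r := by
  rw [logCutoff_deriv hr]
  by_cases hmem : r ∈ Set.Icc (exp (-2 * L)) (exp (-L))
  · rw [Set.indicator_of_mem hmem, mul_pow, ← sq_abs]
    have h1 := hC ((Real.log r + 2 * L) / L)
    have : C ^ 2 / (L ^ 2 * r ^ 2) = C ^ 2 * (1 / (r * L)) ^ 2 := by field_simp
    rw [this]
    gcongr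
  · rw [Set.indicator_of_notMem hmem]
    have : deriv Real.smoothTransition ((Real.log r + 2 * L) / L) = 0 := by
      by_cases h : r < exp (-2 * L)
      · apply smoothTransition_deriv_eq_zero_of_neg
        have := Real.log_lt_log hr h
        rw [Real.log_exp] at this
        exact div_neg_of_neg_of_pos (by linarith) hL
      · have h' : exp (-L) < r := by
          by_contra hc
          exact hmem ⟨not_lt.1 h, not_lt.1 hc⟩
        apply smoothTransition_deriv_eq_zero_of_one_lt
        have := Real.log_lt_log (exp_pos _) h'
        rw [Real.log_exp] at this
        rw [lt_div_iff₀ hL]; linarith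
    rw [this]; simp

lemma lintegral_log_weight {C L : ℝ} (hL : 0 < L) :
    ∫⁻ r in Set.Icc (exp (-2 * L)) (exp (-L)), ENNReal.ofReal (C ^ 2 / L ^ 2 * (1 / r)) =
      ENNReal.ofReal (C ^ 2 / L) := by
  have hle : exp (-2 * L) ≤ exp (-L) := exp_le_exp.2 (by linarith)
  have hcont : ContinuousOn (fun r : ℝ => C ^ 2 / L ^ 2 * (1 / r))
      (Set.Icc (exp (-2 * L)) (exp (-L))) := by
    refine continuousOn_const.mul (continuousOn_const.div continuousOn_id fun r hr => ?_)
    exact ((exp_pos _).trans_le hr.1).ne'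
  rw [← ofReal_integral_eq_lintegral_ofReal (hcont.integrableOn_Icc)]
  · rw [integral_Icc_eq_integral_Ioc, ← intervalIntegral.integral_of_le hle,
      intervalIntegral.integral_const_mul, integral_one_div_of_pos (exp_pos _) (exp_pos _),
      ← Real.exp_sub, Real.log_exp]
    congr 1; field_simp; ring
  · filter_upwards [ae_restrict_mem measurableSet_Icc] with r hr
    have := (exp_pos _).trans_le hr.1
    simp only [Pi.zero_apply]; positivity

/-- The radial energy (without the angular factor `2π`) on the disc of radius `ℓ`. -/
def radialE {E : Type*} [NormedAddCommGroup E] [NormedSpace ℝ E]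
    (V : Vec 2 → ℝ≥0∞) (h : ℝ → E) (ℓ : ℝ) : ℝ≥0∞ :=
  ∫⁻ r in Set.Ioo 0 ℓ, ENNReal.ofReal r * (‖deriv h r‖ₑ ^ 2 + radialV V r * ‖h r‖ₑ ^ 2 / 2)

lemma sq_add_le_weighted {s : ℝ} (hs : 0 < s) (x y : ℝ) :
    (x + y) ^ 2 ≤ (1 + s) * x ^ 2 + (1 + 1 / s) * y ^ 2 := by
  have h : (1 + s) * x ^ 2 + (1 + 1 / s) * y ^ 2 - (x + y) ^ 2 = (s * x - y) ^ 2 / s := by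
    field_simp; ring
  have : 0 ≤ (s * x - y) ^ 2 / s := by positivity
  linarith

lemma radialE_logCutoff_le (V : Vec 2 → ℝ≥0∞) {h : ℝ → ℝ}
    (hh : ContDiff ℝ (⊤ : ℕ∞) h) {C M s L : ℝ} (hs : 0 < s) (hL : 0 < L)
    (hC : ∀ t, |deriv Real.smoothTransition t| ≤ C) (hM : ∀ r ∈ Set.Icc (0 : ℝ) 1, |h r| ≤ M)
    (ℓ : ℝ) :
    radialE V (fun r => logCutoff L r * h r) ℓ ≤
      ENNReal.ofReal (1 + s) * radialE V h ℓ +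
        ENNReal.ofReal ((1 + 1 / s) * M ^ 2) * ENNReal.ofReal (C ^ 2 / L) := by
  have hpt : ∀ r ∈ Set.Ioo 0 ℓ, ENNReal.ofReal r *
      (‖deriv (fun r => logCutoff L r * h r) r‖ₑ ^ 2 +
        radialV V r * ‖logCutoff L r * h r‖ₑ ^ 2 / 2) ≤
      ENNReal.ofReal (1 + s) *
          (ENNReal.ofReal r * (‖deriv h r‖ₑ ^ 2 + radialV V r * ‖h r‖ₑ ^ 2 / 2))
      + ENNReal.ofReal ((1 + 1 / s) * M ^ 2) * (Set.Icc (exp (-2 * L)) (exp (-L))).indicator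
        (fun r => ENNReal.ofReal (C ^ 2 / L ^ 2 * (1 / r))) r := by
    intro r hr
    have hr0 : 0 < r := hr.1
    have hη1 : 0 ≤ logCutoff L r := Real.smoothTransition.nonneg _
    have hη2 : logCutoff L r ≤ 1 := Real.smoothTransition.le_one _
    have hd : deriv (fun r => logCutoff L r * h r) r =
        logCutoff L r * deriv h r + deriv (logCutoff L) r * h r := by
      have e1 := ((contDiff_logCutoff hL).differentiable (by simp)).differentiableAt (x := r)
      have e2 := (hh.differentiable (by simp)).differentiableAt (x := r)
      have := (e1.hasDerivAt.mul e2.hasDerivAt).deriv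
      rw [show (fun r => logCutoff L r * h r) = logCutoff L * h from rfl, this]; ring
    have hV : ‖logCutoff L r * h r‖ₑ ^ 2 ≤ ‖h r‖ₑ ^ 2 := by
      rw [enorm_sq_real, enorm_sq_real]
      apply ENNReal.ofReal_le_ofReal
      rw [mul_pow]
      exact mul_le_of_le_one_left (sq_nonneg _) (pow_le_one₀ hη1 hη2)
    have hone : (1 : ℝ≥0∞) ≤ ENNReal.ofReal (1 + s) := by
      rw [← ENNReal.ofReal_one]; exact ENNReal.ofReal_le_ofReal (by linarith)
    have hkin : ENNReal.ofReal r * ‖deriv (fun r => logCutoff L r * h r) r‖ₑ ^ 2 ≤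
        ENNReal.ofReal (1 + s) * (ENNReal.ofReal r * ‖deriv h r‖ₑ ^ 2) +
        ENNReal.ofReal ((1 + 1 / s) * M ^ 2) * (Set.Icc (exp (-2 * L)) (exp (-L))).indicator
        (fun r => ENNReal.ofReal (C ^ 2 / L ^ 2 * (1 / r))) r := by
      have hD := logCutoff_deriv_sq_le hC hL hr0
      rw [hd, enorm_sq_real, enorm_sq_real]
      have h1 : (logCutoff L r * deriv h r + deriv (logCutoff L) r * h r) ^ 2 ≤
          (1 + s) * (deriv h r) ^ 2 + (1 + 1 / s) * (deriv (logCutoff L) r * h r) ^ 2 := by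
        have hq : (logCutoff L r * deriv h r) ^ 2 ≤ (deriv h r) ^ 2 := by
          rw [mul_pow]
          exact mul_le_of_le_one_left (sq_nonneg _) (pow_le_one₀ hη1 hη2)
        exact (sq_add_le_weighted hs _ _).trans
          (add_le_add (mul_le_mul_of_nonneg_left hq (by positivity)) le_rfl)
      by_cases hmem : r ∈ Set.Icc (exp (-2 * L)) (exp (-L))
      · rw [Set.indicator_of_mem hmem] at hD ⊢
        rw [← ENNReal.ofReal_mul hr0.le, ← ENNReal.ofReal_mul hr0.le,
          ← ENNReal.ofReal_mul (by positivity), ← ENNReal.ofReal_mul (by positivity),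
          ← ENNReal.ofReal_add (by positivity) (by positivity)]
        apply ENNReal.ofReal_le_ofReal
        have hM' : |h r| ≤ M := by
          refine hM r ⟨hr0.le, hmem.2.trans ?_⟩
          rw [← Real.exp_zero]; exact exp_le_exp.2 (by linarith)
        have hM2 : (h r) ^ 2 ≤ M ^ 2 := by rw [← sq_abs]; gcongr
        have h2 : (deriv (logCutoff L) r * h r) ^ 2 ≤ C ^ 2 / (L ^ 2 * r ^ 2) * M ^ 2 := by
          rw [mul_pow]; gcongr
        calc r * (logCutoff L r * deriv h r + deriv (logCutoff L) r * h r) ^ 2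
            ≤ r * ((1 + s) * (deriv h r) ^ 2 +
                (1 + 1 / s) * (C ^ 2 / (L ^ 2 * r ^ 2) * M ^ 2)) := by
              gcongr; exact h1.trans (by gcongr)
          _ = _ := by field_simp
      · rw [Set.indicator_of_notMem hmem] at hD ⊢
        have h0 : deriv (logCutoff L) r = 0 := by
          have : (deriv (logCutoff L) r) ^ 2 = 0 := le_antisymm hD (sq_nonneg _)
          exact pow_eq_zero_iff (two_ne_zero) |>.1 this
        rw [mul_zero, add_zero, ← ENNReal.ofReal_mul hr0.le, ← ENNReal.ofReal_mul hr0.le,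
          ← ENNReal.ofReal_mul (by positivity)]
        apply ENNReal.ofReal_le_ofReal
        rw [h0] at h1
        rw [h0]
        simp only [zero_mul, add_zero] at h1 ⊢
        have : r * (logCutoff L r * deriv h r) ^ 2 ≤ r * ((1 + s) * (deriv h r) ^ 2) := by
          gcongr; simpa using h1
        linarith
    calc _ = ENNReal.ofReal r * ‖deriv (fun r => logCutoff L r * h r) r‖ₑ ^ 2 +
          1 * (ENNReal.ofReal r * (radialV V r * ‖logCutoff L r * h r‖ₑ ^ 2 / 2)) := by
            rw [mul_add, one_mul]
      _ ≤ (ENNReal.ofReal (1 + s) * (ENNReal.ofReal r * ‖deriv h r‖ₑ ^ 2) +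
        ENNReal.ofReal ((1 + 1 / s) * M ^ 2) * (Set.Icc (exp (-2 * L)) (exp (-L))).indicator
        (fun r => ENNReal.ofReal (C ^ 2 / L ^ 2 * (1 / r))) r) +
         ENNReal.ofReal (1 + s) * (ENNReal.ofReal r * (radialV V r * ‖h r‖ₑ ^ 2 / 2)) := by
            gcongr
      _ = _ := by ring
  calc radialE V (fun r => logCutoff L r * h r) ℓ ≤ _ := setLIntegral_mono' measurableSet_Ioo hpt
    _ ≤ _ := by
      have hm : Measurable fun r : ℝ => ENNReal.ofReal ((1 + 1 / s) * M ^ 2) *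
          (Set.Icc (exp (-2 * L)) (exp (-L))).indicator
        (fun r => ENNReal.ofReal (C ^ 2 / L ^ 2 * (1 / r))) r := by
        refine Measurable.const_mul ?_ _
        refine Measurable.indicator ?_ measurableSet_Icc
        fun_prop
      rw [lintegral_add_right _ hm, lintegral_const_mul' _ _ ENNReal.ofReal_ne_top,
        lintegral_const_mul' _ _ ENNReal.ofReal_ne_top]
      refine add_le_add le_rfl ?_
      gcongr
      refine (lintegral_mono' Measure.restrict_le_self le_rfl).trans ?_
      rw [lintegral_indicator measurableSet_Icc, lintegral_log_weight hL]

/-- Lower bound for the radial energy of functions equal to one near the outer circle. -/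
lemma radialE_lower_of_eq_one {V : Vec 2 → ℝ≥0∞} (hVmeas : Measurable V)
    (hVrad : ∀ x y : Vec 2, ∑ k, (x k) ^ 2 = ∑ k, (y k) ^ 2 → V x = V y)
    {h : ℝ → ℝ} (hh : ContDiff ℝ (⊤ : ℕ∞) h) {ε ℓ : ℝ} (hε : 0 < ε) (hℓ : 0 < ℓ)
    (h1 : ∀ r, |r - ℓ| < ε → h r = 1) :
    sInf (scatSet2 V ℓ) ≤ ENNReal.ofReal (2 * π) * radialE V h ℓ := by
  obtain ⟨C, hC0, hC⟩ := exists_smoothTransition_deriv_bound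
  obtain ⟨M, hM⟩ := isCompact_Icc.exists_bound_of_continuousOn (s := Set.Icc (0 : ℝ) 1)
    hh.continuous.continuousOn
  have hev : ∀ᶠ τ : ℝ in atTop, sInf (scatSet2 V ℓ) ≤ ENNReal.ofReal (2 * π) *
      (ENNReal.ofReal (1 + 1 / τ) * radialE V h ℓ +
        ENNReal.ofReal ((1 + τ) * M ^ 2 * (C ^ 2 / τ ^ 2))) := by
    have hlim : Tendsto (fun τ : ℝ => exp (-τ ^ 2)) atTop (nhds 0) := by
      apply Real.tendsto_exp_neg_atTop_nhds_zero.comp (tendsto_pow_atTop two_ne_zero)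
    filter_upwards [eventually_gt_atTop 0, hlim.eventually_lt_const (show 0 < ℓ / 2 by linarith)]
      with τ hτ hτ2
    have hL : 0 < τ ^ 2 := by positivity
    set ε' := min (min ε (ℓ / 2)) (exp (-2 * τ ^ 2)) with hε'
    have hε'0 : 0 < ε' := lt_min (lt_min hε (by linarith)) (exp_pos _)
    refine (scat_le_radial hVmeas hVrad ((contDiff_logCutoff hL).mul hh) hε'0 ?_ ?_).trans ?_
    · intro r hr
      rw [logCutoff_zero hL (hr.trans (min_le_right _ _)), zero_mul]
    · intro r hr
      have e1 : |r - ℓ| < ε := hr.trans_le ((min_le_left _ _).trans (min_le_left _ _))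
      have e2 : |r - ℓ| < ℓ / 2 := hr.trans_le ((min_le_left _ _).trans (min_le_right _ _))
      rw [h1 r e1, logCutoff_one hL, one_mul]
      have := (abs_lt.1 e2).1
      have h3 : exp (-τ ^ 2) < ℓ / 2 := hτ2
      linarith
    · refine mul_le_mul_right ((radialE_logCutoff_le V hh (s := 1 / τ) (by positivity) hL hC
        (by simpa using hM) ℓ).trans ?_) _
      rw [← ENNReal.ofReal_mul (by positivity), one_div_one_div]
  by_cases htop : radialE V h ℓ = ⊤
  · rw [htop, ENNReal.mul_top]
    · exact le_top
    · simp [Real.pi_pos]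
  refine ge_of_tendsto ?_ hev
  refine ENNReal.Tendsto.const_mul ?_ (Or.inr ENNReal.ofReal_ne_top)
  have t1 : Tendsto (fun τ : ℝ => ENNReal.ofReal (1 + 1 / τ) * radialE V h ℓ) atTop
      (nhds (radialE V h ℓ)) := by
    have : Tendsto (fun τ : ℝ => ENNReal.ofReal (1 + 1 / τ)) atTop (nhds 1) := by
      rw [← ENNReal.ofReal_one]
      refine ENNReal.tendsto_ofReal ?_
      simpa using tendsto_const_nhds.add (tendsto_inv_atTop_zero (𝕜 := ℝ))
    simpa using ENNReal.Tendsto.mul_const this (Or.inr htop)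
  have t2 : Tendsto (fun τ : ℝ => ENNReal.ofReal ((1 + τ) * M ^ 2 * (C ^ 2 / τ ^ 2))) atTop
      (nhds 0) := by
    rw [← ENNReal.ofReal_zero]
    refine ENNReal.tendsto_ofReal ?_
    have : Tendsto (fun τ : ℝ => (τ⁻¹ * τ⁻¹ + τ⁻¹) * (M ^ 2 * C ^ 2)) atTop (nhds 0) := by
      have h := tendsto_inv_atTop_zero (𝕜 := ℝ)
      simpa using ((h.mul h).add h).mul_const (M ^ 2 * C ^ 2)
    refine this.congr' ?_
    filter_upwards [eventually_gt_atTop 0] with τ hτ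
    field_simp
  simpa using t1.add t2

/-- `V` is a radial potential supported in the disc of radius `ℓ₀`, whose scattering energy at
each radius `ℓ ≥ ℓ₀` is at least `2π / log (ℓ / a)`. -/
structure ScatteringBound (V : Vec 2 → ℝ≥0∞) (a ℓ₀ : ℝ) : Prop where
  meas : Measurable V
  radial : ∀ x y : Vec 2, ∑ k, (x k) ^ 2 = ∑ k, (y k) ^ 2 → V x = V y
  pos : 0 < a
  lt : a < ℓ₀
  supp : ∀ x, V x ≠ 0 → rad x < ℓ₀
  low : ∀ ℓ ≥ ℓ₀, ENNReal.ofReal (2 * π) * ENNReal.ofReal (1 / Real.log (ℓ / a)) ≤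
    sInf (scatSet2 V ℓ)

lemma ScatteringBound.radialV_eq_zero {V : Vec 2 → ℝ≥0∞} {a ℓ₀ : ℝ} (hV : ScatteringBound V a ℓ₀)
    {r : ℝ} (hr : ℓ₀ ≤ r) : radialV V r = 0 := by
  by_contra h
  have h1 := hV.supp _ h
  have h2 : rad ![r, 0] = r := by
    have hr0 : 0 ≤ r := (hV.pos.trans hV.lt).le.trans hr
    simpa using rad_polar hr0 0
  linarith

lemma radialE_lower {V : Vec 2 → ℝ≥0∞} {a ℓ₀ : ℝ} (hV : ScatteringBound V a ℓ₀)
    {h : ℝ → ℝ} (hh : ContDiff ℝ (⊤ : ℕ∞) h) {ℓ : ℝ} (hℓ : ℓ₀ ≤ ℓ) (h1 : h ℓ = 1) :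
    ENNReal.ofReal (1 / Real.log (ℓ / a)) ≤ radialE V h ℓ := by
  have ha := hV.pos
  have hal := hV.lt
  have hℓ0 : 0 < ℓ := by linarith
  obtain ⟨C, hC0, hC⟩ := exists_smoothTransition_deriv_bound
  obtain ⟨M, hM⟩ := isCompact_Icc.exists_bound_of_continuousOn (s := Set.Icc ℓ (ℓ + 2))
    (hh.continuous_deriv (by simp)).continuousOn
  have hM0 : 0 ≤ M := (norm_nonneg _).trans (hM ℓ (by constructor <;> linarith))
  set B := (ℓ + 2) * (C * M + M) ^ 2 with hB
  have hev : ∀ᶠ ε : ℝ in nhdsWithin 0 (Set.Ioi 0),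
      ENNReal.ofReal (1 / Real.log ((ℓ + 2 * ε) / a)) ≤ radialE V h ℓ +
          ENNReal.ofReal (B * (2 * ε)) := by
    filter_upwards [Ioo_mem_nhdsGT (show (0 : ℝ) < 1 by norm_num)] with ε hε
    obtain ⟨hε0, hε1⟩ := hε
    set κ : ℝ → ℝ := fun r => 1 - Real.smoothTransition ((r - ℓ) / ε) with hκ
    have hκs : ContDiff ℝ (⊤ : ℕ∞) κ := by
      refine contDiff_const.sub (Real.smoothTransition.contDiff.comp ?_)
      fun_prop
    have hκ01 : ∀ r, 0 ≤ κ r ∧ κ r ≤ 1 := fun r =>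
      ⟨sub_nonneg.2 (Real.smoothTransition.le_one _),
        sub_le_self _ (Real.smoothTransition.nonneg _)⟩
    set H : ℝ → ℝ := fun r => 1 + κ r * (h r - 1) with hH
    have hHs : ContDiff ℝ (⊤ : ℕ∞) H := contDiff_const.add (hκs.mul (hh.sub contDiff_const))
    have hH1 : ∀ r, |r - (ℓ + 2 * ε)| < ε → H r = 1 := by
      intro r hr
      have : 1 ≤ (r - ℓ) / ε := by
        rw [le_div_iff₀ hε0]; linarith [(abs_lt.1 hr).1]
      simp [hH, hκ, Real.smoothTransition.one_of_one_le this]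
    have hHh : ∀ r ≤ ℓ, H r = h r := by
      intro r hr
      have : (r - ℓ) / ε ≤ 0 := div_nonpos_of_nonpos_of_nonneg (by linarith) hε0.le
      simp [hH, hκ, Real.smoothTransition.zero_of_nonpos this]
    have hlow := (hV.low (ℓ + 2 * ε) (by linarith)).trans
      (radialE_lower_of_eq_one hV.meas hV.radial hHs hε0 (by linarith) hH1)
    have hπ : ENNReal.ofReal (2 * π) ≠ 0 := by simp [Real.pi_pos]
    refine ((ENNReal.mul_le_mul_iff_right hπ ENNReal.ofReal_ne_top).1 hlow).trans ?_
    have hsplit : Set.Ioo 0 (ℓ + 2 * ε) = Set.Ioo 0 ℓ ∪ Set.Ico ℓ (ℓ + 2 * ε) :=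
      (Set.Ioo_union_Ico_eq_Ioo hℓ0 (by linarith)).symm
    unfold radialE
    rw [hsplit]
    refine (lintegral_union_le _ _ _).trans ?_
    refine add_le_add (le_of_eq ?_) ?_
    · refine setLIntegral_congr_fun measurableSet_Ioo fun r hr => ?_
      have : H =ᶠ[nhds r] h := by
        filter_upwards [eventually_lt_nhds hr.2] with y hy using hHh y hy.le
      simp only [this.deriv_eq, hHh r hr.2.le]
    · have hb : ∀ r ∈ Set.Ico ℓ (ℓ + 2 * ε), ENNReal.ofReal r *
          (‖deriv H r‖ₑ ^ 2 + radialV V r * ‖H r‖ₑ ^ 2 / 2) ≤ ENNReal.ofReal B := by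
        intro r hr
        rw [hV.radialV_eq_zero (hℓ.trans hr.1), zero_mul, ENNReal.zero_div, add_zero, enorm_sq_real,
          ← ENNReal.ofReal_mul (by linarith [hr.1])]
        apply ENNReal.ofReal_le_ofReal
        have hd : deriv H r = -(deriv Real.smoothTransition ((r - ℓ) / ε) / ε) * (h r - 1)
            + κ r * deriv h r := by
          have e1 : HasDerivAt Real.smoothTransition
              (deriv Real.smoothTransition ((r - ℓ) / ε)) ((r - ℓ) / ε) :=
            ((Real.smoothTransition.contDiff (n := 1)).differentiable
              one_ne_zero).differentiableAt.hasDerivAt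
          have e2 : HasDerivAt (fun r => (r - ℓ) / ε) (1 / ε) r :=
            ((hasDerivAt_id r).sub_const ℓ).div_const ε
          have e12 : HasDerivAt (fun r => Real.smoothTransition ((r - ℓ) / ε))
              (deriv Real.smoothTransition ((r - ℓ) / ε) * (1 / ε)) r :=
            HasDerivAt.comp (h := fun r => (r - ℓ) / ε) (h₂ := Real.smoothTransition) r e1 e2
          have e3 : HasDerivAt κ (-(deriv Real.smoothTransition ((r - ℓ) / ε) * (1 / ε))) r :=
            e12.const_sub 1
          have e4 := (hh.differentiable (by simp)).differentiableAt (x := r).hasDerivAt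
          have e5 : HasDerivAt H _ r := (e3.mul (e4.sub_const 1)).const_add 1
          rw [e5.deriv]; ring
        have hmem : r ∈ Set.Icc ℓ (ℓ + 2) := ⟨hr.1, by linarith [hr.2]⟩
        have hM1 := hM r hmem
        rw [Real.norm_eq_abs] at hM1
        have hterm1 : |deriv Real.smoothTransition ((r - ℓ) / ε) / ε * (h r - 1)| ≤ C * M := by
          by_cases hc : 1 < (r - ℓ) / ε
          · rw [smoothTransition_deriv_eq_zero_of_one_lt hc]
            simpa using by positivity
          · have hmv := (convex_Icc ℓ (ℓ + 2)).norm_image_sub_le_of_norm_deriv_le (f := h)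
              (fun x _ => (hh.differentiable (by simp)).differentiableAt) hM
              (show ℓ ∈ Set.Icc ℓ (ℓ + 2) by constructor <;> linarith) hmem
            rw [h1, Real.norm_eq_abs, Real.norm_eq_abs, abs_of_nonneg (sub_nonneg.2 hr.1)] at hmv
            have hre : r - ℓ ≤ ε := by
              rw [not_lt, div_le_one hε0] at hc; exact hc
            rw [abs_mul, abs_div, abs_of_pos hε0]
            calc |deriv Real.smoothTransition ((r - ℓ) / ε)| / ε * |h r - 1|
                ≤ C / ε * (M * ε) := by
                  have := hC ((r - ℓ) / ε)
                  have h3 : |h r - 1| ≤ M * ε := hmv.trans (by gcongr)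
                  gcongr
              _ = C * M := by field_simp
        have hterm2 : |κ r * deriv h r| ≤ M := by
          rw [abs_mul, abs_of_nonneg (hκ01 r).1]
          exact (mul_le_of_le_one_left (abs_nonneg _) (hκ01 r).2).trans hM1
        have habs : |deriv H r| ≤ C * M + M := by
          rw [hd, neg_mul]
          refine (abs_add_le _ _).trans (add_le_add ?_ hterm2)
          rwa [abs_neg]
        rw [hB, ← sq_abs]
        have : r ≤ ℓ + 2 := hmem.2
        have : 0 ≤ r := by linarith [hr.1]
        gcongr
      refine (setLIntegral_mono' measurableSet_Ico hb).trans ?_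
      rw [lintegral_const, Measure.restrict_apply_univ, Real.volume_Ico,
        ← ENNReal.ofReal_mul (by positivity)]
      gcongr; linarith
  refine le_of_tendsto_of_tendsto (b := nhdsWithin (0 : ℝ) (Set.Ioi 0)) ?_ ?_ hev
  · refine ENNReal.tendsto_ofReal (Tendsto.mono_left ?_ nhdsWithin_le_nhds)
    have hlog : 0 < Real.log (ℓ / a) := Real.log_pos ((one_lt_div ha).2 (by linarith))
    have hpos : (ℓ + 2 * 0) / a ≠ 0 := by rw [mul_zero, add_zero]; positivity
    have : ContinuousAt (fun ε : ℝ => 1 / Real.log ((ℓ + 2 * ε) / a)) 0 := by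
      refine continuousAt_const.div (ContinuousAt.log (by fun_prop) hpos) ?_
      rw [mul_zero, add_zero]; exact hlog.ne'
    have := this.tendsto
    simpa using this
  · have : Tendsto (fun ε : ℝ => ENNReal.ofReal (B * (2 * ε))) (nhds 0) (nhds 0) := by
      have h0 : ContinuousAt (fun ε : ℝ => B * (2 * ε)) 0 := by fun_prop
      have := ENNReal.tendsto_ofReal h0.tendsto
      simpa using this
    simpa using (tendsto_const_nhds (x := radialE V h ℓ)).add (this.mono_left nhdsWithin_le_nhds)

lemma radialE_lower_complex {V : Vec 2 → ℝ≥0∞} {a ℓ₀ : ℝ} (hV : ScatteringBound V a ℓ₀)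
    {g : ℝ → ℂ} (hg : ContDiff ℝ (⊤ : ℕ∞) g) {ℓ : ℝ} (hℓ : ℓ₀ ≤ ℓ) :
    ENNReal.ofReal (1 / Real.log (ℓ / a)) * ‖g ℓ‖ₑ ^ 2 ≤ radialE V g ℓ := by
  by_cases h0 : g ℓ = 0
  · simp [h0]
  set h : ℝ → ℝ := fun r => (g r / g ℓ).re with hh
  have hs : ContDiff ℝ (⊤ : ℕ∞) h := Complex.reCLM.contDiff.comp (hg.div_const _)
  have hlow := radialE_lower hV hs hℓ (by simp [hh, h0])
  have hre : ∀ z : ℂ, ‖g ℓ‖ₑ ^ 2 * ‖(z / g ℓ).re‖ₑ ^ 2 ≤ ‖z‖ₑ ^ 2 := by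
    intro z
    rw [← mul_pow]
    gcongr
    rw [← ofReal_norm, ← ofReal_norm, ← ofReal_norm, ← ENNReal.ofReal_mul (norm_nonneg _)]
    apply ENNReal.ofReal_le_ofReal
    calc ‖g ℓ‖ * ‖(z / g ℓ).re‖ ≤ ‖g ℓ‖ * ‖z / g ℓ‖ := by
          gcongr; exact Complex.abs_re_le_norm _
      _ = ‖z‖ := by rw [norm_div]; field_simp
  have hd : ∀ r, deriv h r = (deriv g r / g ℓ).re := by
    intro r
    have e1 := ((hg.differentiable (by simp)).differentiableAt (x := r)).hasDerivAt.div_const (g ℓ)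
    exact (Complex.reCLM.hasFDerivAt.comp_hasDerivAt r e1).deriv
  calc _ ≤ radialE V h ℓ * ‖g ℓ‖ₑ ^ 2 := by gcongr
    _ = ∫⁻ r in Set.Ioo 0 ℓ, (ENNReal.ofReal r * (‖deriv h r‖ₑ ^ 2 + radialV V r * ‖h r‖ₑ ^ 2 / 2))
          * ‖g ℓ‖ₑ ^ 2 := by
        rw [lintegral_mul_const' _ _ (by simp)]; rfl
    _ ≤ radialE V g ℓ := by
        refine lintegral_mono fun r => ?_
        rw [hd]
        calc _ = ENNReal.ofReal r * (‖g ℓ‖ₑ ^ 2 * ‖(deriv g r / g ℓ).re‖ₑ ^ 2 +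
              radialV V r * (‖g ℓ‖ₑ ^ 2 * ‖(g r / g ℓ).re‖ₑ ^ 2) / 2) := by
              simp only [hh, ENNReal.div_eq_inv_mul]; ring
          _ ≤ _ := by gcongr <;> exact hre _

/-- The energy density of a one-particle function `u` in the field of `V`. -/
def gradSq (u : Vec 2 → ℂ) (x : Vec 2) : ℝ≥0∞ := ∑ k, ‖fderiv ℝ u x (Pi.single k 1)‖ₑ ^ 2

lemma measurable_gradSq (u : Vec 2 → ℂ) : Measurable (gradSq u) := by
  refine Finset.measurable_sum _ fun k _ => ?_
  exact (measurable_fderiv_apply_const ℝ u _).enorm.pow_const 2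

lemma enorm_sq_eq_ofReal {E : Type*} [NormedAddCommGroup E] (x : E) :
    ‖x‖ₑ ^ 2 = ENNReal.ofReal (‖x‖ ^ 2) := by
  rw [← ofReal_norm, ← ENNReal.ofReal_pow (norm_nonneg _)]

lemma deriv_polar_enorm_sq_le {u : Vec 2 → ℂ} (hu : Differentiable ℝ u) (r θ : ℝ) :
    ‖deriv (fun r : ℝ => u ![r * cos θ, r * sin θ]) r‖ₑ ^ 2 ≤ gradSq u ![r * cos θ, r * sin θ] := by
  have h1 : HasDerivAt (fun r : ℝ => (![r * cos θ, r * sin θ] : Vec 2)) ![cos θ, sin θ] r := by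
    rw [hasDerivAt_pi]
    intro k
    fin_cases k
    · simpa using (hasDerivAt_id r).mul_const (cos θ)
    · simpa using (hasDerivAt_id r).mul_const (sin θ)
  have h2 := (hu ![r * cos θ, r * sin θ]).hasFDerivAt.comp_hasDerivAt r h1
  have h3 : (![cos θ, sin θ] : Vec 2) = cos θ • Pi.single 0 1 + sin θ • Pi.single 1 1 := by
    ext k; fin_cases k <;> simp
  have h4 : deriv (fun r : ℝ => u ![r * cos θ, r * sin θ]) r = _ := h2.deriv
  rw [h4, h3, map_add, map_smul, map_smul, gradSq, Fin.sum_univ_two]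
  generalize fderiv ℝ u ![r * cos θ, r * sin θ] (Pi.single 0 1) = A
  generalize fderiv ℝ u ![r * cos θ, r * sin θ] (Pi.single 1 1) = B
  simp only [enorm_sq_eq_ofReal]
  rw [← ENNReal.ofReal_add (by positivity) (by positivity)]
  apply ENNReal.ofReal_le_ofReal
  have h5 : ‖cos θ • A + sin θ • B‖ ≤ |cos θ| * ‖A‖ + |sin θ| * ‖B‖ := by
    refine (norm_add_le _ _).trans ?_
    rw [norm_smul, norm_smul, Real.norm_eq_abs, Real.norm_eq_abs]
  have h6 : |sin θ| ^ 2 + |cos θ| ^ 2 = 1 := by rw [sq_abs, sq_abs, sin_sq_add_cos_sq]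
  calc ‖cos θ • A + sin θ • B‖ ^ 2 ≤ (|cos θ| * ‖A‖ + |sin θ| * ‖B‖) ^ 2 := by gcongr
    _ = (|sin θ| ^ 2 + |cos θ| ^ 2) * (‖A‖ ^ 2 + ‖B‖ ^ 2) -
        (|cos θ| * ‖B‖ - |sin θ| * ‖A‖) ^ 2 := by
        ring
    _ ≤ ‖A‖ ^ 2 + ‖B‖ ^ 2 := by rw [h6]; nlinarith [sq_nonneg (|cos θ| * ‖B‖ - |sin θ| * ‖A‖)]

lemma lintegral_ofReal_Ico_half {R : ℝ} (hR : 0 < R) :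
    ∫⁻ r in Set.Ico (R / 2) R, ENNReal.ofReal r = ENNReal.ofReal (3 * R ^ 2 / 8) := by
  have hInt : IntegrableOn (fun r : ℝ => r) (Set.Ico (R / 2) R) :=
    (continuous_id.integrableOn_Icc (a := R / 2) (b := R)).mono_set Set.Ico_subset_Icc_self
  rw [← ofReal_integral_eq_lintegral_ofReal hInt]
  · rw [integral_Ico_eq_integral_Ioc, ← intervalIntegral.integral_of_le (by linarith), integral_id]
    congr 1; ring
  · filter_upwards [ae_restrict_mem measurableSet_Ico] with r hr
    have := hr.1
    simp only [Pi.zero_apply]; linarith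

/-- Dyson's lemma on a disc. -/
lemma dyson_disc {V : Vec 2 → ℝ≥0∞} {a ℓ₀ : ℝ} (hV : ScatteringBound V a ℓ₀)
    {u : Vec 2 → ℂ} (hu : ContDiff ℝ (⊤ : ℕ∞) u) {R : ℝ} (hR : 2 * ℓ₀ ≤ R) :
    ENNReal.ofReal (1 / Real.log (R / a)) * ENNReal.ofReal (8 / (3 * R ^ 2)) *
      ∫⁻ x in {x | rad x < R}, {x | R / 2 ≤ rad x}.indicator (fun x => ‖u x‖ₑ ^ 2) x ≤
    ∫⁻ x in {x | rad x < R}, (gradSq u x + V x * ‖u x‖ₑ ^ 2 / 2) := by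
  have ha := hV.pos
  have hal := hV.lt
  have hR0 : 0 < R := by linarith
  have hcont := hu.continuous
  have hVm := hV.meas
  have hgm := measurable_gradSq u
  have hms : MeasurableSet {x : Vec 2 | R / 2 ≤ rad x} :=
    measurableSet_le measurable_const continuous_rad.measurable
  have hum : Measurable fun x => ‖u x‖ₑ ^ 2 := hcont.measurable.enorm.pow_const 2
  rw [lintegral_polar _ (hum.indicator hms), lintegral_polar _ (by fun_prop),
    ← lintegral_const_mul' _ _ (by finiteness)]
  refine lintegral_mono fun θ => ?_
  set g : ℝ → ℂ := fun r => u ![r * cos θ, r * sin θ] with hg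
  have hgs : ContDiff ℝ (⊤ : ℕ∞) g := by
    refine hu.comp (contDiff_pi.2 fun k => ?_)
    fin_cases k <;> simp <;> fun_prop
  have hE : radialE V g R ≤ ∫⁻ r in Set.Ioo 0 R, ENNReal.ofReal r *
      (gradSq u ![r * cos θ, r * sin θ] + V ![r * cos θ, r * sin θ] *
        ‖u ![r * cos θ, r * sin θ]‖ₑ ^ 2 / 2) := by
    refine setLIntegral_mono' measurableSet_Ioo fun r hr => ?_
    have h1 := deriv_polar_enorm_sq_le (hu.differentiable (by simp)) r θ
    have h2 : V ![r * cos θ, r * sin θ] = radialV V r := by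
      rw [← radialV_rad hV.radial, rad_polar hr.1.le]
    rw [h2]
    gcongr
  refine le_trans ?_ hE
  have hpt : ∀ r ∈ Set.Ioo 0 R, ENNReal.ofReal (1 / Real.log (R / a)) * (ENNReal.ofReal r *
      {x : Vec 2 | R / 2 ≤ rad x}.indicator (fun x => ‖u x‖ₑ ^ 2) ![r * cos θ, r * sin θ]) ≤
      (Set.Ico (R / 2) R).indicator (fun r => ENNReal.ofReal r) r * radialE V g R := by
    intro r hr
    by_cases h : R / 2 ≤ r
    · rw [Set.indicator_of_mem (by simpa [rad_polar hr.1.le] using h),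
        Set.indicator_of_mem (by exact ⟨h, hr.2⟩)]
      have h1 := radialE_lower_complex hV hgs (show ℓ₀ ≤ r by linarith)
      have h2 : radialE V g r ≤ radialE V g R :=
        lintegral_mono' (Measure.restrict_mono (Set.Ioo_subset_Ioo_right hr.2.le) le_rfl) le_rfl
      have h3 : ENNReal.ofReal (1 / Real.log (R / a)) ≤ ENNReal.ofReal (1 / Real.log (r / a)) := by
        apply ENNReal.ofReal_le_ofReal
        have hr0 := hr.1
        have : 0 < Real.log (r / a) := Real.log_pos ((one_lt_div ha).2 (by linarith))
        have h4 : r / a ≤ R / a := by have := hr.2.le; gcongr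
        gcongr
      calc _ = ENNReal.ofReal r * (ENNReal.ofReal (1 / Real.log (R / a)) * ‖g r‖ₑ ^ 2) := by
            simp only [hg]; ring
        _ ≤ ENNReal.ofReal r * (ENNReal.ofReal (1 / Real.log (r / a)) * ‖g r‖ₑ ^ 2) := by gcongr
        _ ≤ ENNReal.ofReal r * radialE V g R := by gcongr; exact h1.trans h2
    · rw [Set.indicator_of_notMem (by simpa [rad_polar hr.1.le] using h)]
      simp
  calc _ = ENNReal.ofReal (8 / (3 * R ^ 2)) * ∫⁻ r in Set.Ioo 0 R,
        ENNReal.ofReal (1 / Real.log (R / a)) * (ENNReal.ofReal r *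
      {x : Vec 2 | R / 2 ≤ rad x}.indicator (fun x => ‖u x‖ₑ ^ 2) ![r * cos θ, r * sin θ]) := by
        rw [lintegral_const_mul' _ _ ENNReal.ofReal_ne_top]; ring
    _ ≤ ENNReal.ofReal (8 / (3 * R ^ 2)) * ∫⁻ r in Set.Ioo 0 R,
        (Set.Ico (R / 2) R).indicator (fun r => ENNReal.ofReal r) r * radialE V g R := by
        refine mul_le_mul_right ?_ _
        exact setLIntegral_mono' measurableSet_Ioo hpt
    _ ≤ ENNReal.ofReal (8 / (3 * R ^ 2)) * (ENNReal.ofReal (3 * R ^ 2 / 8) * radialE V g R) := by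
        refine mul_le_mul_right ?_ _
        have hm : Measurable ((Set.Ico (R / 2) R).indicator fun r => ENNReal.ofReal r) :=
          ENNReal.measurable_ofReal.indicator measurableSet_Ico
        rw [lintegral_mul_const _ hm]
        gcongr
        rw [← lintegral_ofReal_Ico_half hR0, ← lintegral_indicator measurableSet_Ico]
        exact lintegral_mono' Measure.restrict_le_self le_rfl
    _ = radialE V g R := by
        rw [← mul_assoc, ← ENNReal.ofReal_mul (by positivity)]
        have : 8 / (3 * R ^ 2) * (3 * R ^ 2 / 8) = 1 := by field_simp
        rw [this, ENNReal.ofReal_one, one_mul]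

/-- The half-open square with lower corner `p` and side `L`. -/
def square (p : Vec 2) (L : ℝ) : Set (Vec 2) := Set.univ.pi fun k => Set.Ico (p k) (p k + L)

lemma measurableSet_square (p : Vec 2) (L : ℝ) : MeasurableSet (square p L) :=
  MeasurableSet.univ_pi fun _ => measurableSet_Ico

lemma volume_square (p : Vec 2) {L : ℝ} (hL : 0 ≤ L) :
    volume (square p L) = ENNReal.ofReal (L ^ 2) := by
  rw [square, volume_pi_pi]
  simp [← ENNReal.ofReal_mul hL, sq]

lemma lintegral_square (p : Vec 2) (L : ℝ) {F : Vec 2 → ℝ≥0∞} (hF : Measurable F) :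
    ∫⁻ x in square p L, F x = ∫⁻ s in Set.Ico (p 0) (p 0 + L), ∫⁻ t in Set.Ico (p 1) (p 1 + L),
      F ![s, t] := by
  rw [← lintegral_indicator (measurableSet_square p L), lintegral_vec2]
  have hm : Measurable fun q : ℝ × ℝ => (![q.1, q.2] : Vec 2) := by
    refine measurable_pi_iff.2 fun k => ?_
    fin_cases k <;> simp <;> fun_prop
  have h : ∀ q : ℝ × ℝ, (square p L).indicator F ![q.1, q.2] =
      ((Set.Ico (p 0) (p 0 + L)) ×ˢ (Set.Ico (p 1) (p 1 + L))).indicator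
        (fun q => F ![q.1, q.2]) q := by
    intro q
    have : (![q.1, q.2] : Vec 2) ∈ square p L ↔
        q ∈ Set.Ico (p 0) (p 0 + L) ×ˢ Set.Ico (p 1) (p 1 + L) := by
      simp [square, Set.mem_pi, Fin.forall_fin_two]
    by_cases hq : q ∈ Set.Ico (p 0) (p 0 + L) ×ˢ Set.Ico (p 1) (p 1 + L)
    · rw [Set.indicator_of_mem hq, Set.indicator_of_mem (this.2 hq)]
    · rw [Set.indicator_of_notMem hq, Set.indicator_of_notMem (mt this.1 hq)]
  simp_rw [h]
  rw [lintegral_indicator (measurableSet_Ico.prod measurableSet_Ico), Measure.volume_eq_prod,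
    ← Measure.prod_restrict, lintegral_prod (fun q : ℝ × ℝ => F ![q.1, q.2])
      (hF.comp hm).aemeasurable]

lemma enorm_sub_sq_le_interval {g : ℝ → ℂ} (hg : ContDiff ℝ 1 g) {p L s t : ℝ}
    (hs : s ∈ Set.Ico p (p + L)) (ht : t ∈ Set.Ico p (p + L)) :
    ‖g s - g t‖ₑ ^ 2 ≤ ENNReal.ofReal L * ∫⁻ r in Set.Ico p (p + L), ‖deriv g r‖ₑ ^ 2 := by
  have hc : Continuous (deriv g) := hg.continuous_deriv le_rfl
  have h1 : g s - g t = ∫ r in t..s, deriv g r := by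
    rw [intervalIntegral.integral_deriv_eq_sub (fun r _ => (hg.differentiable (by simp)) r)
      (hc.intervalIntegrable _ _)]
  have hsub : Set.uIoc t s ⊆ Set.Ico p (p + L) := by
    intro r hr
    rw [Set.uIoc, Set.mem_Ioc] at hr
    exact ⟨(le_min ht.1 hs.1).trans hr.1.le, hr.2.trans_lt (max_lt ht.2 hs.2)⟩
  have h2 : ‖g s - g t‖ₑ ≤ ∫⁻ r in Set.Ico p (p + L), ‖deriv g r‖ₑ := by
    have : ‖g s - g t‖ₑ = ‖∫ r in Set.uIoc t s, deriv g r‖ₑ := by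
      rw [h1, ← ofReal_norm, ← ofReal_norm, intervalIntegral.norm_intervalIntegral_eq]
    rw [this]
    exact (enorm_integral_le_lintegral_enorm _).trans (lintegral_mono_set hsub)
  have h3 := ENNReal.lintegral_mul_le_Lp_mul_Lq (volume.restrict (Set.Ico p (p + L)))
    Real.HolderConjugate.two_two (f := fun _ => 1) (g := fun r => ‖deriv g r‖ₑ)
    aemeasurable_const hc.measurable.enorm.aemeasurable
  simp only [Pi.mul_apply, one_mul, ENNReal.one_rpow, lintegral_const, Measure.restrict_apply,
    MeasurableSet.univ, Set.univ_inter, Real.volume_Ico] at h3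
  have h4 : ∀ x : ℝ≥0∞, (x ^ (1 / 2 : ℝ)) ^ 2 = x := fun x => by
    rw [← ENNReal.rpow_natCast, ← ENNReal.rpow_mul]; norm_num
  calc _ ≤ _ := pow_le_pow_left' (h2.trans h3) 2
    _ = _ := by
      rw [mul_pow, h4, h4]
      simp

lemma enorm_add_sq_le {E : Type*} [NormedAddCommGroup E] {s : ℝ} (hs : 0 < s) (x y : E) :
    ‖x + y‖ₑ ^ 2 ≤ ENNReal.ofReal (1 + s) * ‖x‖ₑ ^ 2 + ENNReal.ofReal (1 + 1 / s) * ‖y‖ₑ ^ 2 := by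
  simp only [enorm_sq_eq_ofReal]
  rw [← ENNReal.ofReal_mul (by positivity), ← ENNReal.ofReal_mul (by positivity),
    ← ENNReal.ofReal_add (by positivity) (by positivity)]
  refine ENNReal.ofReal_le_ofReal (le_trans ?_ (sq_add_le_weighted hs _ _))
  gcongr
  exact norm_add_le x y

lemma lintegral_lintegral_enorm_sub_sq_le {g : ℝ → ℂ} (hg : ContDiff ℝ 1 g) (p : ℝ) {L : ℝ}
    (hL : 0 ≤ L) :
    ∫⁻ s in Set.Ico p (p + L), ∫⁻ t in Set.Ico p (p + L), ‖g s - g t‖ₑ ^ 2 ≤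
      ENNReal.ofReal (L ^ 3) * ∫⁻ r in Set.Ico p (p + L), ‖deriv g r‖ₑ ^ 2 := by
  calc _ ≤ ∫⁻ s in Set.Ico p (p + L), ∫⁻ t in Set.Ico p (p + L),
        ENNReal.ofReal L * ∫⁻ r in Set.Ico p (p + L), ‖deriv g r‖ₑ ^ 2 :=
        setLIntegral_mono' measurableSet_Ico fun s hs =>
          setLIntegral_mono' measurableSet_Ico fun t ht => enorm_sub_sq_le_interval hg hs ht
    _ = _ := by
        simp only [lintegral_const, Measure.restrict_apply, MeasurableSet.univ, Set.univ_inter,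
          Real.volume_Ico, add_sub_cancel_left]
        rw [show L ^ 3 = L * L * L by ring, ENNReal.ofReal_mul (by positivity),
          ENNReal.ofReal_mul hL]
        ring

lemma measurable_vecCons {α : Type*} [MeasurableSpace α] {f g : α → ℝ} (hf : Measurable f)
    (hg : Measurable g) : Measurable fun q => (![f q, g q] : Vec 2) := by
  refine measurable_pi_iff.2 fun k => ?_
  fin_cases k
  · exact hf
  · exact hg

lemma deriv_vecCons_left {u : Vec 2 → ℂ} (hu : Differentiable ℝ u) (s t : ℝ) :
    deriv (fun s => u ![s, t]) s = fderiv ℝ u ![s, t] (Pi.single 0 1) := by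
  have h1 : HasDerivAt (fun s : ℝ => (![s, t] : Vec 2)) (Pi.single 0 1) s := by
    rw [hasDerivAt_pi]
    intro k
    fin_cases k
    · exact hasDerivAt_id s
    · exact hasDerivAt_const s t
  exact ((hu _).hasFDerivAt.comp_hasDerivAt s h1).deriv

lemma deriv_vecCons_right {u : Vec 2 → ℂ} (hu : Differentiable ℝ u) (s t : ℝ) :
    deriv (fun t => u ![s, t]) t = fderiv ℝ u ![s, t] (Pi.single 1 1) := by
  have h1 : HasDerivAt (fun t : ℝ => (![s, t] : Vec 2)) (Pi.single 1 1) t := by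
    rw [hasDerivAt_pi]
    intro k
    fin_cases k
    · exact hasDerivAt_const t s
    · exact hasDerivAt_id t
  exact ((hu _).hasFDerivAt.comp_hasDerivAt t h1).deriv

/-- A Poincaré inequality on the square, in the form of a double integral. -/
lemma poincare_square {u : Vec 2 → ℂ} (hu : ContDiff ℝ (⊤ : ℕ∞) u) (p : Vec 2) {L : ℝ}
    (hL : 0 ≤ L) :
    ∫⁻ x in square p L, ∫⁻ y in square p L, ‖u x - u y‖ₑ ^ 2 ≤
      ENNReal.ofReal (2 * L ^ 4) * ∫⁻ x in square p L, gradSq u x := by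
  have hd : Differentiable ℝ u := hu.differentiable (by simp)
  have hum : Measurable u := hu.continuous.measurable
  set I := Set.Ico (p 0) (p 0 + L) with hI
  set J := Set.Ico (p 1) (p 1 + L) with hJ
  have hpt : ∀ s t s' t', ‖u ![s, t] - u ![s', t']‖ₑ ^ 2 ≤
      2 * ‖u ![s, t] - u ![s', t]‖ₑ ^ 2 + 2 * ‖u ![s', t] - u ![s', t']‖ₑ ^ 2 := by
    intro s t s' t'
    have := enorm_add_sq_le one_pos (u ![s, t] - u ![s', t]) (u ![s', t] - u ![s', t'])
    rw [sub_add_sub_cancel] at this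
    norm_num at this
    exact this
  have hm1 : Measurable fun q : ((ℝ × ℝ) × ℝ) × ℝ =>
      ‖u ![q.1.1.1, q.1.1.2] - u ![q.1.2, q.1.1.2]‖ₑ ^ 2 := by
    refine Measurable.pow_const (Measurable.enorm (Measurable.sub ?_ ?_)) 2 <;>
    exact hum.comp (measurable_vecCons (by fun_prop) (by fun_prop))
  have hslice0 : ∀ t, ContDiff ℝ 1 fun s => u ![s, t] := fun t =>
    (hu.of_le (by simp)).comp (contDiff_pi.2 fun k => by fin_cases k <;> simp <;> fun_prop)
  have hslice1 : ∀ s, ContDiff ℝ 1 fun t => u ![s, t] := fun s =>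
    (hu.of_le (by simp)).comp (contDiff_pi.2 fun k => by fin_cases k <;> simp <;> fun_prop)
  have hvol : volume J = ENNReal.ofReal L := by simp [hJ]
  have hvolI : volume I = ENNReal.ofReal L := by simp [hI]
  have hpow : ENNReal.ofReal (2 * L ^ 4) =
      2 * (ENNReal.ofReal L * ENNReal.ofReal (L ^ 3)) := by
    rw [← ENNReal.ofReal_mul hL, ENNReal.ofReal_mul (by norm_num)]
    norm_num; ring_nf
  have hmg : ∀ k : Fin 2, Measurable fun x => ‖fderiv ℝ u x (Pi.single k 1)‖ₑ ^ 2 := fun k =>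
    (measurable_fderiv_apply_const ℝ u _).enorm.pow_const 2
  have hA : ∫⁻ s in I, ∫⁻ t in J, ∫⁻ s' in I, ∫⁻ t' in J, ‖u ![s, t] - u ![s', t]‖ₑ ^ 2 ≤
      ENNReal.ofReal L * ENNReal.ofReal (L ^ 3) *
        ∫⁻ x in square p L, ‖fderiv ℝ u x (Pi.single 0 1)‖ₑ ^ 2 := by
    have hmm : Measurable fun q : (ℝ × ℝ) × ℝ => ‖u ![q.1.1, q.1.2] - u ![q.2, q.1.2]‖ₑ ^ 2 := by
      refine Measurable.pow_const (Measurable.enorm (Measurable.sub ?_ ?_)) 2 <;>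
      exact hum.comp (measurable_vecCons (by fun_prop) (by fun_prop))
    calc _ = ∫⁻ s in I, ∫⁻ t in J, ENNReal.ofReal L *
          ∫⁻ s' in I, ‖u ![s, t] - u ![s', t]‖ₑ ^ 2 := by
          simp only [lintegral_const, Measure.restrict_apply, MeasurableSet.univ, Set.univ_inter,
            hvol]
          refine lintegral_congr fun s => lintegral_congr fun t => ?_
          rw [lintegral_mul_const' _ _ ENNReal.ofReal_ne_top, mul_comm]
      _ = ENNReal.ofReal L * ∫⁻ s in I, ∫⁻ t in J,
          ∫⁻ s' in I, ‖u ![s, t] - u ![s', t]‖ₑ ^ 2 := by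
          simp only [lintegral_const_mul' _ _ ENNReal.ofReal_ne_top]
      _ = ENNReal.ofReal L * ∫⁻ t in J, ∫⁻ s in I,
          ∫⁻ s' in I, ‖u ![s, t] - u ![s', t]‖ₑ ^ 2 := by
          rw [lintegral_lintegral_swap]
          exact (hmm.lintegral_prod_right' (ν := volume.restrict I)).aemeasurable
      _ ≤ ENNReal.ofReal L * ∫⁻ t in J, ENNReal.ofReal (L ^ 3) *
          ∫⁻ s in I, ‖fderiv ℝ u ![s, t] (Pi.single 0 1)‖ₑ ^ 2 := by
          refine mul_le_mul_right (lintegral_mono fun t => ?_) _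
          have := lintegral_lintegral_enorm_sub_sq_le (hslice0 t) (p 0) hL
          simpa only [deriv_vecCons_left hd] using this
      _ = _ := by
          rw [lintegral_const_mul' _ _ ENNReal.ofReal_ne_top, ← mul_assoc,
            lintegral_square p L (hmg 0), lintegral_lintegral_swap]
          exact ((hmg 0).comp (measurable_vecCons measurable_snd measurable_fst)).aemeasurable
  have hB : ∫⁻ s in I, ∫⁻ t in J, ∫⁻ s' in I, ∫⁻ t' in J, ‖u ![s', t] - u ![s', t']‖ₑ ^ 2 ≤
      ENNReal.ofReal L * ENNReal.ofReal (L ^ 3) *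
        ∫⁻ x in square p L, ‖fderiv ℝ u x (Pi.single 1 1)‖ₑ ^ 2 := by
    have hmm : Measurable fun q : (ℝ × ℝ) × ℝ => ‖u ![q.1.2, q.1.1] - u ![q.1.2, q.2]‖ₑ ^ 2 := by
      refine Measurable.pow_const (Measurable.enorm (Measurable.sub ?_ ?_)) 2 <;>
      exact hum.comp (measurable_vecCons (by fun_prop) (by fun_prop))
    calc _ = ENNReal.ofReal L * ∫⁻ t in J, ∫⁻ s' in I, ∫⁻ t' in J,
          ‖u ![s', t] - u ![s', t']‖ₑ ^ 2 := by
          rw [lintegral_const, Measure.restrict_apply MeasurableSet.univ, Set.univ_inter, hvolI,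
            mul_comm]
      _ = ENNReal.ofReal L * ∫⁻ s' in I, ∫⁻ t in J, ∫⁻ t' in J,
          ‖u ![s', t] - u ![s', t']‖ₑ ^ 2 := by
          rw [lintegral_lintegral_swap]
          exact (hmm.lintegral_prod_right' (ν := volume.restrict J)).aemeasurable
      _ ≤ ENNReal.ofReal L * ∫⁻ s in I, ENNReal.ofReal (L ^ 3) *
          ∫⁻ t in J, ‖fderiv ℝ u ![s, t] (Pi.single 1 1)‖ₑ ^ 2 := by
          refine mul_le_mul_right (lintegral_mono fun s => ?_) _
          have := lintegral_lintegral_enorm_sub_sq_le (hslice1 s) (p 1) hL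
          simpa only [deriv_vecCons_right hd] using this
      _ = _ := by
          rw [lintegral_const_mul' _ _ ENNReal.ofReal_ne_top, ← mul_assoc,
            lintegral_square p L (hmg 1)]
  have hmx : ∀ x, Measurable fun y => ‖u x - u y‖ₑ ^ 2 := fun x =>
    (measurable_const.sub hum).enorm.pow_const 2
  have hmm2 : Measurable fun q : Vec 2 × Vec 2 => ‖u q.1 - u q.2‖ₑ ^ 2 :=
    ((hum.comp measurable_fst).sub (hum.comp measurable_snd)).enorm.pow_const 2
  calc _ = ∫⁻ s in I, ∫⁻ t in J, ∫⁻ s' in I, ∫⁻ t' in J, ‖u ![s, t] - u ![s', t']‖ₑ ^ 2 := by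
        rw [lintegral_square p L (hmm2.lintegral_prod_right' (ν := volume.restrict (square p L)))]
        simp_rw [lintegral_square p L (hmx _)]
        rfl
    _ ≤ ∫⁻ s in I, ∫⁻ t in J, ∫⁻ s' in I, ∫⁻ t' in J,
        (2 * ‖u ![s, t] - u ![s', t]‖ₑ ^ 2 + 2 * ‖u ![s', t] - u ![s', t']‖ₑ ^ 2) := by
        gcongr with s t s' t'
        exact hpt _ _ _ _
    _ = 2 * (∫⁻ s in I, ∫⁻ t in J, ∫⁻ s' in I, ∫⁻ t' in J, ‖u ![s, t] - u ![s', t]‖ₑ ^ 2) +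
        2 * (∫⁻ s in I, ∫⁻ t in J, ∫⁻ s' in I, ∫⁻ t' in J, ‖u ![s', t] - u ![s', t']‖ₑ ^ 2) := by
        have e1 : ∀ s t s', ∫⁻ t' in J,
            (2 * ‖u ![s, t] - u ![s', t]‖ₑ ^ 2 + 2 * ‖u ![s', t] - u ![s', t']‖ₑ ^ 2) =
            (∫⁻ t' in J, 2 * ‖u ![s, t] - u ![s', t]‖ₑ ^ 2) +
            ∫⁻ t' in J, 2 * ‖u ![s', t] - u ![s', t']‖ₑ ^ 2 := fun s t s' =>
          lintegral_add_left measurable_const _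
        have g3 : Measurable fun q : (ℝ × ℝ) × ℝ =>
            ∫⁻ t' in J, 2 * ‖u ![q.1.1, q.1.2] - u ![q.2, q.1.2]‖ₑ ^ 2 :=
          (hm1.const_mul 2).lintegral_prod_right' (ν := volume.restrict J)
        have e2 : ∀ s t, ∫⁻ s' in I, ((∫⁻ t' in J, 2 * ‖u ![s, t] - u ![s', t]‖ₑ ^ 2) +
            ∫⁻ t' in J, 2 * ‖u ![s', t] - u ![s', t']‖ₑ ^ 2) =
            (∫⁻ s' in I, ∫⁻ t' in J, 2 * ‖u ![s, t] - u ![s', t]‖ₑ ^ 2) +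
            ∫⁻ s' in I, ∫⁻ t' in J, 2 * ‖u ![s', t] - u ![s', t']‖ₑ ^ 2 := fun s t =>
          lintegral_add_left (g3.comp (measurable_prodMk_left (x := (s, t)))) _
        have g2 : Measurable fun q : ℝ × ℝ => ∫⁻ s' in I,
            ∫⁻ t' in J, 2 * ‖u ![q.1, q.2] - u ![s', q.2]‖ₑ ^ 2 :=
          g3.lintegral_prod_right' (ν := volume.restrict I)
        have e3 : ∀ s, ∫⁻ t in J, ((∫⁻ s' in I, ∫⁻ t' in J, 2 * ‖u ![s, t] - u ![s', t]‖ₑ ^ 2) +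
            ∫⁻ s' in I, ∫⁻ t' in J, 2 * ‖u ![s', t] - u ![s', t']‖ₑ ^ 2) =
            (∫⁻ t in J, ∫⁻ s' in I, ∫⁻ t' in J, 2 * ‖u ![s, t] - u ![s', t]‖ₑ ^ 2) +
            ∫⁻ t in J, ∫⁻ s' in I, ∫⁻ t' in J, 2 * ‖u ![s', t] - u ![s', t']‖ₑ ^ 2 := fun s =>
          lintegral_add_left (g2.comp (measurable_prodMk_left (x := s))) _
        have g1 : Measurable fun s : ℝ => ∫⁻ t in J, ∫⁻ s' in I,
            ∫⁻ t' in J, 2 * ‖u ![s, t] - u ![s', t]‖ₑ ^ 2 :=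
          g2.lintegral_prod_right' (ν := volume.restrict J)
        simp_rw [e1, e2, e3]
        rw [lintegral_add_left g1]
        simp only [lintegral_const_mul' _ _ ENNReal.ofNat_ne_top]
    _ ≤ _ := by
        refine (add_le_add (mul_le_mul_right hA _) (mul_le_mul_right hB _)).trans_eq ?_
        simp only [gradSq, Fin.sum_univ_two]
        rw [lintegral_add_left (hmg 0), hpow]
        ring

lemma weighted_double_le {u : Vec 2 → ℂ} (hu : ContDiff ℝ (⊤ : ℕ∞) u) (p : Vec 2) {L : ℝ}
    (hL : 0 ≤ L) {W : Vec 2 → ℝ≥0∞} {M : ℝ≥0∞} (hWM : ∀ x, W x ≤ M) (hMtop : M ≠ ⊤) :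
    ∫⁻ x in square p L, ∫⁻ y in square p L, W x * ‖u x - u y‖ₑ ^ 2 ≤
      M * ENNReal.ofReal (2 * L ^ 4) * ∫⁻ x in square p L, gradSq u x := by
  calc _ ≤ ∫⁻ x in square p L, ∫⁻ y in square p L, M * ‖u x - u y‖ₑ ^ 2 := by
        gcongr with x y
        exact hWM x
    _ = M * ∫⁻ x in square p L, ∫⁻ y in square p L, ‖u x - u y‖ₑ ^ 2 := by
        simp only [lintegral_const_mul' _ _ hMtop]
    _ ≤ _ := by
        rw [mul_assoc]
        exact mul_le_mul_right (poincare_square hu p hL) _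

lemma lintegral_weight_le {u : Vec 2 → ℂ} (hu : ContDiff ℝ (⊤ : ℕ∞) u) (p : Vec 2) {L η : ℝ}
    (hL : 0 ≤ L) (hη : 0 < η) {W : Vec 2 → ℝ≥0∞} (hW : Measurable W) {M : ℝ≥0∞}
    (hWM : ∀ x, W x ≤ M) (hMtop : M ≠ ⊤) :
    (∫⁻ x in square p L, W x) * ∫⁻ x in square p L, ‖u x‖ₑ ^ 2 ≤
      ENNReal.ofReal (1 + η) * ENNReal.ofReal (L ^ 2) * (∫⁻ x in square p L, W x * ‖u x‖ₑ ^ 2) +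
      ENNReal.ofReal (1 + 1 / η) * (M * ENNReal.ofReal (2 * L ^ 4) *
        ∫⁻ x in square p L, gradSq u x) := by
  have hum : Measurable u := hu.continuous.measurable
  have hn : Measurable fun x => ‖u x‖ₑ ^ 2 := hum.enorm.pow_const 2
  have hmm2 : Measurable fun q : Vec 2 × Vec 2 => ‖u q.1 - u q.2‖ₑ ^ 2 :=
    ((hum.comp measurable_fst).sub (hum.comp measurable_snd)).enorm.pow_const 2
  have hm1 : Measurable fun q : Vec 2 × Vec 2 =>
      ENNReal.ofReal (1 + η) * (W q.1 * ‖u q.1‖ₑ ^ 2) :=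
    (((hW.comp measurable_fst).mul (hn.comp measurable_fst)).const_mul _)
  calc _ = ∫⁻ x in square p L, ∫⁻ y in square p L, W x * ‖u y‖ₑ ^ 2 := by
        rw [← lintegral_mul_const _ hW]
        refine lintegral_congr fun x => ?_
        rw [lintegral_const_mul _ hn]
    _ ≤ ∫⁻ x in square p L, ∫⁻ y in square p L,
        (ENNReal.ofReal (1 + η) * (W x * ‖u x‖ₑ ^ 2) +
          ENNReal.ofReal (1 + 1 / η) * (W x * ‖u x - u y‖ₑ ^ 2)) := by
        gcongr with x y
        have h := enorm_add_sq_le hη (u x) (u y - u x)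
        rw [add_sub_cancel] at h
        rw [← enorm_neg (u y - u x), neg_sub] at h
        refine (mul_le_mul_right h _).trans_eq ?_
        ring
    _ = (∫⁻ x in square p L, ∫⁻ y in square p L,
          ENNReal.ofReal (1 + η) * (W x * ‖u x‖ₑ ^ 2)) +
        ∫⁻ x in square p L, ∫⁻ y in square p L,
          ENNReal.ofReal (1 + 1 / η) * (W x * ‖u x - u y‖ₑ ^ 2) := by
        rw [← lintegral_add_left (hm1.lintegral_prod_right' (ν := volume.restrict (square p L)))]
        refine lintegral_congr fun x => ?_
        rw [lintegral_add_left measurable_const]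
    _ ≤ _ := by
        gcongr ?_ + ?_
        · simp only [lintegral_const, Measure.restrict_apply, MeasurableSet.univ, Set.univ_inter,
            volume_square p hL]
          rw [lintegral_mul_const _ (by fun_prop), lintegral_const_mul _ (by fun_prop)]
          apply le_of_eq
          ring
        · simp only [lintegral_const_mul' _ _ ENNReal.ofReal_ne_top]
          exact mul_le_mul_right (weighted_double_le hu p hL hWM hMtop) _

lemma lintegral_weight_ge {u : Vec 2 → ℂ} (hu : ContDiff ℝ (⊤ : ℕ∞) u) (p : Vec 2) {L η : ℝ}
    (hL : 0 ≤ L) (hη : 0 < η) {W : Vec 2 → ℝ≥0∞} (hW : Measurable W) {M : ℝ≥0∞}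
    (hWM : ∀ x, W x ≤ M) (hMtop : M ≠ ⊤) :
    ENNReal.ofReal (L ^ 2) * (∫⁻ x in square p L, W x * ‖u x‖ₑ ^ 2) ≤
      ENNReal.ofReal (1 + η) * ((∫⁻ x in square p L, W x) * ∫⁻ x in square p L, ‖u x‖ₑ ^ 2) +
      ENNReal.ofReal (1 + 1 / η) * (M * ENNReal.ofReal (2 * L ^ 4) *
        ∫⁻ x in square p L, gradSq u x) := by
  have hum : Measurable u := hu.continuous.measurable
  have hn : Measurable fun x => ‖u x‖ₑ ^ 2 := hum.enorm.pow_const 2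
  have hm1 : Measurable fun q : Vec 2 × Vec 2 =>
      ENNReal.ofReal (1 + η) * (W q.1 * ‖u q.2‖ₑ ^ 2) :=
    (((hW.comp measurable_fst).mul (hn.comp measurable_snd)).const_mul _)
  calc _ = ∫⁻ x in square p L, ∫⁻ y in square p L, W x * ‖u x‖ₑ ^ 2 := by
        simp only [lintegral_const, Measure.restrict_apply, MeasurableSet.univ, Set.univ_inter,
            volume_square p hL]
        rw [lintegral_mul_const _ (by fun_prop), mul_comm]
    _ ≤ ∫⁻ x in square p L, ∫⁻ y in square p L,
        (ENNReal.ofReal (1 + η) * (W x * ‖u y‖ₑ ^ 2) +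
          ENNReal.ofReal (1 + 1 / η) * (W x * ‖u x - u y‖ₑ ^ 2)) := by
        gcongr with x y
        have h := enorm_add_sq_le hη (u y) (u x - u y)
        rw [add_sub_cancel] at h
        refine (mul_le_mul_right h _).trans_eq ?_
        ring
    _ = (∫⁻ x in square p L, ∫⁻ y in square p L,
          ENNReal.ofReal (1 + η) * (W x * ‖u y‖ₑ ^ 2)) +
        ∫⁻ x in square p L, ∫⁻ y in square p L,
          ENNReal.ofReal (1 + 1 / η) * (W x * ‖u x - u y‖ₑ ^ 2) := by
        rw [← lintegral_add_left (hm1.lintegral_prod_right' (ν := volume.restrict (square p L)))]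
        refine lintegral_congr fun x => ?_
        exact lintegral_add_left (hm1.comp (measurable_prodMk_left (x := x))) _
    _ ≤ _ := by
        gcongr ?_ + ?_
        · simp only [lintegral_const_mul' _ _ ENNReal.ofReal_ne_top]
          refine mul_le_mul_right ?_ _
          rw [← lintegral_mul_const _ hW]
          refine lintegral_mono fun x => ?_
          rw [lintegral_const_mul _ hn]
        · simp only [lintegral_const_mul' _ _ ENNReal.ofReal_ne_top]
          exact mul_le_mul_right (weighted_double_le hu p hL hWM hMtop) _

lemma measurableSet_disc (y : Vec 2) (R : ℝ) : MeasurableSet {x : Vec 2 | rad (x - y) < R} :=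
  measurableSet_lt (continuous_rad.comp (continuous_id.sub continuous_const)).measurable
    measurable_const

lemma setLIntegral_disc_eq (F : Vec 2 → ℝ≥0∞) (y : Vec 2) (R : ℝ) :
    ∫⁻ x in {x | rad (x - y) < R}, F x = ∫⁻ z in {z | rad z < R}, F (z + y) := by
  have h0 := measurableSet_disc 0 R
  simp only [sub_zero] at h0
  rw [← lintegral_indicator (measurableSet_disc y R), ← lintegral_indicator h0,
    ← lintegral_add_right_eq_self _ y]
  refine lintegral_congr fun z => ?_
  simp [Set.indicator_apply]

lemma gradSq_comp_add_right (u : Vec 2 → ℂ) (y z : Vec 2) :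
    gradSq (fun z => u (z + y)) z = gradSq u (z + y) := by
  simp only [gradSq, fderiv_comp_add_right]

/-- Dyson's lemma on a disc centred at `y`. -/
lemma dyson_disc_translate {V : Vec 2 → ℝ≥0∞} {a ℓ₀ : ℝ} (hV : ScatteringBound V a ℓ₀)
    {u : Vec 2 → ℂ} (hu : ContDiff ℝ (⊤ : ℕ∞) u) {R : ℝ} (hR : 2 * ℓ₀ ≤ R) (y : Vec 2) :
    ENNReal.ofReal (1 / Real.log (R / a)) * ENNReal.ofReal (8 / (3 * R ^ 2)) *
      ∫⁻ x in {x | rad (x - y) < R}, {x | R / 2 ≤ rad (x - y)}.indicator (fun x => ‖u x‖ₑ ^ 2) x ≤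
    ∫⁻ x in {x | rad (x - y) < R}, (gradSq u x + V (x - y) * ‖u x‖ₑ ^ 2 / 2) := by
  rw [setLIntegral_disc_eq, setLIntegral_disc_eq]
  have h := dyson_disc hV (u := fun z => u (z + y))
    (hu.comp (contDiff_id.add contDiff_const)) hR
  simp only [gradSq_comp_add_right] at h
  simpa [Set.indicator_apply] using h

lemma lintegral_annulus {R : ℝ} (hR : 0 < R) :
    ∫⁻ z in {z : Vec 2 | rad z < R}, {z | R / 2 ≤ rad z}.indicator (fun _ => 1) z =
      ENNReal.ofReal (2 * π) * ENNReal.ofReal (3 * R ^ 2 / 8) := by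
  have h := lintegral_radial ((Set.Ici (R / 2)).indicator fun _ => 1)
    (measurable_const.indicator measurableSet_Ici) R
  have e : ∀ z : Vec 2, {z | R / 2 ≤ rad z}.indicator (fun _ => (1 : ℝ≥0∞)) z =
      (Set.Ici (R / 2)).indicator (fun _ => 1) (rad z) := fun z => by
    simp [Set.indicator_apply]
  simp_rw [e, h]
  congr 1
  rw [← lintegral_ofReal_Ico_half hR, ← lintegral_indicator measurableSet_Ioo,
    ← lintegral_indicator measurableSet_Ico]
  refine lintegral_congr fun r => ?_
  simp only [Set.indicator_apply, Set.mem_Ioo, Set.mem_Ici, Set.mem_Ico]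
  by_cases h1 : R / 2 ≤ r
  · have h2 : 0 < r := by linarith
    simp [h1, h2]
  · simp [h1]

/-- Energy of one particle in a square in the field of fixed scatterers. -/
lemma one_particle_bound {ι : Type*} {V : Vec 2 → ℝ≥0∞} {a ℓ₀ : ℝ} (hV : ScatteringBound V a ℓ₀)
    {u : Vec 2 → ℂ} (hu : ContDiff ℝ (⊤ : ℕ∞) u) {R : ℝ} (hR : 2 * ℓ₀ ≤ R) {p : Vec 2} {L η : ℝ}
    (hL : 0 ≤ L) (hη : 0 < η) (y : ι → Vec 2) {G J : Finset ι} (hGJ : G ⊆ J)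
    (hin : ∀ j ∈ G, ∀ x, rad (x - y j) < R → x ∈ square p L)
    (hdis : ∀ j ∈ G, ∀ k ∈ G, j ≠ k → ∀ x, rad (x - y j) < R → ¬ rad (x - y k) < R)
    (hA : (1 + 1 / η) * (1 / Real.log (R / a) * (8 / (3 * R ^ 2)) * (2 * L ^ 4)) ≤ η * L ^ 2) :
    (G.card : ℝ≥0∞) * ENNReal.ofReal (2 * π / Real.log (R / a)) * ∫⁻ x in square p L, ‖u x‖ₑ ^ 2 ≤
      ENNReal.ofReal ((1 + 2 * η) * L ^ 2) *
        ∫⁻ x in square p L, (gradSq u x + ∑ j ∈ J, V (x - y j) * ‖u x‖ₑ ^ 2 / 2) := by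
  classical
  have ha := hV.pos
  have hal := hV.lt
  have hR0 : 0 < R := by linarith
  have hlog : 0 < Real.log (R / a) := Real.log_pos ((one_lt_div ha).2 (by linarith))
  have hum : Measurable u := hu.continuous.measurable
  set M : ℝ≥0∞ := ENNReal.ofReal (1 / Real.log (R / a)) * ENNReal.ofReal (8 / (3 * R ^ 2)) with hM
  have hMtop : M ≠ ⊤ := by finiteness
  set D : ι → Set (Vec 2) := fun j => {x | rad (x - y j) < R} with hD
  have hDm : ∀ j, MeasurableSet (D j) := fun j => measurableSet_disc (y j) R
  have hinD : ∀ j ∈ G, D j ⊆ square p L := fun j hj x hx => hin j hj x hx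
  have hdisD : ∀ j ∈ G, ∀ k ∈ G, k ≠ j → ∀ x ∈ D j, x ∉ D k := fun j hj k hk hkj x hx =>
    hdis j hj k hk hkj.symm x hx
  set S : ι → Set (Vec 2) := fun j => {x | R / 2 ≤ rad (x - y j)} with hS
  have hSm : ∀ j, MeasurableSet (S j) := fun j =>
    measurableSet_le measurable_const
      (continuous_rad.comp (continuous_id.sub continuous_const)).measurable
  set W : Vec 2 → ℝ≥0∞ := fun x => ∑ j ∈ G, (D j).indicator ((S j).indicator fun _ => M) x with hW
  have hWi : ∀ j, Measurable ((D j).indicator ((S j).indicator fun _ => M)) := fun j =>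
    (measurable_const.indicator (hSm j)).indicator (hDm j)
  have hWm : Measurable W := Finset.measurable_sum _ fun j _ => hWi j
  have hWM : ∀ x, W x ≤ M := by
    intro x
    by_cases hx : ∃ j ∈ G, x ∈ D j
    · obtain ⟨j, hj, hxj⟩ := hx
      have : W x = (D j).indicator ((S j).indicator fun _ => M) x := by
        refine Finset.sum_eq_single_of_mem j hj fun k hk hkj => ?_
        exact Set.indicator_of_notMem (hdisD j hj k hk hkj x hxj) _
      rw [this]
      exact (Set.indicator_le_self _ _ _).trans (Set.indicator_le_self _ _ _)
    · push Not at hx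
      have : W x = 0 := Finset.sum_eq_zero fun j hj => Set.indicator_of_notMem (hx j hj) _
      rw [this]; exact zero_le
  have hrestr : ∀ j ∈ G, ∀ F : Vec 2 → ℝ≥0∞,
      ∫⁻ x in square p L, (D j).indicator F x = ∫⁻ x in D j, F x := by
    intro j hj F
    rw [lintegral_indicator (hDm j), Measure.restrict_restrict (hDm j),
      Set.inter_eq_left.2 (hinD j hj)]
  have hintW : ∫⁻ x in square p L, W x =
      (G.card : ℝ≥0∞) * ENNReal.ofReal (2 * π / Real.log (R / a)) := by
    rw [lintegral_finsetSum _ fun j _ => hWi j]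
    have : ∀ j ∈ G, ∫⁻ x in square p L, (D j).indicator ((S j).indicator fun _ => M) x =
        ENNReal.ofReal (2 * π / Real.log (R / a)) := by
      intro j hj
      rw [hrestr j hj, hD, setLIntegral_disc_eq]
      have e : ∀ z : Vec 2, (S j).indicator (fun _ => M) (z + y j) =
          M * {z | R / 2 ≤ rad z}.indicator (fun _ => 1) z := fun z => by
        simp [Set.indicator_apply, hS]
      simp_rw [e]
      rw [lintegral_const_mul' _ _ hMtop, lintegral_annulus hR0, hM,
        ← ENNReal.ofReal_mul (by positivity), ← ENNReal.ofReal_mul (by positivity),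
        ← ENNReal.ofReal_mul (by positivity)]
      congr 1
      field_simp
    rw [Finset.sum_congr rfl this, Finset.sum_const, nsmul_eq_mul]
  have hmg := measurable_gradSq u
  have hVm : ∀ j, Measurable fun x => V (x - y j) * ‖u x‖ₑ ^ 2 / 2 := fun j =>
    ((hV.meas.comp (measurable_id.sub_const _)).mul (hum.enorm.pow_const 2)).div_const 2
  have hintWu : ∫⁻ x in square p L, W x * ‖u x‖ₑ ^ 2 ≤
      ∫⁻ x in square p L, (gradSq u x + ∑ j ∈ J, V (x - y j) * ‖u x‖ₑ ^ 2 / 2) := by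
    calc _ = ∑ j ∈ G, ∫⁻ x in square p L,
          (D j).indicator (fun x => M * (S j).indicator (fun x => ‖u x‖ₑ ^ 2) x) x := by
          rw [← lintegral_finsetSum _ fun j _ =>
            (((hum.enorm.pow_const 2).indicator (hSm j)).const_mul M).indicator (hDm j)]
          refine lintegral_congr fun x => ?_
          rw [hW, Finset.sum_mul]
          refine Finset.sum_congr rfl fun j _ => ?_
          by_cases h1 : x ∈ D j <;> by_cases h2 : x ∈ S j <;> simp [h1, h2]
      _ ≤ ∑ j ∈ G, ∫⁻ x in square p L,
          (D j).indicator (fun x => gradSq u x + V (x - y j) * ‖u x‖ₑ ^ 2 / 2) x := by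
          refine Finset.sum_le_sum fun j hj => ?_
          rw [hrestr j hj, hrestr j hj, lintegral_const_mul' _ _ hMtop]
          exact dyson_disc_translate hV hu hR (y j)
      _ = ∫⁻ x in square p L, ∑ j ∈ G,
          (D j).indicator (fun x => gradSq u x + V (x - y j) * ‖u x‖ₑ ^ 2 / 2) x :=
          (lintegral_finsetSum _ fun j _ => (hmg.add (hVm j)).indicator (hDm j)).symm
      _ ≤ _ := by
          refine lintegral_mono fun x => ?_
          by_cases hx : ∃ j ∈ G, x ∈ D j
          · obtain ⟨j, hj, hxj⟩ := hx
            dsimp only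
            rw [Finset.sum_eq_single_of_mem j hj fun k hk hkj =>
              Set.indicator_of_notMem (hdisD j hj k hk hkj x hxj) _,
              Set.indicator_of_mem hxj]
            gcongr
            exact Finset.single_le_sum (f := fun j => V (x - y j) * ‖u x‖ₑ ^ 2 / 2)
              (fun _ _ => zero_le) (hGJ hj)
          · push Not at hx
            dsimp only
            rw [Finset.sum_eq_zero fun j hj => Set.indicator_of_notMem (hx j hj) _]
            exact zero_le
  rw [← hintW]
  refine (lintegral_weight_le hu p hL hη hWm hWM hMtop).trans ?_
  have h1 : ENNReal.ofReal (1 + 1 / η) * (M * ENNReal.ofReal (2 * L ^ 4) *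
        ∫⁻ x in square p L, gradSq u x) ≤ ENNReal.ofReal (η * L ^ 2) *
        ∫⁻ x in square p L, (gradSq u x + ∑ j ∈ J, V (x - y j) * ‖u x‖ₑ ^ 2 / 2) := by
    rw [← mul_assoc]
    gcongr ?_ * ?_
    · rw [hM, ← ENNReal.ofReal_mul (by positivity), ← ENNReal.ofReal_mul (by positivity),
        ← ENNReal.ofReal_mul (by positivity)]
      exact ENNReal.ofReal_le_ofReal hA
    · exact lintegral_mono fun x => le_self_add
  refine (add_le_add (mul_le_mul_right hintWu _) h1).trans_eq ?_
  rw [← add_mul, ← ENNReal.ofReal_mul (by positivity),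
    ← ENNReal.ofReal_add (by positivity) (by positivity)]
  congr 2
  ring

/-- Configurations with particle `i` in the square with corner `p i`. -/
def cells {N : ℕ} (p : Fin N → Vec 2) (L : ℝ) : Set (Fin N → Vec 2) :=
  Set.univ.pi fun i => square (p i) L

lemma measurableSet_cells {N : ℕ} (p : Fin N → Vec 2) (L : ℝ) : MeasurableSet (cells p L) :=
  MeasurableSet.univ_pi fun _ => measurableSet_square _ _

/-- To compare integrals over a product it suffices to compare them in one coordinate. -/
lemma setLIntegral_cells_mono {N : ℕ} (p : Fin N → Vec 2) (L : ℝ) (i : Fin N)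
    {F G : (Fin N → Vec 2) → ℝ≥0∞} (hF : Measurable F) (hG : Measurable G)
    (h : ∀ x, ∫⁻ y in square (p i) L, F (Function.update x i y) ≤
      ∫⁻ y in square (p i) L, G (Function.update x i y)) :
    ∫⁻ x in cells p L, F x ≤ ∫⁻ x in cells p L, G x := by
  have e : (volume : Measure (Fin N → Vec 2)).restrict (cells p L) =
      Measure.pi fun i => volume.restrict (square (p i) L) :=
    Measure.restrict_pi_pi (fun _ => volume) _
  rw [e]
  refine lintegral_le_of_lmarginal_le {i} hF hG ?_
  rw [lmarginal_singleton, lmarginal_singleton]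
  exact h

/-- The squared gradient with respect to particle `i`. -/
def gradAt {N : ℕ} (ψ : (Fin N → Vec 2) → ℂ) (i : Fin N) (x : Fin N → Vec 2) : ℝ≥0∞ :=
  ∑ k, ‖fderiv ℝ ψ x (Pi.single i (Pi.single k 1))‖ₑ ^ 2

lemma measurable_gradAt {N : ℕ} (ψ : (Fin N → Vec 2) → ℂ) (i : Fin N) :
    Measurable (gradAt ψ i) := by
  refine Finset.measurable_sum _ fun k _ => ?_
  exact (measurable_fderiv_apply_const ℝ ψ _).enorm.pow_const 2

lemma gradSq_update {N : ℕ} {ψ : (Fin N → Vec 2) → ℂ} (hψ : Differentiable ℝ ψ) (i : Fin N)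
    (x : Fin N → Vec 2) (y : Vec 2) :
    gradSq (fun y => ψ (Function.update x i y)) y = gradAt ψ i (Function.update x i y) := by
  have h := (hψ (Function.update x i y)).hasFDerivAt.comp y (hasFDerivAt_update (𝕜 := ℝ) x y)
  have h2 : fderiv ℝ (fun y => ψ (Function.update x i y)) y = _ := h.fderiv
  simp only [gradSq, gradAt, h2]
  refine Finset.sum_congr rfl fun k _ => ?_
  have e : (ContinuousLinearMap.pi (Pi.single i (ContinuousLinearMap.id ℝ (Vec 2))) :
      Vec 2 →L[ℝ] (Fin N → Vec 2)) (Pi.single k 1) = Pi.single i (Pi.single k 1) := by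
    funext j
    rcases eq_or_ne j i with rfl | hij
    · simp
    · simp [hij]
  rw [ContinuousLinearMap.comp_apply, e]

/-- Configurations of points of the square that are `R`-far from its boundary. -/
def deep (p : Vec 2) (L R : ℝ) : Set (Vec 2) :=
  Set.univ.pi fun k => Set.Ico (p k + R) (p k + L - R)

lemma measurableSet_deep (p : Vec 2) (L R : ℝ) : MeasurableSet (deep p L R) :=
  MeasurableSet.univ_pi fun _ => measurableSet_Ico

lemma abs_lt_of_rad_lt {z : Vec 2} {R : ℝ} (h : rad z < R) (k : Fin 2) : |z k| < R := by
  refine lt_of_le_of_lt ?_ h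
  rw [rad, ← Real.sqrt_sq_eq_abs]
  refine Real.sqrt_le_sqrt ?_
  exact Finset.single_le_sum (f := fun k => (z k) ^ 2) (fun _ _ => sq_nonneg _) (Finset.mem_univ k)

lemma mem_square_of_deep {p y x : Vec 2} {L R : ℝ} (hy : y ∈ deep p L R)
    (hx : rad (x - y) < R) : x ∈ square p L := by
  intro k _
  have h1 := abs_lt.1 (abs_lt_of_rad_lt hx k)
  have h2 := hy k trivial
  simp only [Set.mem_Ico, Pi.sub_apply] at h1 h2 ⊢
  constructor <;> linarith [h1.1, h1.2, h2.1, h2.2]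

/-- Differences of points that are within sup-distance `2R`. -/
def nearSet (R : ℝ) : Set (Vec 2) := Set.univ.pi fun _ => Set.Ioo (-(2 * R)) (2 * R)

lemma measurableSet_nearSet (R : ℝ) : MeasurableSet (nearSet R) :=
  MeasurableSet.univ_pi fun _ => measurableSet_Ioo

lemma nearSet_of_disc {x y z : Vec 2} {R : ℝ} (hx : rad (x - y) < R) (hz : rad (x - z) < R) :
    y - z ∈ nearSet R := by
  intro k _
  have h1 := abs_lt.1 (abs_lt_of_rad_lt hx k)
  have h2 := abs_lt.1 (abs_lt_of_rad_lt hz k)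
  simp only [Set.mem_Ioo, Pi.sub_apply] at h1 h2 ⊢
  constructor <;> linarith [h1.1, h1.2, h2.1, h2.2]

lemma volume_square_diff_deep (p : Vec 2) {L R : ℝ} (hR : 0 ≤ R) (hRL : 2 * R ≤ L) :
    volume (square p L \ deep p L R) ≤ ENNReal.ofReal (4 * R * L) := by
  have hL : 0 ≤ L := by linarith
  have hsub : deep p L R ⊆ square p L := fun x hx k _ => by
    have := hx k trivial
    simp only [Set.mem_Ico] at this ⊢
    constructor <;> linarith [this.1, this.2]
  have hv : volume (deep p L R) = ENNReal.ofReal ((L - 2 * R) ^ 2) := by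
    rw [deep, volume_pi_pi]
    simp only [Real.volume_Ico, Fin.prod_univ_two]
    rw [← ENNReal.ofReal_mul (by linarith)]
    congr 1
    ring
  rw [measure_sdiff hsub (measurableSet_deep _ _ _).nullMeasurableSet (by rw [hv]; finiteness), hv,
    volume_square p hL, ← ENNReal.ofReal_sub _ (by positivity)]
  refine ENNReal.ofReal_le_ofReal ?_
  nlinarith

lemma volume_nearSet {R : ℝ} (hR : 0 ≤ R) : volume (nearSet R) = ENNReal.ofReal (16 * R ^ 2) := by
  rw [nearSet, volume_pi_pi]
  simp only [Real.volume_Ioo, Fin.prod_univ_two]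
  rw [← ENNReal.ofReal_mul (by linarith)]
  congr 1
  ring

/-- Probability that particle `j` satisfies a condition of small area. -/
lemma bad_event_bound {N : ℕ} {ψ : (Fin N → Vec 2) → ℂ} (hψ : ContDiff ℝ (⊤ : ℕ∞) ψ)
    (p : Fin N → Vec 2) {L m : ℝ} (hL : 0 < L) (j : Fin N)
    (B : Set (Fin N → Vec 2)) (hB : MeasurableSet B)
    (hvol : ∀ x, volume {y ∈ square (p j) L | Function.update x j y ∈ B} ≤
      ENNReal.ofReal (m * L ^ 2)) :
    ∫⁻ x in cells p L, B.indicator 1 x * ‖ψ x‖ₑ ^ 2 ≤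
      ENNReal.ofReal (2 * m) * (∫⁻ x in cells p L, ‖ψ x‖ₑ ^ 2) +
      ENNReal.ofReal (4 * L ^ 2) * ∫⁻ x in cells p L, gradAt ψ j x := by
  have hψm : Measurable fun x => ‖ψ x‖ₑ ^ 2 := hψ.continuous.measurable.enorm.pow_const 2
  have hgm := measurable_gradAt ψ j
  rw [← lintegral_const_mul _ hψm, ← lintegral_const_mul _ hgm,
    ← lintegral_add_left (hψm.const_mul _)]
  refine setLIntegral_cells_mono p L j ((measurable_const.indicator hB).mul hψm)
    ((hψm.const_mul _).add (hgm.const_mul _)) fun x => ?_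
  have hu : ContDiff ℝ (⊤ : ℕ∞) fun y => ψ (Function.update x j y) :=
    hψ.comp (contDiff_update _ x j)
  have hum : Measurable fun y => ‖ψ (Function.update x j y)‖ₑ ^ 2 :=
    hu.continuous.measurable.enorm.pow_const 2
  have hpre : MeasurableSet {y | Function.update x j y ∈ B} := measurable_update x hB
  have h := lintegral_weight_ge hu (p j) hL.le one_pos
    (W := {y | Function.update x j y ∈ B}.indicator 1) (measurable_const.indicator hpre) (M := 1)
    (fun y => Set.indicator_le_self' (fun _ _ => zero_le) y) ENNReal.one_ne_top
  have hW : ∫⁻ y in square (p j) L, {y | Function.update x j y ∈ B}.indicator 1 y ≤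
      ENNReal.ofReal (m * L ^ 2) := by
    rw [lintegral_indicator_one hpre, Measure.restrict_apply hpre, Set.inter_comm]
    exact hvol x
  simp_rw [gradSq_update (hψ.differentiable (by simp))] at h
  have hgu : Measurable fun y => gradAt ψ j (Function.update x j y) :=
    hgm.comp (measurable_update x)
  rw [lintegral_add_left (hum.const_mul _), lintegral_const_mul _ hum, lintegral_const_mul _ hgu]
  have hL2 : ENNReal.ofReal (L ^ 2) ≠ 0 := by
    rw [ne_eq, ENNReal.ofReal_eq_zero, not_le]; positivity
  rw [← ENNReal.mul_le_mul_iff_right hL2 ENNReal.ofReal_ne_top]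
  refine h.trans ?_
  rw [mul_add]
  gcongr ?_ + ?_
  · rw [← mul_assoc, ← mul_assoc]
    refine mul_le_mul_left ((mul_le_mul_right hW _).trans_eq ?_) _
    rw [← ENNReal.ofReal_mul (by norm_num), ← ENNReal.ofReal_mul (by positivity)]
    congr 1; ring
  · rw [← mul_assoc, ← mul_assoc, mul_one, ← ENNReal.ofReal_mul (by norm_num),
      ← mul_assoc (ENNReal.ofReal (L ^ 2)), ← ENNReal.ofReal_mul (by positivity)]
    apply le_of_eq
    congr 2
    ring

open Classical in
/-- The particles of `S` other than `i` that are far from the boundary of the square and from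
all other particles of `S`, apart from `i`. -/
def goodSet {N : ℕ} (p₀ : Vec 2) (L R : ℝ) (S : Finset (Fin N)) (i : Fin N) (x : Fin N → Vec 2) :
    Finset (Fin N) :=
  (S.erase i).filter fun j => x j ∈ deep p₀ L R ∧ ∀ k ∈ S.erase i, k ≠ j → x j - x k ∉ nearSet R

lemma goodSet_update {N : ℕ} (p₀ : Vec 2) (L R : ℝ) (S : Finset (Fin N)) (i : Fin N)
    (x : Fin N → Vec 2) (y : Vec 2) :
    goodSet p₀ L R S i (Function.update x i y) = goodSet p₀ L R S i x := by
  classical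
  refine Finset.filter_congr fun j hj => ?_
  rw [Function.update_of_ne (Finset.ne_of_mem_erase hj)]
  refine and_congr_right fun _ => forall_congr' fun k => forall_congr' fun hk => ?_
  rw [Function.update_of_ne (Finset.ne_of_mem_erase hk)]

lemma measurableSet_deepEvent {N : ℕ} (p₀ : Vec 2) (L R : ℝ) (j : Fin N) :
    MeasurableSet {x : Fin N → Vec 2 | x j ∉ deep p₀ L R} :=
  ((measurableSet_deep p₀ L R).preimage (measurable_pi_apply j)).compl

lemma measurableSet_nearEvent {N : ℕ} (R : ℝ) (j k : Fin N) :
    MeasurableSet {x : Fin N → Vec 2 | x j - x k ∈ nearSet R} :=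
  (measurableSet_nearSet R).preimage ((measurable_pi_apply j).sub (measurable_pi_apply k))

lemma measurable_card_goodSet {N : ℕ} (p₀ : Vec 2) (L R : ℝ) (S : Finset (Fin N)) (i : Fin N) :
    Measurable fun x => ((goodSet p₀ L R S i x).card : ℝ≥0∞) := by
  classical
  simp only [goodSet, Finset.card_filter, Nat.cast_sum]
  refine Finset.measurable_sum _ fun j _ => ?_
  have hm : MeasurableSet {x : Fin N → Vec 2 | x j ∈ deep p₀ L R ∧
      ∀ k ∈ S.erase i, k ≠ j → x j - x k ∉ nearSet R} := by
    refine MeasurableSet.inter ?_ ?_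
    · exact (measurableSet_deep p₀ L R).preimage (measurable_pi_apply j)
    · have : {x : Fin N → Vec 2 | ∀ k ∈ S.erase i, k ≠ j → x j - x k ∉ nearSet R} =
          ⋂ k ∈ S.erase i, ⋂ _ : k ≠ j, {x | x j - x k ∈ nearSet R}ᶜ := by
        ext x; simp
      change MeasurableSet {x : Fin N → Vec 2 | ∀ k ∈ S.erase i, k ≠ j → x j - x k ∉ nearSet R}
      rw [this]
      exact Finset.measurableSet_biInter _ fun k _ => MeasurableSet.iInter fun _ =>
        (measurableSet_nearEvent R j k).compl
  have h1 : Measurable fun x : Fin N → Vec 2 => if x j ∈ deep p₀ L R ∧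
      ∀ k ∈ S.erase i, k ≠ j → x j - x k ∉ nearSet R then (1 : ℕ) else 0 :=
    Measurable.ite hm measurable_const measurable_const
  exact (measurable_from_top (f := fun n : ℕ => (n : ℝ≥0∞))).comp h1

lemma card_le_goodSet {N : ℕ} (p₀ : Vec 2) (L R : ℝ) (S : Finset (Fin N)) {i : Fin N} (hi : i ∈ S)
    (x : Fin N → Vec 2) :
    (S.card : ℝ≥0∞) ≤ (goodSet p₀ L R S i x).card + 1 +
      (∑ j ∈ S, {x : Fin N → Vec 2 | x j ∉ deep p₀ L R}.indicator 1 x +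
        ∑ j ∈ S, ∑ k ∈ S.erase j, {x : Fin N → Vec 2 | x j - x k ∈ nearSet R}.indicator 1 x) := by
  classical
  have h1 : (S.card : ℝ≥0∞) = ((S.erase i).card : ℝ≥0∞) + 1 := by
    rw [← Finset.card_erase_add_one hi]; push_cast; rfl
  have h2 := Finset.card_filter_add_card_filter_not (s := S.erase i)
    (fun j => x j ∈ deep p₀ L R ∧ ∀ k ∈ S.erase i, k ≠ j → x j - x k ∉ nearSet R)
  rw [h1, ← h2, Nat.cast_add, add_right_comm]
  refine add_le_add le_rfl ?_
  rw [Finset.card_filter, Nat.cast_sum, ← Finset.sum_add_distrib]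
  refine (Finset.sum_le_sum_of_subset (Finset.erase_subset i S)).trans ?_
  refine Finset.sum_le_sum fun j hj => ?_
  split_ifs with h
  · simp
  · rw [not_and_or] at h
    rcases h with h | h
    · rw [Set.indicator_of_mem (show x ∈ {x : Fin N → Vec 2 | x j ∉ deep p₀ L R} from h)]
      simp
    · push Not at h
      obtain ⟨k, hk, hkj, hn⟩ := h
      refine le_trans ?_ le_add_self
      refine le_trans ?_ (Finset.single_le_sum (fun _ _ => zero_le)
        (Finset.mem_erase.2 ⟨hkj, Finset.mem_of_mem_erase hk⟩))
      rw [Set.indicator_of_mem (show x ∈ {x : Fin N → Vec 2 | x j - x k ∈ nearSet R} from hn)]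
      simp

/-- Energy density of the particles in `S`. -/
def eDens {N : ℕ} (V : Vec 2 → ℝ≥0∞) (ψ : (Fin N → Vec 2) → ℂ) (S : Finset (Fin N))
    (x : Fin N → Vec 2) : ℝ≥0∞ :=
  ∑ i ∈ S, (gradAt ψ i x + ∑ j ∈ S.erase i, V (x i - x j) * ‖ψ x‖ₑ ^ 2 / 2)

lemma measurable_pairTerm {N : ℕ} {V : Vec 2 → ℝ≥0∞} (hV : Measurable V)
    {ψ : (Fin N → Vec 2) → ℂ} (hψ : Measurable ψ) (i j : Fin N) :
    Measurable fun x => V (x i - x j) * ‖ψ x‖ₑ ^ 2 / 2 :=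
  ((hV.comp ((measurable_pi_apply i).sub (measurable_pi_apply j))).mul
    (hψ.enorm.pow_const 2)).div_const 2

lemma good_pairs_bound {N : ℕ} {V : Vec 2 → ℝ≥0∞} {a ℓ₀ : ℝ} (hV : ScatteringBound V a ℓ₀)
    {ψ : (Fin N → Vec 2) → ℂ} (hψ : ContDiff ℝ (⊤ : ℕ∞) ψ) {p : Fin N → Vec 2} {p₀ : Vec 2}
    {S : Finset (Fin N)} {i : Fin N} (hp : p i = p₀) {L R η : ℝ} (hL : 0 ≤ L)
    (hR : 2 * ℓ₀ ≤ R) (hη : 0 < η)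
    (hA : (1 + 1 / η) * (1 / Real.log (R / a) * (8 / (3 * R ^ 2)) * (2 * L ^ 4)) ≤ η * L ^ 2) :
    ENNReal.ofReal (2 * π / Real.log (R / a)) *
        ∫⁻ x in cells p L, ((goodSet p₀ L R S i x).card : ℝ≥0∞) * ‖ψ x‖ₑ ^ 2 ≤
      ENNReal.ofReal ((1 + 2 * η) * L ^ 2) * ∫⁻ x in cells p L,
        (gradAt ψ i x + ∑ j ∈ S.erase i, V (x i - x j) * ‖ψ x‖ₑ ^ 2 / 2) := by
  classical
  have hψm : Measurable ψ := hψ.continuous.measurable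
  have hn : Measurable fun x => ‖ψ x‖ₑ ^ 2 := hψm.enorm.pow_const 2
  have hc := measurable_card_goodSet p₀ L R S i
  have he : Measurable fun x => gradAt ψ i x + ∑ j ∈ S.erase i, V (x i - x j) * ‖ψ x‖ₑ ^ 2 / 2 :=
    (measurable_gradAt ψ i).add
      (Finset.measurable_sum _ fun j _ => measurable_pairTerm hV.meas hψm i j)
  have hcn : Measurable fun x => ((goodSet p₀ L R S i x).card : ℝ≥0∞) * ‖ψ x‖ₑ ^ 2 := hc.mul hn
  rw [← lintegral_const_mul _ hcn, ← lintegral_const_mul _ he]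
  refine setLIntegral_cells_mono p L i (hcn.const_mul _) (he.const_mul _) fun x => ?_
  have hu : ContDiff ℝ (⊤ : ℕ∞) fun y => ψ (Function.update x i y) :=
    hψ.comp (contDiff_update _ x i)
  have h := one_particle_bound hV hu hR (p := p i) hL hη x (G := goodSet p₀ L R S i x)
    (J := S.erase i) (Finset.filter_subset _ _) ?_ ?_ hA
  · simp_rw [goodSet_update]
    rw [lintegral_const_mul' _ _ (by finiteness), lintegral_const_mul' _ _ (by finiteness),
      lintegral_const_mul' _ _ (by finiteness), ← mul_assoc, mul_comm (ENNReal.ofReal _)]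
    refine h.trans_eq ?_
    congr 1
    refine lintegral_congr fun y => ?_
    rw [gradSq_update (hψ.differentiable (by simp))]
    congr 1
    refine Finset.sum_congr rfl fun j hj => ?_
    rw [Function.update_self, Function.update_of_ne (Finset.ne_of_mem_erase hj)]
  · intro j hj z hz
    rw [hp]
    exact mem_square_of_deep (Finset.mem_filter.1 hj).2.1 hz
  · intro j hj k hk hjk z hz hz'
    exact (Finset.mem_filter.1 hj).2.2 k (Finset.mem_filter.1 hk).1 hjk.symm
        (nearSet_of_disc hz hz')

lemma volume_near_update_le {N : ℕ} (p : Fin N → Vec 2) (L : ℝ) {R : ℝ} (hR : 0 ≤ R)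
    {j k : Fin N} (hjk : k ≠ j) (x : Fin N → Vec 2) :
    volume {y ∈ square (p j) L | Function.update x j y ∈
      {x : Fin N → Vec 2 | x j - x k ∈ nearSet R}} ≤ ENNReal.ofReal (16 * R ^ 2) := by
  rw [← volume_nearSet hR, ← measure_preimage_add_right volume (-x k) (nearSet R)]
  refine measure_mono fun y hy => ?_
  have := hy.2
  simpa [Function.update_of_ne hjk, sub_eq_add_neg] using this

lemma volume_notDeep_update_le {N : ℕ} (p : Fin N → Vec 2) {p₀ : Vec 2} {j : Fin N} (hp : p j = p₀)
    {L R : ℝ} (hR : 0 ≤ R) (hRL : 2 * R ≤ L) (x : Fin N → Vec 2) :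
    volume {y ∈ square (p j) L | Function.update x j y ∈
      {x : Fin N → Vec 2 | x j ∉ deep p₀ L R}} ≤ ENNReal.ofReal (4 * R * L) := by
  refine le_trans (measure_mono fun y hy => ?_) (volume_square_diff_deep p₀ hR hRL)
  have := hy.2
  rw [← hp]
  refine ⟨hy.1, ?_⟩
  simpa [hp] using this

/-- The total weight of configurations in which some particle is near the boundary or near
another particle. -/
lemma bad_sum_bound {N : ℕ} {ψ : (Fin N → Vec 2) → ℂ} (hψ : ContDiff ℝ (⊤ : ℕ∞) ψ)
    {p : Fin N → Vec 2} {p₀ : Vec 2} {S : Finset (Fin N)} (hp : ∀ i ∈ S, p i = p₀) {L θ : ℝ}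
    (hL : 0 < L) (hθ : 0 < θ) (hθ2 : 2 * θ ≤ 1) :
    ∫⁻ x in cells p L, (∑ j ∈ S, {x : Fin N → Vec 2 | x j ∉ deep p₀ L (θ * L)}.indicator 1 x +
        ∑ j ∈ S, ∑ k ∈ S.erase j, {x : Fin N → Vec 2 | x j - x k ∈ nearSet (θ * L)}.indicator 1 x) *
          ‖ψ x‖ₑ ^ 2 ≤
      ENNReal.ofReal (8 * θ * S.card + 32 * θ ^ 2 * S.card ^ 2) * (∫⁻ x in cells p L, ‖ψ x‖ₑ ^ 2) +
      ENNReal.ofReal (4 * (1 + S.card) * L ^ 2) * ∑ j ∈ S, ∫⁻ x in cells p L, gradAt ψ j x := by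
  classical
  have hn : Measurable fun x => ‖ψ x‖ₑ ^ 2 := hψ.continuous.measurable.enorm.pow_const 2
  have hθL : 0 ≤ θ * L := by positivity
  have h2θL : 2 * (θ * L) ≤ L := by nlinarith
  have hmd : ∀ j, Measurable fun x : Fin N → Vec 2 =>
      {x : Fin N → Vec 2 | x j ∉ deep p₀ L (θ * L)}.indicator (1 : (Fin N → Vec 2) → ℝ≥0∞) x *
          ‖ψ x‖ₑ ^ 2 :=
    fun j => (measurable_const.indicator (measurableSet_deepEvent p₀ L _ j)).mul hn
  have hmn : ∀ j k, Measurable fun x : Fin N → Vec 2 =>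
      {x : Fin N → Vec 2 | x j - x k ∈ nearSet (θ * L)}.indicator (1 : (Fin N → Vec 2) → ℝ≥0∞) x *
          ‖ψ x‖ₑ ^ 2 :=
    fun j k => (measurable_const.indicator (measurableSet_nearEvent _ j k)).mul hn
  set A := ∫⁻ x in cells p L, ‖ψ x‖ₑ ^ 2 with hA
  set c := (S.card : ℝ) with hc
  have hc0 : 0 ≤ c := Nat.cast_nonneg _
  have cE : ENNReal.ofReal c = (S.card : ℝ≥0∞) := ENNReal.ofReal_natCast _
  have hβ : ∀ j ∈ S, ∫⁻ x in cells p L,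
      {x : Fin N → Vec 2 | x j ∉ deep p₀ L (θ * L)}.indicator 1 x * ‖ψ x‖ₑ ^ 2 ≤
      ENNReal.ofReal (8 * θ) * A +
          ENNReal.ofReal (4 * L ^ 2) * ∫⁻ x in cells p L, gradAt ψ j x := by
    intro j hj
    have := bad_event_bound hψ p hL (m := 4 * θ) j _ (measurableSet_deepEvent p₀ L (θ * L) j)
      (fun x => (volume_notDeep_update_le p (hp j hj) hθL h2θL x).trans_eq
        (by congr 1; ring))
    refine this.trans_eq ?_
    congr 3; ring
  have hγ : ∀ j ∈ S, ∀ k ∈ S.erase j, ∫⁻ x in cells p L,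
      {x : Fin N → Vec 2 | x j - x k ∈ nearSet (θ * L)}.indicator 1 x * ‖ψ x‖ₑ ^ 2 ≤
      ENNReal.ofReal (32 * θ ^ 2) * A +
        ENNReal.ofReal (4 * L ^ 2) * ∫⁻ x in cells p L, gradAt ψ j x := by
    intro j hj k hk
    have := bad_event_bound hψ p hL (m := 16 * θ ^ 2) j _ (measurableSet_nearEvent (θ * L) j k)
      (fun x => (volume_near_update_le p L hθL (Finset.ne_of_mem_erase hk) x).trans_eq
        (by congr 1; ring))
    refine this.trans_eq ?_
    congr 3; ring
  have hγ2 : ∀ j ∈ S, ∑ k ∈ S.erase j, ∫⁻ x in cells p L,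
      {x : Fin N → Vec 2 | x j - x k ∈ nearSet (θ * L)}.indicator 1 x * ‖ψ x‖ₑ ^ 2 ≤
      ENNReal.ofReal c * (ENNReal.ofReal (32 * θ ^ 2) * A +
        ENNReal.ofReal (4 * L ^ 2) * ∫⁻ x in cells p L, gradAt ψ j x) := by
    intro j hj
    refine (Finset.sum_le_sum (hγ j hj)).trans ?_
    rw [Finset.sum_const, nsmul_eq_mul, cE]
    refine mul_le_mul_left ?_ _
    exact_mod_cast Finset.card_le_card (Finset.erase_subset j S)
  have e1 : ∀ x : Fin N → Vec 2,
      (∑ j ∈ S,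
          {x : Fin N → Vec 2 | x j ∉ deep p₀ L (θ * L)}.indicator (1 : (Fin N → Vec 2) → ℝ≥0∞) x +
        ∑ j ∈ S, ∑ k ∈ S.erase j, {x : Fin N → Vec 2 | x j - x k ∈ nearSet (θ * L)}.indicator 1 x) *
          ‖ψ x‖ₑ ^ 2 =
      ∑ j ∈ S, {x : Fin N → Vec 2 | x j ∉ deep p₀ L (θ * L)}.indicator 1 x * ‖ψ x‖ₑ ^ 2 +
        ∑ j ∈ S, ∑ k ∈ S.erase j, {x : Fin N → Vec 2 | x j - x k ∈ nearSet (θ * L)}.indicator 1 x *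
          ‖ψ x‖ₑ ^ 2 := by
    intro x
    simp only [add_mul, Finset.sum_mul]
  simp_rw [e1]
  rw [lintegral_add_left (Finset.measurable_sum _ fun j _ => hmd j),
    lintegral_finsetSum _ fun j _ => hmd j,
    lintegral_finsetSum _ fun j _ => Finset.measurable_sum _ fun k _ => hmn j k]
  simp_rw [fun j => lintegral_finsetSum (μ := volume.restrict (cells p L)) (S.erase j)
    fun k _ => hmn j k]
  refine (add_le_add (Finset.sum_le_sum hβ) (Finset.sum_le_sum hγ2)).trans_eq ?_
  rw [← Finset.mul_sum, Finset.sum_add_distrib, Finset.sum_add_distrib, ← Finset.mul_sum,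
    Finset.sum_const, Finset.sum_const, nsmul_eq_mul, nsmul_eq_mul, ← cE, ENNReal.ofReal_add,
    show 8 * θ * c = c * (8 * θ) by ring, show 32 * θ ^ 2 * c ^ 2 = c * (c * (32 * θ ^ 2)) by ring,
    show 4 * (1 + c) * L ^ 2 = 4 * L ^ 2 + c * (4 * L ^ 2) by ring, ENNReal.ofReal_add]
  · simp only [ENNReal.ofReal_mul hc0, ← Finset.mul_sum]
    ring
  all_goals positivity

/-- Lower bound for the energy of at most `P` particles in one square. -/
lemma few_particles_bound {N : ℕ} {V : Vec 2 → ℝ≥0∞} {a ℓ₀ : ℝ} (hV : ScatteringBound V a ℓ₀)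
    {ψ : (Fin N → Vec 2) → ℂ} (hψ : ContDiff ℝ (⊤ : ℕ∞) ψ) {p : Fin N → Vec 2} {p₀ : Vec 2}
    {S : Finset (Fin N)} (hp : ∀ i ∈ S, p i = p₀) {L θ η P κ : ℝ} (hL : 0 < L)
    (hθ : 0 < θ) (hθ2 : 2 * θ ≤ 1) (hR : 2 * ℓ₀ ≤ θ * L) (hη : 0 < η) (hP : (S.card : ℝ) ≤ P)
    (hκ : κ = 2 * π / Real.log (θ * L / a)) (hκ0 : 0 ≤ κ)
    (hA : (1 + 1 / η) * (1 / Real.log (θ * L / a) * (8 / (3 * (θ * L) ^ 2)) * (2 * L ^ 4)) ≤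
      η * L ^ 2)
    (h1 : 8 * θ * P + 32 * θ ^ 2 * P ^ 2 ≤ 1) (h2 : κ * (4 * P + 4 * P ^ 2) ≤ η) :
    ENNReal.ofReal (κ * S.card ^ 2) * (∫⁻ x in cells p L, ‖ψ x‖ₑ ^ 2) ≤
      ENNReal.ofReal ((1 + 3 * η) * L ^ 2) * (∫⁻ x in cells p L, eDens V ψ S x) +
      ENNReal.ofReal (2 * κ * S.card) * ∫⁻ x in cells p L, ‖ψ x‖ₑ ^ 2 := by
  classical
  have hψm : Measurable ψ := hψ.continuous.measurable
  have hn : Measurable fun x => ‖ψ x‖ₑ ^ 2 := hψm.enorm.pow_const 2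
  set A := ∫⁻ x in cells p L, ‖ψ x‖ₑ ^ 2 with hAdef
  set c := (S.card : ℝ) with hc
  have hc0 : 0 ≤ c := Nat.cast_nonneg _
  have hP0 : 0 ≤ P := hc0.trans hP
  have cE : ENNReal.ofReal c = (S.card : ℝ≥0∞) := ENNReal.ofReal_natCast _
  set q := ∑ j ∈ S, ∫⁻ x in cells p L, gradAt ψ j x with hq
  set Q : Fin N → ℝ≥0∞ := fun i => ∫⁻ x in cells p L,
    (gradAt ψ i x + ∑ j ∈ S.erase i, V (x i - x j) * ‖ψ x‖ₑ ^ 2 / 2) with hQ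
  have hQsum : ∫⁻ x in cells p L, eDens V ψ S x = ∑ i ∈ S, Q i :=
    lintegral_finsetSum _ fun i _ => (measurable_gradAt ψ i).add
      (Finset.measurable_sum _ fun j _ => measurable_pairTerm hV.meas hψm i j)
  have hqQ : q ≤ ∑ i ∈ S, Q i :=
    Finset.sum_le_sum fun i _ => lintegral_mono fun x => le_self_add
  have hbad := bad_sum_bound hψ hp hL hθ hθ2
  rw [← hq, ← hAdef, ← hc] at hbad
  have hone : ∀ i ∈ S, ENNReal.ofReal κ * (ENNReal.ofReal c * A) ≤
      ENNReal.ofReal ((1 + 2 * η) * L ^ 2) * Q i + ENNReal.ofReal (2 * κ) * A +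
        ENNReal.ofReal (κ * (4 * (1 + c) * L ^ 2)) * q := by
    intro i hi
    have hg := good_pairs_bound hV hψ (hp i hi) (S := S) hL.le hR hη hA
    rw [← hκ] at hg
    have hcn : Measurable fun x => ((goodSet p₀ L (θ * L) S i x).card : ℝ≥0∞) * ‖ψ x‖ₑ ^ 2 :=
      (measurable_card_goodSet p₀ L (θ * L) S i).mul hn
    have hcn2 : Measurable fun x =>
        ((goodSet p₀ L (θ * L) S i x).card : ℝ≥0∞) * ‖ψ x‖ₑ ^ 2 + ‖ψ x‖ₑ ^ 2 := hcn.add hn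
    have hstep : ENNReal.ofReal c * A ≤
        (∫⁻ x in cells p L, ((goodSet p₀ L (θ * L) S i x).card : ℝ≥0∞) * ‖ψ x‖ₑ ^ 2) + A +
        (ENNReal.ofReal (8 * θ * c + 32 * θ ^ 2 * c ^ 2) * A +
          ENNReal.ofReal (4 * (1 + c) * L ^ 2) * q) := by
      refine le_trans ?_ (add_le_add le_rfl hbad)
      rw [cE, ← lintegral_const_mul _ hn, ← lintegral_add_left hcn,
        ← lintegral_add_left hcn2]
      refine lintegral_mono fun x => ?_
      refine (mul_le_mul_left (card_le_goodSet p₀ L (θ * L) S hi x) _).trans_eq ?_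
      rw [add_mul, add_mul, one_mul]
    refine (mul_le_mul_right hstep _).trans ?_
    have hsmall : ENNReal.ofReal (8 * θ * c + 32 * θ ^ 2 * c ^ 2) ≤ 1 := by
      rw [← ENNReal.ofReal_one]
      refine ENNReal.ofReal_le_ofReal (le_trans ?_ h1)
      gcongr
    calc _ ≤ ENNReal.ofReal κ *
        ((∫⁻ x in cells p L, ((goodSet p₀ L (θ * L) S i x).card : ℝ≥0∞) * ‖ψ x‖ₑ ^ 2) + A +
        (1 * A + ENNReal.ofReal (4 * (1 + c) * L ^ 2) * q)) := by gcongr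
      _ = ENNReal.ofReal κ *
        (∫⁻ x in cells p L, ((goodSet p₀ L (θ * L) S i x).card : ℝ≥0∞) * ‖ψ x‖ₑ ^ 2) +
          ENNReal.ofReal (2 * κ) * A + ENNReal.ofReal (κ * (4 * (1 + c) * L ^ 2)) * q := by
        rw [ENNReal.ofReal_mul hκ0, ENNReal.ofReal_mul (p := 2) (by norm_num)]
        simp only [ENNReal.ofReal_ofNat]
        ring
      _ ≤ _ := by gcongr
  have hsum := Finset.sum_le_sum hone
  rw [Finset.sum_const, nsmul_eq_mul, Finset.sum_add_distrib, Finset.sum_add_distrib,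
    ← Finset.mul_sum, Finset.sum_const, Finset.sum_const, nsmul_eq_mul, nsmul_eq_mul, ← cE] at hsum
  rw [hQsum]
  calc ENNReal.ofReal (κ * c ^ 2) * A
      = ENNReal.ofReal c * (ENNReal.ofReal κ * (ENNReal.ofReal c * A)) := by
        rw [show κ * c ^ 2 = c * (κ * c) by ring, ENNReal.ofReal_mul hc0, ENNReal.ofReal_mul hκ0]
        ring
    _ ≤ _ := hsum
    _ = ENNReal.ofReal ((1 + 2 * η) * L ^ 2) * (∑ i ∈ S, Q i) + ENNReal.ofReal (2 * κ * c) * A +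
        ENNReal.ofReal (κ * (4 * (1 + c) * c) * L ^ 2) * q := by
        rw [show 2 * κ * c = c * (2 * κ) by ring, ENNReal.ofReal_mul hc0,
          show κ * (4 * (1 + c) * c) * L ^ 2 = c * (κ * (4 * (1 + c) * L ^ 2)) by ring,
          ENNReal.ofReal_mul (p := c) hc0]
        ring
    _ ≤ ENNReal.ofReal ((1 + 2 * η) * L ^ 2) * (∑ i ∈ S, Q i) + ENNReal.ofReal (2 * κ * c) * A +
        ENNReal.ofReal (η * L ^ 2) * ∑ i ∈ S, Q i := by
        gcongr
        refine le_trans ?_ h2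
        gcongr
        nlinarith
    _ = _ := by
        rw [show (1 + 3 * η) * L ^ 2 = (1 + 2 * η) * L ^ 2 + η * L ^ 2 by ring,
          ENNReal.ofReal_add (by positivity) (by positivity)]
        ring

lemma measurable_eDens {N : ℕ} {V : Vec 2 → ℝ≥0∞} (hV : Measurable V)
    {ψ : (Fin N → Vec 2) → ℂ} (hψ : Measurable ψ) (S : Finset (Fin N)) :
    Measurable (eDens V ψ S) :=
  Finset.measurable_sum _ fun i _ => (measurable_gradAt ψ i).add
    (Finset.measurable_sum _ fun j _ => measurable_pairTerm hV hψ i j)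

lemma sum_eDens_le_eDens_biUnion {N : ℕ} {ι : Type*} (V : Vec 2 → ℝ≥0∞) (ψ : (Fin N → Vec 2) → ℂ)
    (s : Finset ι) (S : ι → Finset (Fin N)) (hd : (s : Set ι).PairwiseDisjoint S)
    {F : Finset (Fin N)} (hF : ∀ c ∈ s, S c ⊆ F) (x : Fin N → Vec 2) :
    ∑ c ∈ s, eDens V ψ (S c) x ≤ eDens V ψ F x := by
  classical
  have h1 : ∑ c ∈ s, eDens V ψ (S c) x ≤ ∑ c ∈ s, ∑ i ∈ S c,
      (gradAt ψ i x + ∑ j ∈ F.erase i, V (x i - x j) * ‖ψ x‖ₑ ^ 2 / 2) := by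
    refine Finset.sum_le_sum fun c hc => Finset.sum_le_sum fun i _ => ?_
    refine add_le_add le_rfl (Finset.sum_le_sum_of_subset ?_)
    exact Finset.erase_subset_erase i (hF c hc)
  refine h1.trans ?_
  rw [← Finset.sum_biUnion hd]
  exact Finset.sum_le_sum_of_subset (Finset.biUnion_subset.2 hF)

lemma eDens_add_le {N : ℕ} (V : Vec 2 → ℝ≥0∞) (ψ : (Fin N → Vec 2) → ℂ)
    {S S' F : Finset (Fin N)} (hd : Disjoint S S') (hS : S ⊆ F) (hS' : S' ⊆ F)
    (x : Fin N → Vec 2) :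
    eDens V ψ S x + eDens V ψ S' x ≤ eDens V ψ F x := by
  have h := sum_eDens_le_eDens_biUnion V ψ (Finset.univ : Finset Bool) (fun b => cond b S S')
    (by
      intro b _ b' _ hb
      cases b <;> cases b' <;> simp_all [Function.onFun, disjoint_comm]) (F := F)
    (by intro b _; cases b <;> simpa) x
  simpa using h

/-- Lower bound, linear in the number of particles, for the energy in one square. -/
lemma many_particles_bound {N : ℕ} {V : Vec 2 → ℝ≥0∞} {a ℓ₀ : ℝ} (hV : ScatteringBound V a ℓ₀)
    {ψ : (Fin N → Vec 2) → ℂ} (hψ : ContDiff ℝ (⊤ : ℕ∞) ψ) {p : Fin N → Vec 2} {p₀ : Vec 2}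
    {L θ η κ m : ℝ} {P : ℕ} (hL : 0 < L)
    (hθ : 0 < θ) (hθ2 : 2 * θ ≤ 1) (hR : 2 * ℓ₀ ≤ θ * L) (hη : 0 < η)
    (hκ : κ = 2 * π / Real.log (θ * L / a)) (hκ0 : 0 ≤ κ)
    (hA : (1 + 1 / η) * (1 / Real.log (θ * L / a) * (8 / (3 * (θ * L) ^ 2)) * (2 * L ^ 4)) ≤
      η * L ^ 2)
    (h1 : 8 * θ * P + 32 * θ ^ 2 * P ^ 2 ≤ 1) (h2 : κ * (4 * P + 4 * P ^ 2) ≤ η)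
    (hm : 0 ≤ m) (hP : 2 * m ≤ P) (hP0 : 0 < P)
    (F : Finset (Fin N)) (hp : ∀ i ∈ F, p i = p₀) :
    ENNReal.ofReal (κ * (2 * m * F.card)) * (∫⁻ x in cells p L, ‖ψ x‖ₑ ^ 2) ≤
      ENNReal.ofReal ((1 + 3 * η) * L ^ 2) * (∫⁻ x in cells p L, eDens V ψ F x) +
      ENNReal.ofReal (κ * (m ^ 2 + 2 * F.card)) * ∫⁻ x in cells p L, ‖ψ x‖ₑ ^ 2 := by
  classical
  induction F using Finset.strongInduction with
  | H F ih =>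
  set A := ∫⁻ x in cells p L, ‖ψ x‖ₑ ^ 2 with hA
  set B := ENNReal.ofReal ((1 + 3 * η) * L ^ 2) with hB
  by_cases hF : F.card ≤ P
  · have hb := few_particles_bound hV hψ hp hL hθ hθ2 hR hη (P := P) (by exact_mod_cast hF) hκ hκ0
      ‹_› h1 h2
    rw [← hA, ← hB] at hb
    calc ENNReal.ofReal (κ * (2 * m * F.card)) * A
        ≤ ENNReal.ofReal (κ * F.card ^ 2 + κ * m ^ 2) * A := by
          gcongr
          nlinarith [mul_nonneg hκ0 (sq_nonneg (m - (F.card : ℝ)))]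
      _ = ENNReal.ofReal (κ * F.card ^ 2) * A + ENNReal.ofReal (κ * m ^ 2) * A := by
          rw [ENNReal.ofReal_add (by positivity) (by positivity), add_mul]
      _ ≤ _ := add_le_add hb le_rfl
      _ = _ := by
          rw [show κ * (m ^ 2 + 2 * F.card) = 2 * κ * F.card + κ * m ^ 2 by ring,
            ENNReal.ofReal_add (by positivity) (by positivity)]
          ring
  · push Not at hF
    obtain ⟨S, hSF, hSc⟩ := Finset.exists_subset_card_eq hF.le
    have hb := few_particles_bound hV hψ (fun i hi => hp i (hSF hi)) hL hθ hθ2 hR hη (P := P)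
      (by rw [hSc]) hκ hκ0 ‹_› h1 h2
    rw [← hA, ← hB] at hb
    have hss : F \ S ⊂ F := by
      refine Finset.sdiff_ssubset hSF ?_
      rw [← Finset.card_pos, hSc]; exact hP0
    have hi := ih (F \ S) hss (fun i hi => hp i (Finset.mem_sdiff.1 hi).1)
    have hcard : (F.card : ℝ) = (F \ S).card + P := by
      rw [← hSc]
      exact_mod_cast (Finset.card_sdiff_add_card_eq_card hSF).symm
    have he : (∫⁻ x in cells p L, eDens V ψ (F \ S) x) + ∫⁻ x in cells p L, eDens V ψ S x ≤
        ∫⁻ x in cells p L, eDens V ψ F x := by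
      rw [← lintegral_add_left (measurable_eDens hV.meas hψ.continuous.measurable _)]
      exact lintegral_mono fun x => eDens_add_le V ψ Finset.sdiff_disjoint Finset.sdiff_subset hSF x
    set d := ((F \ S).card : ℝ) with hd
    have hd0 : 0 ≤ d := Nat.cast_nonneg _
    rw [hSc] at hb
    rw [hcard]
    calc ENNReal.ofReal (κ * (2 * m * (d + P))) * A
        ≤ ENNReal.ofReal (κ * (2 * m * d) + κ * P ^ 2) * A := by
          gcongr
          have : κ * (2 * m) * P ≤ κ * P * P := by gcongr
          nlinarith
      _ = ENNReal.ofReal (κ * (2 * m * d)) * A + ENNReal.ofReal (κ * P ^ 2) * A := by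
          rw [ENNReal.ofReal_add (by positivity) (by positivity), add_mul]
      _ ≤ _ := add_le_add hi hb
      _ = B * ((∫⁻ x in cells p L, eDens V ψ (F \ S) x) + ∫⁻ x in cells p L, eDens V ψ S x) +
          ENNReal.ofReal (κ * (m ^ 2 + 2 * (d + P))) * A := by
          rw [show κ * (m ^ 2 + 2 * (d + P)) = κ * (m ^ 2 + 2 * d) + 2 * κ * P by ring,
            ENNReal.ofReal_add (by positivity) (by positivity)]
          ring
      _ ≤ _ := by gcongr

/-- Corner of the square with index `c` in the subdivision of the box into squares of side `L`. -/
def corner (T L : ℝ) {M : ℕ} (c : Fin 2 → Fin M) : Vec 2 := fun k => -T / 2 + (c k : ℝ) * L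

lemma exists_fin_mem_Ico {T L : ℝ} {M : ℕ} (hL : 0 < L) (hT : T = M * L) {t : ℝ}
    (ht : t ∈ Set.Ico (-T / 2) (T / 2)) :
    ∃ c : Fin M, t ∈ Set.Ico (-T / 2 + (c : ℝ) * L) (-T / 2 + (c : ℝ) * L + L) := by
  have h0 : 0 ≤ (t + T / 2) / L := div_nonneg (by linarith [ht.1]) hL.le
  have hM : (t + T / 2) / L < M := by
    rw [div_lt_iff₀ hL, ← hT]; linarith [ht.2]
  refine ⟨⟨⌊(t + T / 2) / L⌋₊, (Nat.floor_lt h0).2 hM⟩, ?_⟩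
  have h1 := (le_div_iff₀ hL).1 (Nat.floor_le h0)
  have h2 := (div_lt_iff₀ hL).1 (Nat.lt_floor_add_one ((t + T / 2) / L))
  constructor
  · simp only; linarith
  · simp only; linarith

lemma mem_Ico_unique {s L t : ℝ} (hL : 0 < L) {c d : ℕ}
    (hc : t ∈ Set.Ico (s + c * L) (s + c * L + L)) (hd : t ∈ Set.Ico (s + d * L) (s + d * L + L)) :
    c = d := by
  have h1 : (c : ℝ) < d + 1 := by
    have := hc.1.trans_lt hd.2
    by_contra h; push Not at h; nlinarith
  have h2 : (d : ℝ) < c + 1 := by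
    have := hd.1.trans_lt hc.2
    by_contra h; push Not at h; nlinarith
  have h3 : c < d + 1 := by exact_mod_cast h1
  have h4 : d < c + 1 := by exact_mod_cast h2
  omega

lemma iUnion_cells_corner (N : ℕ) {T L : ℝ} {M : ℕ} (hL : 0 < L) (hT : T = M * L) :
    ⋃ α : Fin N → Fin 2 → Fin M, cells (fun i => corner T L (α i)) L =
      cells (fun _ => fun _ => -T / 2) T := by
  ext x
  simp only [Set.mem_iUnion]
  constructor
  · rintro ⟨α, h⟩ i - k -
    have := h i trivial k trivial
    simp only [corner, Set.mem_Ico] at this ⊢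
    have hc : ((α i k : ℕ) : ℝ) + 1 ≤ M := by exact_mod_cast (α i k).2
    have h0 : (0 : ℝ) ≤ ((α i k : ℕ) : ℝ) := Nat.cast_nonneg _
    constructor <;> nlinarith [this.1, this.2]
  · intro h
    have h2 : ∀ i k, ∃ c : Fin M,
        x i k ∈ Set.Ico (-T / 2 + (c : ℝ) * L) (-T / 2 + (c : ℝ) * L + L) := by
      intro i k
      refine exists_fin_mem_Ico hL hT ?_
      have := h i trivial k trivial
      simp only [Set.mem_Ico] at this ⊢
      constructor <;> linarith [this.1, this.2]
    choose α hα using h2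
    exact ⟨α, fun i _ k _ => hα i k⟩

lemma pairwise_disjoint_cells_corner (N : ℕ) {T L : ℝ} {M : ℕ} (hL : 0 < L) :
    Pairwise (Function.onFun Disjoint
      fun α : Fin N → Fin 2 → Fin M => cells (fun i => corner T L (α i)) L) := by
  intro α β hαβ
  rw [Function.onFun, Set.disjoint_left]
  intro x hx hy
  refine hαβ (funext fun i => funext fun k => Fin.ext ?_)
  exact mem_Ico_unique hL (hx i trivial k trivial) (hy i trivial k trivial)

lemma box_ae_eq_cells (N : ℕ) (T : ℝ) :
    box 2 N T =ᵐ[volume] cells (fun _ : Fin N => fun _ => -T / 2) T := by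
  have h : box 2 N T = Set.univ.pi fun _ : Fin N =>
      Set.univ.pi fun _ : Fin 2 => Set.Icc (-T / 2) (T / 2) := by
    ext x; simp only [box, Set.mem_pi, Set.mem_ofPred_eq, Set.mem_univ, true_imp_iff]
  rw [h, cells]
  refine Measure.ae_eq_set_pi fun i _ => Measure.ae_eq_set_pi fun k _ => ?_
  have : -T / 2 + T = T / 2 := by ring
  simp only [this]
  exact Ico_ae_eq_Icc.symm

/-- Splitting an integral over the box into integrals over products of squares. -/
lemma lintegral_box_eq_sum (N : ℕ) {T L : ℝ} {M : ℕ} (hL : 0 < L) (hT : T = M * L)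
    (G : (Fin N → Vec 2) → ℝ≥0∞) :
    ∫⁻ x in box 2 N T, G x =
      ∑ α : Fin N → Fin 2 → Fin M, ∫⁻ x in cells (fun i => corner T L (α i)) L, G x := by
  rw [setLIntegral_congr (box_ae_eq_cells N T), ← iUnion_cells_corner N hL hT,
    lintegral_iUnion (fun α => measurableSet_cells _ _) (pairwise_disjoint_cells_corner N hL),
    tsum_fintype]

lemma le_periodize (V : Vec 2 → ℝ≥0∞) (T : ℝ) (z : Vec 2) : V z ≤ periodize 2 V T z := by
  refine le_trans (le_of_eq ?_) (ENNReal.le_tsum (0 : Fin 2 → ℤ))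
  simp

lemma sum_offDiag_half {ι : Type*} [Fintype ι] [LinearOrder ι] (g : ι → ι → ℝ≥0∞)
    (hg : ∀ i j, g i j = g j i) :
    ∑ i, ∑ j ∈ Finset.univ.erase i, g i j / 2 = ∑ i, ∑ j, if i < j then g i j else 0 := by
  have h : ∀ i, ∑ j ∈ Finset.univ.erase i, g i j / 2 =
      ∑ j, ((if i < j then g i j / 2 else 0) + if j < i then g j i / 2 else 0) := by
    intro i
    rw [← Finset.sum_erase (s := Finset.univ) (a := i) (f := fun j =>
      ((if i < j then g i j / 2 else 0) + if j < i then g j i / 2 else 0)) (by simp)]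
    refine Finset.sum_congr rfl fun j hj => ?_
    rcases lt_or_gt_of_ne (Finset.ne_of_mem_erase hj) with h | h
    · rw [if_neg h.not_gt, if_pos h, zero_add, hg]
    · rw [if_neg h.not_gt, if_pos h, add_zero]
  simp_rw [h, Finset.sum_add_distrib]
  rw [Finset.sum_comm (f := fun i j => if j < i then g j i / 2 else 0), ← Finset.sum_add_distrib]
  refine Finset.sum_congr rfl fun i _ => ?_
  rw [← Finset.sum_add_distrib]
  refine Finset.sum_congr rfl fun j _ => ?_
  split_ifs <;> simp

lemma radial_neg {V : Vec 2 → ℝ≥0∞}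
    (hVrad : ∀ x y : Vec 2, ∑ k, (x k) ^ 2 = ∑ k, (y k) ^ 2 → V x = V y) (x y : Vec 2) :
    V (x - y) = V (y - x) := by
  apply hVrad
  refine Finset.sum_congr rfl fun k _ => ?_
  simp only [Pi.sub_apply]; ring

/-- The total energy dominates the integral of the unperiodized energy density. -/
lemma lintegral_eDens_le_energy {N : ℕ} {V : Vec 2 → ℝ≥0∞} (hV : Measurable V)
    (hVrad : ∀ x y : Vec 2, ∑ k, (x k) ^ 2 = ∑ k, (y k) ^ 2 → V x = V y)
    {ψ : (Fin N → Vec 2) → ℂ} (hψ : Measurable ψ) (T : ℝ) :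
    ∫⁻ x in box 2 N T, eDens V ψ Finset.univ x ≤ kineticE 2 N T ψ + interE 2 N T V ψ := by
  have h1 : ∫⁻ x in box 2 N T, eDens V ψ Finset.univ x =
      (∑ i, ∫⁻ x in box 2 N T, gradAt ψ i x) +
        ∑ i, ∑ j ∈ Finset.univ.erase i,
          (∫⁻ x in box 2 N T, V (x i - x j) * ‖ψ x‖ₑ ^ 2) / 2 := by
    simp only [eDens]
    have hm : ∀ i : Fin N, Measurable fun x => gradAt ψ i x +
        ∑ j ∈ Finset.univ.erase i, V (x i - x j) * ‖ψ x‖ₑ ^ 2 / 2 := fun i =>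
      (measurable_gradAt ψ i).add
        (Finset.measurable_sum _ fun j _ => measurable_pairTerm hV hψ i j)
    rw [lintegral_finsetSum _ fun i _ => hm i, ← Finset.sum_add_distrib]
    refine Finset.sum_congr rfl fun i _ => ?_
    rw [lintegral_add_left (measurable_gradAt ψ i),
      lintegral_finsetSum _ fun j _ => measurable_pairTerm hV hψ i j]
    congr 1
    refine Finset.sum_congr rfl fun j _ => ?_
    simp only [div_eq_mul_inv]
    exact lintegral_mul_const' _ _ (by finiteness)
  rw [h1]
  refine add_le_add (le_of_eq ?_) ?_
  · simp only [kineticE, gradAt, ← enorm_eq_nnnorm]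
    refine Finset.sum_congr rfl fun i _ => ?_
    exact lintegral_finsetSum _ fun k _ =>
      (measurable_fderiv_apply_const ℝ ψ _).enorm.pow_const 2
  · rw [sum_offDiag_half (fun i j => ∫⁻ x in box 2 N T, V (x i - x j) * ‖ψ x‖ₑ ^ 2)
      fun i j => by simp only [radial_neg hVrad (_ : Vec 2) _]]
    simp only [interE, ← enorm_eq_nnnorm]
    refine Finset.sum_le_sum fun i _ => Finset.sum_le_sum fun j _ => ?_
    split_ifs
    · refine lintegral_mono fun x => ?_
      gcongr
      exact le_periodize V T _
    · exact le_rfl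

/-- Lower bound for the energy of a normalized wave function on the torus. -/
lemma energy_lower {N : ℕ} {V : Vec 2 → ℝ≥0∞} {a ℓ₀ : ℝ} (hV : ScatteringBound V a ℓ₀)
    {ψ : (Fin N → Vec 2) → ℂ} (hψ : ContDiff ℝ (⊤ : ℕ∞) ψ)
    {T L θ η κ m : ℝ} {P M : ℕ} (hL : 0 < L) (hT : T = M * L)
    (hθ : 0 < θ) (hθ2 : 2 * θ ≤ 1) (hR : 2 * ℓ₀ ≤ θ * L) (hη : 0 < η)
    (hκ : κ = 2 * π / Real.log (θ * L / a)) (hκ0 : 0 ≤ κ)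
    (hA : (1 + 1 / η) * (1 / Real.log (θ * L / a) * (8 / (3 * (θ * L) ^ 2)) * (2 * L ^ 4)) ≤
      η * L ^ 2)
    (h1 : 8 * θ * P + 32 * θ ^ 2 * P ^ 2 ≤ 1) (h2 : κ * (4 * P + 4 * P ^ 2) ≤ η)
    (hm : 0 ≤ m) (hP : 2 * m ≤ P) (hP0 : 0 < P) (hmM : m * M ^ 2 = N)
    (hnorm : ∫⁻ x in box 2 N T, (‖ψ x‖₊ : ℝ≥0∞) ^ 2 = 1)
    (hfin : kineticE 2 N T ψ + interE 2 N T V ψ ≠ ⊤) :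
    κ * N * (m - 2) ≤ (1 + 3 * η) * L ^ 2 * (kineticE 2 N T ψ + interE 2 N T V ψ).toReal := by
  classical
  simp only [← enorm_eq_nnnorm] at hnorm
  have hψm : Measurable ψ := hψ.continuous.measurable
  set B := ENNReal.ofReal ((1 + 3 * η) * L ^ 2) with hB
  have hα : ∀ α : Fin N → Fin 2 → Fin M,
      ENNReal.ofReal (κ * (2 * m * N)) *
        (∫⁻ x in cells (fun i => corner T L (α i)) L, ‖ψ x‖ₑ ^ 2) ≤
      B * (∫⁻ x in cells (fun i => corner T L (α i)) L, eDens V ψ Finset.univ x) +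
      ENNReal.ofReal (κ * (m ^ 2 * M ^ 2 + 2 * N)) *
        ∫⁻ x in cells (fun i => corner T L (α i)) L, ‖ψ x‖ₑ ^ 2 := by
    intro α
    set A := ∫⁻ x in cells (fun i => corner T L (α i)) L, ‖ψ x‖ₑ ^ 2 with hA
    set F : (Fin 2 → Fin M) → Finset (Fin N) := fun c => Finset.univ.filter fun i => α i = c with hF
    have hcell := fun c : Fin 2 → Fin M => many_particles_bound hV hψ
      (p := fun i => corner T L (α i)) (p₀ := corner T L c) hL hθ hθ2 hR hη hκ hκ0
          ‹_› h1 h2 hm hP hP0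
      (F c) (by intro i hi; rw [(Finset.mem_filter.1 hi).2])
    rw [← hA, ← hB] at hcell
    have hsum := Finset.sum_le_sum fun c (_ : c ∈ (Finset.univ : Finset (Fin 2 → Fin M))) => hcell c
    have hN : ∑ c, ((F c).card : ℝ) = N := by
      have := Finset.card_eq_sum_card_fiberwise (f := α) (s := Finset.univ) (t := Finset.univ)
        (fun _ _ => Finset.mem_coe.2 (Finset.mem_univ _))
      rw [Finset.card_univ, Fintype.card_fin] at this
      exact_mod_cast this.symm
    have he : ∑ c, ∫⁻ x in cells (fun i => corner T L (α i)) L, eDens V ψ (F c) x ≤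
        ∫⁻ x in cells (fun i => corner T L (α i)) L, eDens V ψ Finset.univ x := by
      rw [← lintegral_finsetSum _ fun c _ => measurable_eDens hV.meas hψm _]
      refine lintegral_mono fun x => sum_eDens_le_eDens_biUnion V ψ _ F ?_
        (fun _ _ => Finset.subset_univ _) x
      intro c _ d _ hcd
      rw [Function.onFun, Finset.disjoint_left]
      intro i hi hj
      exact hcd ((Finset.mem_filter.1 hi).2.symm.trans (Finset.mem_filter.1 hj).2)
    rw [Finset.sum_add_distrib, ← Finset.sum_mul, ← Finset.sum_mul, ← Finset.mul_sum,
      ← ENNReal.ofReal_sum_of_nonneg (fun _ _ => by positivity),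
      ← ENNReal.ofReal_sum_of_nonneg (fun _ _ => by positivity), ← Finset.mul_sum, ← Finset.mul_sum,
      ← Finset.mul_sum, Finset.sum_add_distrib, ← Finset.mul_sum, hN, Finset.sum_const,
      Finset.card_univ, Fintype.card_fun, Fintype.card_fin, Fintype.card_fin, nsmul_eq_mul] at hsum
    push_cast at hsum
    rw [mul_comm ((M : ℝ) ^ 2)] at hsum
    exact hsum.trans (by gcongr)
  have hsum := Finset.sum_le_sum fun α (_ : α ∈ (Finset.univ : Finset (Fin N → Fin 2 → Fin M))) =>
    hα α
  rw [Finset.sum_add_distrib, ← Finset.mul_sum, ← Finset.mul_sum, ← Finset.mul_sum,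
    ← lintegral_box_eq_sum N hL hT, ← lintegral_box_eq_sum N hL hT, hnorm, mul_one, mul_one] at hsum
  have hE := hsum.trans (add_le_add (mul_le_mul_right
    (lintegral_eDens_le_energy hV.meas hV.radial hψm T) B) le_rfl)
  rw [← ENNReal.ofReal_toReal hfin, hB, ← ENNReal.ofReal_mul (by positivity),
    ← ENNReal.ofReal_add (by positivity) (by positivity)] at hE
  have hE2 := (ENNReal.ofReal_le_ofReal_iff (by positivity)).1 hE
  have : m ^ 2 * (M : ℝ) ^ 2 = m * N := by rw [← hmM]; ring
  rw [this] at hE2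
  linarith

lemma tendsto_inv_sqrt_nhdsGT_zero :
    Tendsto (fun ρ : ℝ => (√ρ)⁻¹) (nhdsWithin 0 (Set.Ioi 0)) atTop := by
  refine tendsto_inv_nhdsGT_zero.comp ?_
  refine tendsto_nhdsWithin_iff.2 ⟨?_, ?_⟩
  · have := (Real.continuous_sqrt.tendsto 0).mono_left (nhdsWithin_le_nhds (s := Set.Ioi 0))
    simpa using this
  · filter_upwards [self_mem_nhdsWithin] with ρ hρ
    exact Real.sqrt_pos.2 hρ

lemma tendsto_log_const_mul_inv_sqrt {c : ℝ} (hc : 0 < c) :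
    Tendsto (fun ρ : ℝ => Real.log (c * (√ρ)⁻¹)) (nhdsWithin 0 (Set.Ioi 0)) atTop :=
  Real.tendsto_log_atTop.comp (tendsto_inv_sqrt_nhdsGT_zero.const_mul_atTop hc)

lemma sideLength_sq {ρ : ℝ} (hρ : 0 < ρ) (N : ℕ) : sideLength 2 ρ N ^ 2 = N / ρ := by
  have h : (0 : ℝ) ≤ N / ρ := by positivity
  rw [sideLength, Nat.cast_ofNat, ← Real.sqrt_eq_rpow, Real.sq_sqrt h]

lemma sideLength_nonneg {ρ : ℝ} (hρ : 0 < ρ) (N : ℕ) : 0 ≤ sideLength 2 ρ N :=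
  Real.rpow_nonneg (by positivity) _

lemma exists_subdivision {T L₀ : ℝ} (hL₀ : 0 < L₀) (hT : L₀ ≤ T) :
    ∃ (M : ℕ) (L : ℝ), 0 < M ∧ T = M * L ∧ L₀ ≤ L ∧ L ≤ 2 * L₀ := by
  have h1 : 1 ≤ T / L₀ := (one_le_div hL₀).2 hT
  have hM : 1 ≤ ⌊T / L₀⌋₊ := Nat.one_le_floor_iff _ |>.2 h1
  have hM' : (1 : ℝ) ≤ ⌊T / L₀⌋₊ := by exact_mod_cast hM
  have hM0 : (0 : ℝ) < ⌊T / L₀⌋₊ := by linarith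
  refine ⟨⌊T / L₀⌋₊, T / ⌊T / L₀⌋₊, hM, (mul_div_cancel₀ _ hM0.ne').symm, ?_, ?_⟩
  · rw [le_div_iff₀ hM0]
    have := (le_div_iff₀ hL₀).1 (Nat.floor_le (by linarith : 0 ≤ T / L₀))
    linarith
  · rw [div_le_iff₀ hM0]
    have := (div_lt_iff₀ hL₀).1 (Nat.lt_floor_add_one (T / L₀))
    nlinarith

lemma log_le_half_abs_log {a ρ c : ℝ} (ha : 0 < a) (hρ : 0 < ρ) (hc : 0 < c) (hc1 : c ≤ 1)
    (hρa : ρ * a ^ 2 < 1) :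
    Real.log (c / a * (√ρ)⁻¹) ≤ |Real.log (ρ * a ^ 2)| / 2 := by
  have hs : 0 < √ρ := Real.sqrt_pos.2 hρ
  rw [abs_of_neg (Real.log_neg (by positivity) hρa), Real.log_mul (by positivity) (by positivity),
    Real.log_mul (by positivity) (by positivity), Real.log_div (by positivity) (by positivity),
    Real.log_inv, Real.log_pow, Real.log_sqrt hρ.le]
  have := Real.log_nonpos hc.le hc1
  push_cast
  linarith

set_option maxHeartbeats 800000 in
/-- Lower bound for the energy per area at fixed small density. -/
lemma energy_lower_density {V : Vec 2 → ℝ≥0∞} {a ℓ₀ : ℝ} (hV : ScatteringBound V a ℓ₀)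
    {η : ℝ} (hη : 0 < η) {K : ℕ} (hK : 2 ≤ K) :
    ∀ᶠ ρ : ℝ in nhdsWithin 0 (Set.Ioi 0), ∀ N : ℕ, K ^ 2 ≤ N → ∀ ψ : (Fin N → Vec 2) → ℂ,
      IsTrialState 2 N (sideLength 2 ρ N) ψ →
      kineticE 2 N (sideLength 2 ρ N) ψ + interE 2 N (sideLength 2 ρ N) V ψ ≠ ⊤ →
      (1 - 2 / (K : ℝ) ^ 2) / (1 + 3 * η) * (4 * π * ρ ^ 2 * bParam a ρ) *
        sideLength 2 ρ N ^ 2 ≤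
      (kineticE 2 N (sideLength 2 ρ N) ψ + interE 2 N (sideLength 2 ρ N) V ψ).toReal := by
  have ha := hV.pos
  have hK0 : (2 : ℝ) ≤ K := by exact_mod_cast hK
  set P : ℕ := 8 * K ^ 2 with hPdef
  have hPc : (P : ℝ) = 8 * (K : ℝ) ^ 2 := by rw [hPdef]; push_cast; ring
  have hP1 : (32 : ℝ) ≤ P := by rw [hPc]; nlinarith
  set θ : ℝ := 1 / (16 * P) with hθdef
  have hθ : 0 < θ := by positivity
  have hθP : θ * P = 1 / 16 := by rw [hθdef]; field_simp
  have hθ2 : 2 * θ ≤ 1 := by nlinarith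
  have hθK : 2 * θ * K ≤ 1 := by
    have h2 : (K : ℝ) ≤ P := by rw [hPc]; nlinarith
    have h3 := mul_le_mul_of_nonneg_left h2 hθ.le
    linarith
  have hP0 : 0 < P := by rw [hPdef]; positivity
  clear_value θ P
  have hc : 0 < θ * K / a := by positivity
  have t1 := (tendsto_log_const_mul_inv_sqrt hc).eventually_ge_atTop
    (1 + 2 * π * (4 * P + 4 * P ^ 2) / η + (1 + 1 / η) * (16 / (3 * θ ^ 2)) / η)
  have t2 := (tendsto_inv_sqrt_nhdsGT_zero.const_mul_atTop
    (show 0 < θ * K by positivity)).eventually_ge_atTop (2 * ℓ₀)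
  have t3 : ∀ᶠ ρ : ℝ in nhdsWithin 0 (Set.Ioi 0), ρ < 1 / a ^ 2 :=
    mem_nhdsWithin_of_mem_nhds (Iio_mem_nhds (by positivity))
  filter_upwards [t1, t2, t3, self_mem_nhdsWithin] with ρ h1 h2 h3 hρ N hN ψ hψ hfin
  replace hρ : 0 < ρ := hρ
  have hs : 0 < √ρ := Real.sqrt_pos.2 hρ
  have hN0 : (0 : ℝ) < N := by
    have : 0 < N := lt_of_lt_of_le (by positivity) hN
    exact_mod_cast this
  have hNK : (K : ℝ) ^ 2 ≤ N := by exact_mod_cast hN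
  set T := sideLength 2 ρ N with hTdef
  have hT2 : T ^ 2 = N / ρ := sideLength_sq hρ N
  have hT0 : 0 ≤ T := sideLength_nonneg hρ N
  set L₀ := K * (√ρ)⁻¹ with hL₀def
  have hL₀ : 0 < L₀ := by positivity
  have hL₀2 : L₀ ^ 2 = K ^ 2 / ρ := by
    rw [hL₀def, mul_pow, inv_pow, Real.sq_sqrt hρ.le]; rfl
  have hL₀T : L₀ ≤ T := by
    refine le_of_sq_le_sq ?_ hT0
    rw [hL₀2, hT2]
    gcongr
  obtain ⟨M, L, hM, hTL, hLlo, hLhi⟩ := exists_subdivision hL₀ hL₀T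
  have hL : 0 < L := hL₀.trans_le hLlo
  have hM0 : (0 : ℝ) < M := by exact_mod_cast hM
  have hLρ : ρ * L ^ 2 * M ^ 2 = N := by
    have : (M * L) ^ 2 = N / ρ := by rw [← hTL, hT2]
    field_simp at this
    linarith
  have hmlo : (K : ℝ) ^ 2 ≤ ρ * L ^ 2 := by
    have : L₀ ^ 2 ≤ L ^ 2 := by gcongr
    rw [hL₀2, div_le_iff₀ hρ] at this
    linarith
  have hmhi : 2 * (ρ * L ^ 2) ≤ P := by
    have : L ^ 2 ≤ (2 * L₀) ^ 2 := by gcongr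
    rw [mul_pow, hL₀2, mul_div_assoc', le_div_iff₀ hρ] at this
    rw [hPc]
    linarith
  set lg := Real.log (θ * L / a) with hlg
  have hX : 0 ≤ 2 * π * (4 * P + 4 * P ^ 2) / η := by positivity
  have hY : 0 ≤ (1 + 1 / η) * (16 / (3 * θ ^ 2)) / η := by positivity
  have hlglo : Real.log (θ * K / a * (√ρ)⁻¹) ≤ lg := by
    refine Real.log_le_log (by positivity) ?_
    rw [div_mul_eq_mul_div, mul_assoc]
    gcongr
  have hlghi : lg ≤ |Real.log (ρ * a ^ 2)| / 2 := by
    refine le_trans (Real.log_le_log (by positivity) ?_)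
      (log_le_half_abs_log ha hρ (show 0 < 2 * θ * K by positivity) hθK
        ((lt_div_iff₀ (by positivity)).1 h3))
    rw [div_mul_eq_mul_div]
    refine div_le_div_of_nonneg_right ?_ ha.le
    have := mul_le_mul_of_nonneg_left hLhi hθ.le
    linarith
  have hlg1 : 1 ≤ lg := by linarith
  have hlgX : 2 * π * (4 * P + 4 * P ^ 2) ≤ η * lg := by
    have : 2 * π * (4 * P + 4 * P ^ 2) / η ≤ lg := by linarith
    rw [div_le_iff₀ hη] at this
    linarith
  have hlgY : (1 + 1 / η) * (16 / (3 * θ ^ 2)) ≤ η * lg := by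
    have : (1 + 1 / η) * (16 / (3 * θ ^ 2)) / η ≤ lg := by linarith
    rw [div_le_iff₀ hη] at this
    linarith
  have hlg0 : 0 < lg := by linarith
  have hmain := energy_lower (N := N) hV hψ.1 (T := T) (L := L) (θ := θ) (η := η) (κ := 2 * π / lg)
    (m := ρ * L ^ 2) (P := P) (M := M) hL hTL hθ hθ2 ?_ hη rfl (by positivity) ?_ ?_ ?_
    (by positivity) hmhi hP0 hLρ hψ.2.2.2 hfin
  · set E := (kineticE 2 N T ψ + interE 2 N T V ψ).toReal with hE
    have hb : 2 * bParam a ρ ≤ 1 / lg := by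
      rw [bParam, le_div_iff₀ hlg0]
      have hpos : 0 < |Real.log (ρ * a ^ 2)| := by linarith
      rw [mul_assoc, inv_mul_eq_div, mul_div_assoc', div_le_one hpos]
      linarith
    have hK2 : 2 / (K : ℝ) ^ 2 ≤ 1 := by
      rw [div_le_one (by positivity)]; nlinarith
    have hfrac : ρ * L ^ 2 * (1 - 2 / (K : ℝ) ^ 2) ≤ ρ * L ^ 2 - 2 := by
      have : 2 ≤ ρ * L ^ 2 * (2 / (K : ℝ) ^ 2) := by
        rw [mul_div_assoc', le_div_iff₀ (by positivity)]
        linarith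
      linarith
    have hb0 : 0 ≤ bParam a ρ := inv_nonneg.2 (abs_nonneg _)
    rw [hT2, div_mul_eq_mul_div, div_mul_eq_mul_div, div_le_iff₀ (by positivity)]
    have step : 2 * π * (2 * bParam a ρ) * N * (ρ * L ^ 2 * (1 - 2 / (K : ℝ) ^ 2)) ≤
        (1 + 3 * η) * L ^ 2 * E := by
      refine le_trans ?_ hmain
      rw [div_eq_mul_one_div (2 * π) lg]
      have h0 : 0 ≤ ρ * L ^ 2 * (1 - 2 / (K : ℝ) ^ 2) := mul_nonneg (by positivity) (by linarith)
      gcongr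
    have hL2 : 0 < L ^ 2 := by positivity
    refine le_of_mul_le_mul_left ?_ hL2
    calc _ = 2 * π * (2 * bParam a ρ) * N * (ρ * L ^ 2 * (1 - 2 / (K : ℝ) ^ 2)) := by
          field_simp
          ring
      _ ≤ _ := step
      _ = _ := by ring
  · refine h2.trans ?_
    rw [mul_assoc]
    gcongr
  · rw [show (1 + 1 / η) * (1 / lg * (8 / (3 * (θ * L) ^ 2)) * (2 * L ^ 4)) =
      (1 + 1 / η) * (16 / (3 * θ ^ 2)) / lg * L ^ 2 by field_simp; ring]
    gcongr
    rw [div_le_iff₀ hlg0]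
    exact hlgY
  · have : 32 * θ ^ 2 * (P : ℝ) ^ 2 = 32 * (θ * P) ^ 2 := by ring
    rw [this, mul_assoc, hθP]
    norm_num
  · rw [div_mul_eq_mul_div, div_le_iff₀ hlg0]
    exact hlgX

section

/-- Functions on the plane with period `T` in both coordinates. -/
def IsPeriodic {β : Type*} (T : ℝ) (h : Vec 2 → β) : Prop :=
  ∀ (z : Vec 2) (n : Fin 2 → ℤ), h (fun k => z k + T * n k) = h z

lemma setLIntegral_Ico_periodic {T : ℝ} (hT : 0 < T) (s t : ℝ) {h : ℝ → ℝ≥0∞}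
    (hh : ∀ (x : ℝ) (n : ℤ), h (x + T * n) = h x) :
    ∫⁻ x in Set.Ico s (s + T), h x = ∫⁻ x in Set.Ico t (t + T), h x := by
  rw [setLIntegral_congr (Ico_ae_eq_Ioc' (by simp) (by simp)),
    setLIntegral_congr (Ico_ae_eq_Ioc' (a := t) (by simp) (by simp))]
  refine (isAddFundamentalDomain_Ioc hT s).setLIntegral_eq (isAddFundamentalDomain_Ioc hT t) h ?_
  rintro ⟨g, n, rfl⟩ x
  rw [← hh x n]
  congr 1
  change n • T + x = _
  rw [zsmul_eq_mul]; ring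

/-- The integral of a periodic function over a full cell does not depend on the cell. -/
lemma setLIntegral_square_periodic {T : ℝ} (hT : 0 < T) (p q : Vec 2) {h : Vec 2 → ℝ≥0∞}
    (hm : Measurable h) (hh : IsPeriodic T h) :
    ∫⁻ x in square p T, h x = ∫⁻ x in square q T, h x := by
  rw [lintegral_square p T hm, lintegral_square q T hm]
  have h1 : ∀ s, ∫⁻ t in Set.Ico (p 1) (p 1 + T), h ![s, t] =
      ∫⁻ t in Set.Ico (q 1) (q 1 + T), h ![s, t] := by
    intro s
    refine setLIntegral_Ico_periodic hT _ _ fun x n => ?_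
    rw [← hh ![s, x] ![0, n]]
    congr 1
    funext k; fin_cases k <;> simp
  simp_rw [h1]
  refine setLIntegral_Ico_periodic hT _ _ fun x n => ?_
  refine lintegral_congr fun t => ?_
  rw [← hh ![x, t] ![n, 0]]
  congr 1
  funext k; fin_cases k <;> simp

/-- Integral over the centered period cell. -/
def cellInt (T : ℝ) (h : Vec 2 → ℝ≥0∞) : ℝ≥0∞ := ∫⁻ y in square (fun _ => -T / 2) T, h y

lemma cellInt_translate {T : ℝ} (hT : 0 < T) {h : Vec 2 → ℝ≥0∞}
    (hm : Measurable h) (hh : IsPeriodic T h) (c : Vec 2) :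
    cellInt T (fun y => h (y - c)) = cellInt T h := by
  have e := setLIntegral_square_periodic hT (fun _ => -T / 2) ((fun _ => -T / 2) - c) hm hh
  rw [cellInt, cellInt, e,
    ← lintegral_indicator (measurableSet_square _ _),
    ← lintegral_indicator (measurableSet_square _ _),
    ← lintegral_sub_right_eq_self (Set.indicator (square ((fun _ => -T / 2) - c) T) h) c]
  refine lintegral_congr fun y => ?_
  have : y ∈ square (fun _ => -T / 2) T ↔ y - c ∈ square ((fun _ => -T / 2) - c) T := by
    simp only [square, Set.mem_pi, Set.mem_univ, true_imp_iff, Set.mem_Ico, Pi.sub_apply]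
    refine forall_congr' fun k => and_congr ?_ ?_ <;> constructor <;> intro h <;> linarith
  by_cases hy : y ∈ square (fun _ => -T / 2) T
  · rw [Set.indicator_of_mem hy, Set.indicator_of_mem (this.1 hy)]
  · rw [Set.indicator_of_notMem hy, Set.indicator_of_notMem (fun h => hy (this.2 h))]

lemma cellInt_const {T : ℝ} (hT : 0 ≤ T) (c : ℝ≥0∞) :
    cellInt T (fun _ => c) = c * ENNReal.ofReal (T ^ 2) := by
  rw [cellInt, setLIntegral_const, volume_square _ hT]

/-- Properties of the pair factor of the periodic trial function. -/
structure IsPairFactor (T : ℝ) (F : Vec 2 → ℝ) : Prop where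
  smooth : ContDiff ℝ (⊤ : ℕ∞) F
  periodic : IsPeriodic T F
  even : ∀ z, F (-z) = F z
  nonneg : ∀ z, 0 ≤ F z
  le_one : ∀ z, F z ≤ 1

variable {T : ℝ} {F : Vec 2 → ℝ}

lemma IsPairFactor.fderiv_eq_zero (hF : IsPairFactor T F) {z : Vec 2} (hz : F z = 1) :
    fderiv ℝ F z = 0 :=
  IsLocalMax.fderiv_eq_zero (Eventually.of_forall fun y => by rw [hz]; exact hF.le_one y)

lemma IsPairFactor.fderiv_periodic (hF : IsPairFactor T F) : IsPeriodic T (fderiv ℝ F) := by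
  intro z n
  have h : (fun y : Vec 2 => F (y + fun k => T * n k)) = F := funext fun y => hF.periodic y n
  have h2 := fderiv_comp_add_right (𝕜 := ℝ) (f := F) (x := z) (fun k => T * (n k : ℝ))
  rw [h] at h2
  exact h2.symm

lemma IsPairFactor.fderiv_neg (hF : IsPairFactor T F) (z : Vec 2) :
    fderiv ℝ F (-z) = -fderiv ℝ F z := by
  have h : (fun y : Vec 2 => F (-y)) = F := funext hF.even
  have h1 : HasFDerivAt (fun y : Vec 2 => -y) (-ContinuousLinearMap.id ℝ (Vec 2)) z :=
    (hasFDerivAt_id z).neg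
  have h2 := ((hF.smooth.differentiable (by simp) (-z)).hasFDerivAt.comp z h1).fderiv
  change fderiv ℝ (fun y : Vec 2 => F (-y)) z = _ at h2
  rw [h] at h2
  rw [h2]
  ext v
  simp

/-- Size of the `k`-th partial derivative. -/
def partialNorm (F : Vec 2 → ℝ) (k : Fin 2) (z : Vec 2) : ℝ≥0∞ :=
  ‖fderiv ℝ F z (Pi.single k 1)‖ₑ

lemma measurable_partialNorm (F : Vec 2 → ℝ) (k : Fin 2) : Measurable (partialNorm F k) :=
  (measurable_fderiv_apply_const ℝ F _).enorm

lemma IsPairFactor.partialNorm_periodic (hF : IsPairFactor T F) (k : Fin 2) :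
    IsPeriodic T (partialNorm F k) := fun z n => by
  simp only [partialNorm, hF.fderiv_periodic z n]

lemma IsPairFactor.partialNorm_neg (hF : IsPairFactor T F) (k : Fin 2) (z : Vec 2) :
    partialNorm F k (-z) = partialNorm F k z := by
  simp only [partialNorm, hF.fderiv_neg z]
  simp

/-- Cauchy-Schwarz for the partial derivatives, which vanish where the factor equals one. -/
lemma IsPairFactor.cellInt_partialNorm_sq_le (hF : IsPairFactor T F) (k : Fin 2) :
    cellInt T (partialNorm F k) ^ 2 ≤
      cellInt T ({z | F z ≠ 1}.indicator 1) * cellInt T (fun z => partialNorm F k z ^ 2) := by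
  have hm : MeasurableSet {z | F z ≠ 1} :=
    (hF.smooth.continuous.measurable (measurableSet_singleton 1)).compl
  have h := ENNReal.lintegral_mul_le_Lp_mul_Lq (volume.restrict (square (fun _ => -T / 2) T))
    Real.HolderConjugate.two_two (f := {z | F z ≠ 1}.indicator 1) (g := partialNorm F k)
    (measurable_const.indicator hm).aemeasurable (measurable_partialNorm F k).aemeasurable
  have e1 : ∀ z,
      ({z | F z ≠ 1}.indicator (1 : Vec 2 → ℝ≥0∞) * partialNorm F k) z = partialNorm F k z := by
    intro z
    by_cases hz : F z = 1
    · simp [partialNorm, hF.fderiv_eq_zero hz]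
    · rw [Pi.mul_apply, Set.indicator_of_mem (show z ∈ {z | F z ≠ 1} from hz), Pi.one_apply,
        one_mul]
  have e2 : ∀ z, ({z | F z ≠ 1}.indicator (1 : Vec 2 → ℝ≥0∞) z) ^ (2 : ℝ) =
      {z | F z ≠ 1}.indicator 1 z := by
    intro z
    by_cases hz : z ∈ {z | F z ≠ 1}
    · rw [Set.indicator_of_mem hz]; simp
    · rw [Set.indicator_of_notMem hz]; simp
  simp only [e1, e2] at h
  have h2 := pow_le_pow_left₀ (zero_le) h 2
  refine h2.trans_eq ?_
  rw [mul_pow, ← ENNReal.rpow_natCast, ← ENNReal.rpow_natCast, ← ENNReal.rpow_mul,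
    ← ENNReal.rpow_mul]
  simp only [cellInt]
  norm_num

end

/-- Configurations in the half-open centered box. -/
def cube (N : ℕ) (T : ℝ) : Set (Fin N → Vec 2) := cells (fun _ => fun _ => -T / 2) T

lemma lintegral_cube_mono {N : ℕ} {T : ℝ} (i : Fin N) {F G : (Fin N → Vec 2) → ℝ≥0∞}
    (hF : Measurable F) (hG : Measurable G)
    (h : ∀ x, cellInt T (fun y => F (Function.update x i y)) ≤
      cellInt T fun y => G (Function.update x i y)) :
    ∫⁻ x in cube N T, F x ≤ ∫⁻ x in cube N T, G x :=
  setLIntegral_cells_mono _ T i hF hG h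

/-- Averaging a function of `x i - x j` against a weight that does not depend on `x i`. -/
lemma lintegral_cube_mul_diff_le {N : ℕ} {T : ℝ} (hT : 0 < T) {i j : Fin N} (hij : j ≠ i)
    {G : (Fin N → Vec 2) → ℝ≥0∞} (hG : Measurable G)
    (hGi : ∀ x y, G (Function.update x i y) = G x) {h : Vec 2 → ℝ≥0∞} (hm : Measurable h)
    (hh : IsPeriodic T h) :
    ENNReal.ofReal (T ^ 2) * (∫⁻ x in cube N T, G x * h (x i - x j)) ≤
      cellInt T h * ∫⁻ x in cube N T, G x := by
  have hd : Measurable fun x : Fin N → Vec 2 => G x * h (x i - x j) :=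
    hG.mul (hm.comp ((measurable_pi_apply i).sub (measurable_pi_apply j)))
  rw [← lintegral_const_mul _ hd, ← lintegral_const_mul _ hG]
  refine lintegral_cube_mono i (hd.const_mul _) (hG.const_mul _) fun x => ?_
  simp only [hGi, Function.update_self, Function.update_of_ne hij]
  rw [cellInt_const hT.le]
  have hs : Measurable fun y : Vec 2 => h (y - x j) := hm.comp (measurable_id.sub_const _)
  have e : cellInt T (fun y => ENNReal.ofReal (T ^ 2) * (G x * h (y - x j))) =
      ENNReal.ofReal (T ^ 2) * G x * cellInt T (fun y => h (y - x j)) := by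
    rw [cellInt, cellInt, ← lintegral_const_mul _ hs]
    simp only [mul_assoc]
  rw [e, cellInt_translate hT hm hh]
  refine le_of_eq ?_
  ring

/-- Product of a function of the differences over all ordered pairs of a set of particles. -/
def pairProd {N : ℕ} (w : Vec 2 → ℝ≥0∞) (S : Finset (Fin N)) (x : Fin N → Vec 2) : ℝ≥0∞ :=
  ∏ p ∈ S.offDiag, w (x p.1 - x p.2)

lemma measurable_pairProd {N : ℕ} {w : Vec 2 → ℝ≥0∞} (hw : Measurable w) (S : Finset (Fin N)) :
    Measurable (pairProd w S) :=
  Finset.measurable_prod _ fun p _ =>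
    hw.comp ((measurable_pi_apply p.1).sub (measurable_pi_apply p.2))

lemma pairProd_insert {N : ℕ} {w : Vec 2 → ℝ≥0∞} (hw : ∀ z, w (-z) = w z) {S : Finset (Fin N)}
    {i : Fin N} (hi : i ∉ S) (x : Fin N → Vec 2) :
    pairProd w (insert i S) x = pairProd w S x * ∏ j ∈ S, w (x i - x j) ^ 2 := by
  classical
  have hd1 : Disjoint S.offDiag ({i} ×ˢ S) := by
    rw [Finset.disjoint_left]
    rintro ⟨a, b⟩ h1 h2
    simp only [Finset.mem_offDiag, Finset.mem_product, Finset.mem_singleton] at h1 h2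
    exact hi (h2.1 ▸ h1.1)
  have hd2 : Disjoint (S.offDiag ∪ {i} ×ˢ S) (S ×ˢ {i}) := by
    rw [Finset.disjoint_left]
    rintro ⟨a, b⟩ h1 h2
    simp only [Finset.mem_union, Finset.mem_offDiag, Finset.mem_product,
      Finset.mem_singleton] at h1 h2
    rcases h1 with h1 | h1
    · exact hi (h2.2 ▸ h1.2.1)
    · exact hi (h2.2 ▸ h1.2)
  rw [pairProd, Finset.offDiag_insert hi, Finset.prod_union hd2, Finset.prod_union hd1,
    Finset.prod_product, Finset.prod_product_right, Finset.prod_singleton, Finset.prod_singleton,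
    mul_assoc, ← Finset.prod_mul_distrib]
  congr 1
  refine Finset.prod_congr rfl fun j _ => ?_
  rw [← hw (x j - x i), neg_sub, sq]

lemma pairProd_update {N : ℕ} (w : Vec 2 → ℝ≥0∞) {S : Finset (Fin N)} {i : Fin N} (hi : i ∉ S)
    (x : Fin N → Vec 2) (y : Vec 2) : pairProd w S (Function.update x i y) = pairProd w S x := by
  refine Finset.prod_congr rfl fun p hp => ?_
  rw [Finset.mem_offDiag] at hp
  rw [Function.update_of_ne (fun h : p.1 = i => hi (h ▸ hp.1)),
    Function.update_of_ne (fun h : p.2 = i => hi (h ▸ hp.2.1))]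

lemma pairProd_insert_le {N : ℕ} {w : Vec 2 → ℝ≥0∞} (hw : ∀ z, w (-z) = w z) (hw1 : ∀ z, w z ≤ 1)
    {S : Finset (Fin N)} {i : Fin N} (hi : i ∉ S) (x : Fin N → Vec 2) :
    pairProd w (insert i S) x ≤ pairProd w S x := by
  rw [pairProd_insert hw hi]
  refine mul_le_of_le_one_right' ?_
  exact Finset.prod_le_one' fun j _ => pow_le_one' (hw1 _) 2

lemma one_le_prod_add_sum {ι : Type*} (s : Finset ι) {w : ι → ℝ≥0∞} :
    1 ≤ ∏ j ∈ s, w j ^ 2 + ∑ j ∈ s, {j | w j ≠ 1}.indicator (1 : ι → ℝ≥0∞) j := by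
  by_cases h : ∀ j ∈ s, w j = 1
  · rw [Finset.prod_eq_one (fun j hj => by rw [h j hj, one_pow])]
    exact le_self_add
  · push Not at h
    obtain ⟨j, hj, hw⟩ := h
    refine le_trans ?_ le_add_self
    refine le_trans ?_ (Finset.single_le_sum (fun _ _ => zero_le) hj)
    rw [Set.indicator_of_mem (show j ∈ {j | w j ≠ 1} from hw)]
    exact le_rfl

/-- Adding one particle to the product does not decrease the norm too much. -/
lemma lintegral_pairProd_insert_ge {N : ℕ} {T : ℝ} (hT : 0 < T) {w : Vec 2 → ℝ≥0∞}
    (hwm : Measurable w) (hwp : IsPeriodic T w) (hw : ∀ z, w (-z) = w z) {β : ℝ}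
    (hβ0 : 0 ≤ β) (hβ1 : β < 1)
    (hβ : N * cellInt T ({z | w z ≠ 1}.indicator 1) ≤ ENNReal.ofReal (β * T ^ 2))
    {S : Finset (Fin N)} {i : Fin N} (hi : i ∉ S) :
    ENNReal.ofReal (1 - β) * (∫⁻ x in cube N T, pairProd w S x) ≤
      ∫⁻ x in cube N T, pairProd w (insert i S) x := by
  classical
  have hmS := measurable_pairProd hwm S
  rw [← lintegral_const_mul _ hmS]
  refine lintegral_cube_mono i (hmS.const_mul _) (measurable_pairProd hwm _) fun x => ?_
  simp only [pairProd_insert hw hi, pairProd_update w hi, Function.update_self]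
  have hne : ∀ j ∈ S, j ≠ i := fun j hj h => hi (h ▸ hj)
  have e : ∀ y, ∏ j ∈ S, w (y - Function.update x i y j) ^ 2 = ∏ j ∈ S, w (y - x j) ^ 2 :=
    fun y => Finset.prod_congr rfl fun j hj => by rw [Function.update_of_ne (hne j hj)]
  simp only [e]
  have hpm : Measurable fun y => ∏ j ∈ S, w (y - x j) ^ 2 :=
    Finset.measurable_prod _ fun j _ => (hwm.comp (measurable_id.sub_const _)).pow_const 2
  have hU : MeasurableSet {z | w z ≠ 1} := (hwm (measurableSet_singleton 1)).compl
  have hUm : Measurable ({z | w z ≠ 1}.indicator (1 : Vec 2 → ℝ≥0∞)) :=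
    measurable_const.indicator hU
  have hUp : IsPeriodic T ({z | w z ≠ 1}.indicator (1 : Vec 2 → ℝ≥0∞)) := by
    intro z n
    have : (fun k => z k + T * n k) ∈ {z | w z ≠ 1} ↔ z ∈ {z | w z ≠ 1} := by
      change w _ ≠ 1 ↔ w z ≠ 1
      rw [hwp z n]
    by_cases hz : z ∈ {z | w z ≠ 1}
    · rw [Set.indicator_of_mem hz, Set.indicator_of_mem (this.2 hz)]; rfl
    · rw [Set.indicator_of_notMem hz, Set.indicator_of_notMem (fun h => hz (this.1 h))]
  have hsm : ∀ j, Measurable fun y => {z | w z ≠ 1}.indicator (1 : Vec 2 → ℝ≥0∞) (y - x j) :=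
    fun j => hUm.comp (measurable_id.sub_const _)
  have key : ENNReal.ofReal (T ^ 2) ≤ cellInt T (fun y => ∏ j ∈ S, w (y - x j) ^ 2) +
      ENNReal.ofReal (β * T ^ 2) := by
    calc ENNReal.ofReal (T ^ 2) = cellInt T fun _ => 1 := by rw [cellInt_const hT.le, one_mul]
      _ ≤ cellInt T fun y => (∏ j ∈ S, w (y - x j) ^ 2 +
          ∑ j ∈ S, {z | w z ≠ 1}.indicator (1 : Vec 2 → ℝ≥0∞) (y - x j)) :=
        lintegral_mono fun y => one_le_prod_add_sum S (w := fun j => w (y - x j))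
      _ = cellInt T (fun y => ∏ j ∈ S, w (y - x j) ^ 2) +
          S.card * cellInt T ({z | w z ≠ 1}.indicator 1) := by
        rw [cellInt, lintegral_add_left hpm, lintegral_finsetSum _ fun j _ => hsm j]
        congr 1
        rw [← nsmul_eq_mul, ← Finset.sum_const]
        exact Finset.sum_congr rfl fun j _ => cellInt_translate hT hUm hUp (x j)
      _ ≤ _ := by
        refine add_le_add le_rfl (le_trans ?_ hβ)
        gcongr
        exact (Finset.card_le_univ S).trans_eq (Fintype.card_fin N)
  have key2 : ENNReal.ofReal ((1 - β) * T ^ 2) ≤ cellInt T fun y => ∏ j ∈ S, w (y - x j) ^ 2 := by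
    rw [show (1 - β) * T ^ 2 = T ^ 2 - β * T ^ 2 by ring, ENNReal.ofReal_sub _ (by positivity)]
    exact tsub_le_iff_right.2 key
  rw [cellInt_const hT.le]
  have e2 : cellInt T (fun y => pairProd w S x * ∏ j ∈ S, w (y - x j) ^ 2) =
      pairProd w S x * cellInt T fun y => ∏ j ∈ S, w (y - x j) ^ 2 :=
    lintegral_const_mul _ hpm
  rw [e2]
  refine le_trans (le_of_eq ?_) (mul_le_mul_right key2 _)
  rw [ENNReal.ofReal_mul (by linarith)]
  ring

/-- The Jastrow product over unordered pairs from `S`. -/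
def jastrow {N : ℕ} (F : Vec 2 → ℝ) (S : Finset (Fin N)) (x : Fin N → Vec 2) : ℝ :=
  ∏ p ∈ S.offDiag with p.1 < p.2, F (x p.1 - x p.2)

lemma jastrow_nonneg {N : ℕ} {F : Vec 2 → ℝ} (hF : ∀ z, 0 ≤ F z) (S : Finset (Fin N))
    (x : Fin N → Vec 2) : 0 ≤ jastrow F S x :=
  Finset.prod_nonneg fun _ _ => hF _

lemma ofReal_jastrow_sq {N : ℕ} {F : Vec 2 → ℝ} (hF : ∀ z, 0 ≤ F z) (he : ∀ z, F (-z) = F z)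
    (S : Finset (Fin N)) (x : Fin N → Vec 2) :
    ENNReal.ofReal (jastrow F S x) ^ 2 = pairProd (fun z => ENNReal.ofReal (F z)) S x := by
  rw [jastrow, ENNReal.ofReal_prod_of_nonneg fun _ _ => hF _, pairProd,
    ← Finset.prod_filter_mul_prod_filter_not S.offDiag (fun p => p.1 < p.2), sq]
  congr 1
  refine Finset.prod_bij' (fun p _ => p.swap) (fun p _ => p.swap) ?_ ?_ ?_ ?_ ?_
  · rintro ⟨a, b⟩ h
    simp only [Finset.mem_filter, Finset.mem_offDiag, Prod.swap_prod_mk, not_lt] at h ⊢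
    exact ⟨⟨h.1.2.1, h.1.1, h.1.2.2.symm⟩, h.2.le⟩
  · rintro ⟨a, b⟩ h
    simp only [Finset.mem_filter, Finset.mem_offDiag, Prod.swap_prod_mk, not_lt] at h ⊢
    exact ⟨⟨h.1.2.1, h.1.1, h.1.2.2.symm⟩, lt_of_le_of_ne h.2 h.1.2.2.symm⟩
  · simp
  · simp
  · rintro ⟨a, b⟩ _
    simp only [Prod.fst_swap, Prod.snd_swap]
    rw [← he (x b - x a), neg_sub]

lemma eq_of_ofReal_sq_eq {a b : ℝ} (ha : 0 ≤ a) (hb : 0 ≤ b)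
    (h : ENNReal.ofReal a ^ 2 = ENNReal.ofReal b ^ 2) : a = b := by
  rw [← ENNReal.ofReal_pow ha, ← ENNReal.ofReal_pow hb,
    ENNReal.ofReal_eq_ofReal_iff (by positivity) (by positivity)] at h
  exact (pow_left_inj₀ ha hb (by norm_num)).1 h

lemma jastrow_comp_perm {N : ℕ} {F : Vec 2 → ℝ} (hF : ∀ z, 0 ≤ F z) (he : ∀ z, F (-z) = F z)
    (σ : Equiv.Perm (Fin N)) (x : Fin N → Vec 2) :
    jastrow F Finset.univ (x ∘ σ) = jastrow F Finset.univ x := by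
  refine eq_of_ofReal_sq_eq (jastrow_nonneg hF _ _) (jastrow_nonneg hF _ _) ?_
  rw [ofReal_jastrow_sq hF he, ofReal_jastrow_sq hF he]
  refine Finset.prod_equiv (σ.prodCongr σ) ?_ ?_
  · rintro ⟨a, b⟩; simp
  · rintro ⟨a, b⟩ _; simp

lemma jastrow_insert {N : ℕ} {F : Vec 2 → ℝ} (hF : ∀ z, 0 ≤ F z) (he : ∀ z, F (-z) = F z)
    {S : Finset (Fin N)} {i : Fin N} (hi : i ∉ S) (x : Fin N → Vec 2) :
    jastrow F (insert i S) x = jastrow F S x * ∏ j ∈ S, F (x i - x j) := by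
  have hp : 0 ≤ ∏ j ∈ S, F (x i - x j) := Finset.prod_nonneg fun _ _ => hF _
  have hj := jastrow_nonneg hF S x
  refine eq_of_ofReal_sq_eq (jastrow_nonneg hF _ _) (mul_nonneg hj hp) ?_
  rw [ENNReal.ofReal_mul hj, mul_pow, ofReal_jastrow_sq hF he, ofReal_jastrow_sq hF he,
    pairProd_insert (fun z => by rw [he]) hi, ENNReal.ofReal_prod_of_nonneg fun _ _ => hF _,
    Finset.prod_pow]

lemma jastrow_update {N : ℕ} {F : Vec 2 → ℝ} {S : Finset (Fin N)} {i : Fin N} (hi : i ∉ S)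
    (x : Fin N → Vec 2) (y : Vec 2) : jastrow F S (Function.update x i y) = jastrow F S x := by
  refine Finset.prod_congr rfl fun p hp => ?_
  rw [Finset.mem_filter, Finset.mem_offDiag] at hp
  rw [Function.update_of_ne (fun h : p.1 = i => hi (h ▸ hp.1.1)),
    Function.update_of_ne (fun h : p.2 = i => hi (h ▸ hp.1.2.1))]

lemma contDiff_jastrow {N : ℕ} {F : Vec 2 → ℝ} (hF : ContDiff ℝ (⊤ : ℕ∞) F) (S : Finset (Fin N)) :
    ContDiff ℝ (⊤ : ℕ∞) (jastrow F S) :=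
  contDiff_prod fun p _ => hF.comp
      ((contDiff_apply ℝ (Vec 2) p.1).sub (contDiff_apply ℝ (Vec 2) p.2))

lemma jastrow_periodic {N : ℕ} {T : ℝ} {F : Vec 2 → ℝ} (hF : IsPeriodic T F) (S : Finset (Fin N))
    (x : Fin N → Vec 2) (v : Fin N → Fin 2 → ℤ) :
    jastrow F S (fun i k => x i k + T * v i k) = jastrow F S x := by
  refine Finset.prod_congr rfl fun p _ => ?_
  rw [← hF (x p.1 - x p.2) (v p.1 - v p.2)]
  congr 1
  funext k
  simp only [Pi.sub_apply, Int.cast_sub]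
  ring

/-- The derivative of a product of translates of a pair factor. -/
lemma enorm_fderiv_prod_le {N : ℕ} {T : ℝ} {F : Vec 2 → ℝ} (hF : IsPairFactor T F)
    (S : Finset (Fin N)) (x : Fin N → Vec 2) (y : Vec 2) (k : Fin 2) :
    ‖fderiv ℝ (fun y => ∏ j ∈ S, F (y - x j)) y (Pi.single k 1)‖ₑ ≤
      ∑ j ∈ S, partialNorm F k (y - x j) := by
  classical
  have h1 : ∀ j ∈ S, HasFDerivAt (fun y => F (y - x j)) (fderiv ℝ F (y - x j)) y := by
    intro j _
    have h := (hF.smooth.differentiable (by simp) (y - x j)).hasFDerivAt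
    exact h.comp y ((hasFDerivAt_id y).sub_const (x j))
  have h2 := (HasFDerivAt.finsetProd h1).fderiv
  rw [h2, sum_apply]
  refine (enorm_sum_le _ _).trans (Finset.sum_le_sum fun j _ => ?_)
  rw [smul_apply, enorm_smul, partialNorm]
  refine mul_le_of_le_one_left' ?_
  rw [← ofReal_norm, ← ENNReal.ofReal_one]
  refine ENNReal.ofReal_le_ofReal ?_
  rw [Real.norm_of_nonneg (Finset.prod_nonneg fun _ _ => hF.nonneg _)]
  exact Finset.prod_le_one (fun _ _ => hF.nonneg _) fun _ _ => hF.le_one _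

lemma gradAt_const_mul_jastrow_le {N : ℕ} {T : ℝ} {F : Vec 2 → ℝ} (hF : IsPairFactor T F) (c : ℝ)
    (i : Fin N) (x : Fin N → Vec 2) :
    gradAt (fun x => ((c * jastrow F Finset.univ x : ℝ) : ℂ)) i x ≤
      ∑ k, ‖c‖ₑ ^ 2 * (pairProd (fun z => ENNReal.ofReal (F z)) (Finset.univ.erase i) x *
        (∑ j ∈ Finset.univ.erase i, partialNorm F k (x i - x j)) ^ 2) := by
  classical
  set E := Finset.univ.erase i with hE
  have hi : i ∉ E := Finset.notMem_erase i _
  have hU : (Finset.univ : Finset (Fin N)) = insert i E :=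
    (Finset.insert_erase (Finset.mem_univ i)).symm
  have hsm : ContDiff ℝ (⊤ : ℕ∞) fun x : Fin N → Vec 2 => ((c * jastrow F Finset.univ x : ℝ) : ℂ) :=
    Complex.ofRealCLM.contDiff.comp (contDiff_const.mul (contDiff_jastrow hF.smooth _))
  have h := gradSq_update (hsm.differentiable (by simp)) i x (x i)
  rw [Function.update_eq_self] at h
  rw [← h, gradSq]
  refine Finset.sum_le_sum fun k _ => ?_
  have e : (fun y => ((c * jastrow F Finset.univ (Function.update x i y) : ℝ) : ℂ)) =
      fun y => Complex.ofRealCLM (c * jastrow F E x * ∏ j ∈ E, F (y - x j)) := by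
    funext y
    rw [hU, jastrow_insert hF.nonneg hF.even hi, jastrow_update hi, Function.update_self]
    rw [Complex.ofRealCLM_apply, mul_assoc]
    congr 3
    refine Finset.prod_congr rfl fun j hj => ?_
    rw [Function.update_of_ne (Finset.ne_of_mem_erase hj)]
  have hd : DifferentiableAt ℝ (fun y => ∏ j ∈ E, F (y - x j)) (x i) := by
    have hc : ContDiff ℝ (⊤ : ℕ∞) fun y => ∏ j ∈ E, F (y - x j) :=
      contDiff_prod fun j _ => hF.smooth.comp (contDiff_id.sub contDiff_const)
    exact hc.differentiable (by simp) _
  have hder := Complex.ofRealCLM.hasFDerivAt.comp (x i)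
    (hd.hasFDerivAt.const_mul (c * jastrow F E x))
  have hder2 : fderiv ℝ (fun y => Complex.ofRealCLM (c * jastrow F E x *
      ∏ j ∈ E, F (y - x j))) (x i) =
    _ := hder.fderiv
  rw [e, hder2, ContinuousLinearMap.comp_apply, smul_apply,
    Complex.ofRealCLM_apply, ← ofReal_norm, Complex.norm_real, ofReal_norm, enorm_smul, enorm_mul,
    mul_pow, mul_pow, mul_assoc]
  have hj : ‖jastrow F E x‖ₑ ^ 2 = pairProd (fun z => ENNReal.ofReal (F z)) E x := by
    rw [← ofReal_jastrow_sq hF.nonneg hF.even, ← ofReal_norm,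
      Real.norm_of_nonneg (jastrow_nonneg hF.nonneg _ _)]
  rw [hj]
  gcongr
  exact enorm_fderiv_prod_le hF E x (x i) k

lemma volume_cube (N : ℕ) {T : ℝ} (hT : 0 ≤ T) :
    volume (cube N T) = ENNReal.ofReal (T ^ 2) ^ N := by
  have h : cube N T = Set.univ.pi fun _ : Fin N => square (fun _ => -T / 2) T := rfl
  rw [h, volume_pi_pi]
  simp [volume_square _ hT]

lemma pairProd_le_one {N : ℕ} {w : Vec 2 → ℝ≥0∞} (hw1 : ∀ z, w z ≤ 1) (S : Finset (Fin N))
    (x : Fin N → Vec 2) : pairProd w S x ≤ 1 :=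
  Finset.prod_le_one' fun _ _ => hw1 _

lemma lintegral_pairProd_ne_top (N : ℕ) {T : ℝ} (hT : 0 ≤ T) {w : Vec 2 → ℝ≥0∞}
    (hw1 : ∀ z, w z ≤ 1) (S : Finset (Fin N)) : ∫⁻ x in cube N T, pairProd w S x ≠ ⊤ := by
  refine ne_top_of_le_ne_top ?_ (lintegral_mono fun x => pairProd_le_one hw1 S x)
  rw [lintegral_one, Measure.restrict_apply_univ, volume_cube N hT]
  finiteness

lemma lintegral_pairProd_ne_zero {N : ℕ} {T : ℝ} (hT : 0 < T) {w : Vec 2 → ℝ≥0∞}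
    (hwm : Measurable w) (hwp : IsPeriodic T w) (hw : ∀ z, w (-z) = w z) {β : ℝ}
    (hβ0 : 0 ≤ β) (hβ1 : β < 1)
    (hβ : N * cellInt T ({z | w z ≠ 1}.indicator 1) ≤ ENNReal.ofReal (β * T ^ 2))
    (S : Finset (Fin N)) : ∫⁻ x in cube N T, pairProd w S x ≠ 0 := by
  induction S using Finset.induction_on with
  | empty =>
    have h : ∀ x : Fin N → Vec 2, pairProd w ∅ x = 1 := fun x => by simp [pairProd]
    simp only [h, lintegral_one, Measure.restrict_apply_univ, volume_cube N hT.le]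
    have := ENNReal.ofReal_pos.2 (show 0 < T ^ 2 by positivity)
    exact pow_ne_zero _ this.ne'
  | insert i S hi ih =>
    have h := lintegral_pairProd_insert_ge hT hwm hwp hw hβ0 hβ1 hβ hi
    intro h0
    rw [h0, nonpos_iff_eq_zero, mul_eq_zero] at h
    rcases h with h | h
    · rw [ENNReal.ofReal_eq_zero] at h; linarith
    · exact ih h

/-- Cross terms of the kinetic energy of a pair product. -/
lemma lintegral_pairProd_cross_le {N : ℕ} {T : ℝ} (hT : 0 < T) {w g : Vec 2 → ℝ≥0∞}
    (hwm : Measurable w) (hw : ∀ z, w (-z) = w z) (hw1 : ∀ z, w z ≤ 1)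
    (hgm : Measurable g) (hgp : IsPeriodic T g) (hg : ∀ z, g (-z) = g z)
    {i j l : Fin N} (hji : j ≠ i) (hli : l ≠ i) (hjl : j ≠ l) :
    ENNReal.ofReal (T ^ 2) ^ 2 * (∫⁻ x in cube N T, pairProd w (Finset.univ.erase i) x *
      (g (x i - x j) * g (x i - x l))) ≤
      cellInt T g ^ 2 * ∫⁻ x in cube N T, pairProd w ((Finset.univ.erase i).erase j) x := by
  classical
  set E := (Finset.univ.erase i).erase j with hE
  have hjE : j ∉ E := Finset.notMem_erase _ _
  have hiE : i ∉ E := fun h => Finset.notMem_erase i Finset.univ (Finset.mem_of_mem_erase h)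
  have hins : Finset.univ.erase i = insert j E :=
    (Finset.insert_erase (Finset.mem_erase.2 ⟨hji, Finset.mem_univ j⟩)).symm
  have hm : Measurable (pairProd w E) := measurable_pairProd hwm E
  have hG : Measurable fun x : Fin N → Vec 2 => pairProd w E x * g (x i - x l) :=
    hm.mul (hgm.comp ((measurable_pi_apply i).sub (measurable_pi_apply l)))
  have h1 := lintegral_cube_mul_diff_le hT (i := j) (j := i) hji.symm hG (fun x y => by
    rw [pairProd_update w hjE, Function.update_of_ne hji.symm, Function.update_of_ne hjl.symm])
    hgm hgp
  have h2 := lintegral_cube_mul_diff_le hT (i := i) (j := l) hli hm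
    (fun x y => pairProd_update w hiE x y) hgm hgp
  have h3 : ∫⁻ x in cube N T, pairProd w (Finset.univ.erase i) x *
      (g (x i - x j) * g (x i - x l)) ≤
      ∫⁻ x in cube N T, pairProd w E x * g (x i - x l) * g (x j - x i) := by
    refine lintegral_mono fun x => ?_
    dsimp only
    rw [hins, mul_assoc, ← hg (x j - x i), neg_sub, mul_comm (g (x i - x j))]
    gcongr
    exact pairProd_insert_le hw hw1 hjE x
  calc _ ≤ ENNReal.ofReal (T ^ 2) * (ENNReal.ofReal (T ^ 2) *
        ∫⁻ x in cube N T, pairProd w E x * g (x i - x l) * g (x j - x i)) := by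
        rw [sq, mul_assoc]; gcongr
    _ ≤ ENNReal.ofReal (T ^ 2) * (cellInt T g *
        ∫⁻ x in cube N T, pairProd w E x * g (x i - x l)) := mul_le_mul_right h1 _
    _ = cellInt T g * (ENNReal.ofReal (T ^ 2) *
        ∫⁻ x in cube N T, pairProd w E x * g (x i - x l)) := by ring
    _ ≤ cellInt T g * (cellInt T g * ∫⁻ x in cube N T, pairProd w E x) := mul_le_mul_right h2 _
    _ = _ := by ring

/-- Kinetic energy of one particle in a pair product state. -/
lemma lintegral_pairProd_sum_sq_le {N : ℕ} {T : ℝ} (hT : 0 < T) {w g : Vec 2 → ℝ≥0∞}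
    (hwm : Measurable w) (hwp : IsPeriodic T w) (hw : ∀ z, w (-z) = w z) (hw1 : ∀ z, w z ≤ 1)
    (hgm : Measurable g) (hgp : IsPeriodic T g) (hg : ∀ z, g (-z) = g z)
    (hcs : cellInt T g ^ 2 ≤
      cellInt T ({z | w z ≠ 1}.indicator 1) * cellInt T (fun z => g z ^ 2)) {β : ℝ}
    (hβ0 : 0 ≤ β) (hβ1 : β < 1)
    (hβ : N * cellInt T ({z | w z ≠ 1}.indicator 1) ≤ ENNReal.ofReal (β * T ^ 2)) (i : Fin N) :
    ENNReal.ofReal (T ^ 2) * (ENNReal.ofReal (1 - β) ^ 2 *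
      ∫⁻ x in cube N T, pairProd w (Finset.univ.erase i) x *
        (∑ j ∈ Finset.univ.erase i, g (x i - x j)) ^ 2) ≤
      N * cellInt T (fun z => g z ^ 2) * ∫⁻ x in cube N T, pairProd w Finset.univ x := by
  classical
  set τ := ENNReal.ofReal (T ^ 2) with hτ
  set X := ENNReal.ofReal (1 - β) with hX
  set Z := ∫⁻ x in cube N T, pairProd w Finset.univ x with hZ
  set G := cellInt T (fun z => g z ^ 2) with hG
  set b := cellInt T ({z | w z ≠ 1}.indicator 1) with hb
  set E := Finset.univ.erase i with hE
  have hiE : i ∉ E := Finset.notMem_erase _ _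
  have hτ0 : τ ≠ 0 := (ENNReal.ofReal_pos.2 (show 0 < T ^ 2 by positivity)).ne'
  have hτt : τ ≠ ⊤ := ENNReal.ofReal_ne_top
  have hZE : X * (∫⁻ x in cube N T, pairProd w E x) ≤ Z := by
    have h := lintegral_pairProd_insert_ge hT hwm hwp hw hβ0 hβ1 hβ hiE
    rwa [hE, Finset.insert_erase (Finset.mem_univ i)] at h
  have hZEj : ∀ j ∈ E, X ^ 2 * (∫⁻ x in cube N T, pairProd w (E.erase j) x) ≤ Z := by
    intro j hj
    have h := lintegral_pairProd_insert_ge hT hwm hwp hw hβ0 hβ1 hβ (Finset.notMem_erase j E)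
    rw [Finset.insert_erase hj] at h
    rw [sq, mul_assoc]
    exact (mul_le_mul_right h X).trans hZE
  have hgd : ∀ j, Measurable fun x : Fin N → Vec 2 => g (x i - x j) := fun j =>
    hgm.comp ((measurable_pi_apply i).sub (measurable_pi_apply j))
  have hPm : Measurable (pairProd w E) := measurable_pairProd hwm E
  have hexp : ∫⁻ x in cube N T, pairProd w E x * (∑ j ∈ E, g (x i - x j)) ^ 2 =
      ∑ j ∈ E, ∑ l ∈ E, ∫⁻ x in cube N T, pairProd w E x * (g (x i - x j) * g (x i - x l)) := by
    have hm : ∀ j l, Measurable fun x : Fin N → Vec 2 =>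
        pairProd w E x * (g (x i - x j) * g (x i - x l)) :=
      fun j l => hPm.mul ((hgd j).mul (hgd l))
    simp_rw [sq, Finset.sum_mul_sum, Finset.mul_sum]
    rw [lintegral_finsetSum _ fun j _ => Finset.measurable_sum _ fun l _ => hm j l]
    exact Finset.sum_congr rfl fun j _ => lintegral_finsetSum _ fun l _ => hm j l
  have hterm : ∀ j ∈ E, ∀ l ∈ E, τ ^ 2 * (X ^ 2 * ∫⁻ x in cube N T,
      pairProd w E x * (g (x i - x j) * g (x i - x l))) ≤
      (if j = l then τ * X * G * Z else 0) + b * G * Z := by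
    intro j hj l hl
    have hji := Finset.ne_of_mem_erase hj
    by_cases hjl : j = l
    · subst hjl
      rw [if_pos rfl]
      refine le_trans ?_ le_self_add
      have h := lintegral_cube_mul_diff_le hT hji hPm (fun x y => pairProd_update w hiE x y)
        (h := fun z => g z ^ 2) (hgm.pow_const 2) (fun z n => by simp only [hgp z n])
      change τ * _ ≤ _ at h
      simp only [sq] at h ⊢
      calc _ = τ * X * X * (τ * ∫⁻ x in cube N T,
            pairProd w E x * (g (x i - x j) * g (x i - x j))) := by ring
        _ ≤ τ * X * X * (cellInt T (fun z => g z * g z) * ∫⁻ x in cube N T, pairProd w E x) :=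
            mul_le_mul_right h _
        _ = τ * X * G * (X * ∫⁻ x in cube N T, pairProd w E x) := by
            simp only [hG, sq]; ring
        _ ≤ _ := mul_le_mul_right hZE _
    · rw [if_neg hjl, zero_add]
      have h := lintegral_pairProd_cross_le hT hwm hw hw1 hgm hgp hg hji
        (Finset.ne_of_mem_erase hl) hjl
      calc _ = X ^ 2 * (τ ^ 2 * ∫⁻ x in cube N T,
            pairProd w E x * (g (x i - x j) * g (x i - x l))) := by ring
        _ ≤ X ^ 2 * (cellInt T g ^ 2 * ∫⁻ x in cube N T, pairProd w (E.erase j) x) :=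
            mul_le_mul_right h _
        _ = cellInt T g ^ 2 * (X ^ 2 * ∫⁻ x in cube N T, pairProd w (E.erase j) x) := by ring
        _ ≤ b * G * Z := mul_le_mul' hcs (hZEj j hj)
  have hcard : (E.card : ℝ≥0∞) ≤ N := by
    exact_mod_cast (Finset.card_le_univ E).trans_eq (Fintype.card_fin N)
  have hXβ : X + ENNReal.ofReal β = 1 := by
    rw [hX, ← ENNReal.ofReal_add (by linarith) hβ0, sub_add_cancel, ENNReal.ofReal_one]
  have hsum : τ * (τ * (X ^ 2 * ∫⁻ x in cube N T,
      pairProd w E x * (∑ j ∈ E, g (x i - x j)) ^ 2)) ≤ τ * (N * G * Z) := by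
    calc _ = ∑ j ∈ E, ∑ l ∈ E, τ ^ 2 * (X ^ 2 * ∫⁻ x in cube N T,
          pairProd w E x * (g (x i - x j) * g (x i - x l))) := by
          rw [hexp, ← mul_assoc, ← sq, Finset.mul_sum, Finset.mul_sum]
          simp_rw [Finset.mul_sum]
      _ ≤ ∑ j ∈ E, ∑ l ∈ E, ((if j = l then τ * X * G * Z else 0) + b * G * Z) :=
          Finset.sum_le_sum fun j hj => Finset.sum_le_sum fun l hl => hterm j hj l hl
      _ = E.card * (τ * X * G * Z) + E.card * (E.card * (b * G * Z)) := by
          simp only [Finset.sum_add_distrib, Finset.sum_ite_eq, Finset.sum_const, nsmul_eq_mul]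
          congr 1
          rw [Finset.sum_congr rfl fun j hj => if_pos hj, Finset.sum_const, nsmul_eq_mul]
      _ ≤ N * (τ * X * G * Z) + N * (N * (b * G * Z)) := by gcongr
      _ = N * (τ * X * G * Z) + N * ((N * b) * (G * Z)) := by ring
      _ ≤ N * (τ * X * G * Z) + N * (ENNReal.ofReal (β * T ^ 2) * (G * Z)) := by gcongr
      _ = τ * (N * G * Z) * (X + ENNReal.ofReal β) := by
          rw [ENNReal.ofReal_mul hβ0]; ring
      _ = _ := by rw [hXβ, mul_one]
  exact (ENNReal.mul_le_mul_iff_right hτ0 hτt).1 hsum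

lemma periodize_periodic (V : Vec 2 → ℝ≥0∞) (T : ℝ) : IsPeriodic T (periodize 2 V T) := by
  intro z m
  rw [periodize, periodize, ← (Equiv.addLeft m).tsum_eq fun n => V fun k => z k + T * n k]
  refine tsum_congr fun n => ?_
  congr 1
  funext k
  simp only [Equiv.coe_addLeft, Pi.add_apply, Int.cast_add]
  ring

lemma measurable_periodize {V : Vec 2 → ℝ≥0∞} (hV : Measurable V) (T : ℝ) :
    Measurable (periodize 2 V T) := by
  refine Measurable.tsum fun n => hV.comp ?_
  fun_prop

/-- Interaction energy of one pair in a pair product state. -/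
lemma lintegral_pairProd_interaction_le {N : ℕ} {T : ℝ} (hT : 0 < T) {w U : Vec 2 → ℝ≥0∞}
    (hwm : Measurable w) (hwp : IsPeriodic T w) (hw : ∀ z, w (-z) = w z) (hw1 : ∀ z, w z ≤ 1)
    (hUm : Measurable U) (hUp : IsPeriodic T U) {β : ℝ} (hβ0 : 0 ≤ β) (hβ1 : β < 1)
    (hβ : N * cellInt T ({z | w z ≠ 1}.indicator 1) ≤ ENNReal.ofReal (β * T ^ 2))
    {i j : Fin N} (hji : j ≠ i) :
    ENNReal.ofReal (T ^ 2) * (ENNReal.ofReal (1 - β) ^ 2 *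
      ∫⁻ x in cube N T, U (x i - x j) * pairProd w Finset.univ x) ≤
      cellInt T (fun z => U z * w z ^ 2) * ∫⁻ x in cube N T, pairProd w Finset.univ x := by
  classical
  set E := Finset.univ.erase i with hE
  have hiE : i ∉ E := Finset.notMem_erase _ _
  have hU : (Finset.univ : Finset (Fin N)) = insert i E :=
    (Finset.insert_erase (Finset.mem_univ i)).symm
  have hX1 : ENNReal.ofReal (1 - β) ≤ 1 := by
    rw [← ENNReal.ofReal_one]; exact ENNReal.ofReal_le_ofReal (by linarith)
  have h1 := lintegral_pairProd_insert_ge hT hwm hwp hw hβ0 hβ1 hβ hiE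
  have h2 := lintegral_cube_mul_diff_le hT hji (measurable_pairProd hwm E)
    (fun x y => pairProd_update w hiE x y)
    (h := fun z => U z * w z ^ 2) (hUm.mul (hwm.pow_const 2))
    (fun z n => by simp only [hUp z n, hwp z n])
  have h3 : ∫⁻ x in cube N T, U (x i - x j) * pairProd w (insert i E) x ≤
      ∫⁻ x in cube N T, pairProd w E x * (U (x i - x j) * w (x i - x j) ^ 2) := by
    refine lintegral_mono fun x => ?_
    dsimp only
    rw [pairProd_insert hw hiE, mul_left_comm]
    gcongr
    rw [← Finset.mul_prod_erase E (fun j => w (x i - x j) ^ 2)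
      (Finset.mem_erase.2 ⟨hji, Finset.mem_univ j⟩)]
    exact mul_le_of_le_one_right' (Finset.prod_le_one' fun l _ => pow_le_one' (hw1 _) 2)
  rw [hU]
  calc _ ≤ ENNReal.ofReal (T ^ 2) * (ENNReal.ofReal (1 - β) *
        ∫⁻ x in cube N T, pairProd w E x * (U (x i - x j) * w (x i - x j) ^ 2)) := by
        gcongr
        rw [sq]
        exact mul_le_of_le_one_right' hX1
    _ = ENNReal.ofReal (1 - β) * (ENNReal.ofReal (T ^ 2) *
        ∫⁻ x in cube N T, pairProd w E x * (U (x i - x j) * w (x i - x j) ^ 2)) := by ring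
    _ ≤ ENNReal.ofReal (1 - β) * (cellInt T (fun z => U z * w z ^ 2) *
        ∫⁻ x in cube N T, pairProd w E x) := mul_le_mul_right h2 _
    _ = cellInt T (fun z => U z * w z ^ 2) * (ENNReal.ofReal (1 - β) *
        ∫⁻ x in cube N T, pairProd w E x) := by ring
    _ ≤ _ := mul_le_mul_right h1 _

lemma exists_enorm_sq_mul_eq_one {Z : ℝ≥0∞} (h0 : Z ≠ 0) (ht : Z ≠ ⊤) :
    ∃ c : ℝ, ‖c‖ₑ ^ 2 * Z = 1 := by
  have hp : 0 < Z.toReal := ENNReal.toReal_pos h0 ht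
  refine ⟨(√Z.toReal)⁻¹, ?_⟩
  rw [← ofReal_norm, Real.norm_of_nonneg (by positivity), ← ENNReal.ofReal_pow (by positivity),
    inv_pow, Real.sq_sqrt hp.le]
  nth_rewrite 2 [← ENNReal.ofReal_toReal ht]
  rw [← ENNReal.ofReal_mul (by positivity), inv_mul_cancel₀ hp.ne', ENNReal.ofReal_one]

/-- The energy of the normalized Jastrow trial state. -/
lemma exists_trialState_energy_le {N : ℕ} {T : ℝ} (hT : 0 < T) {F : Vec 2 → ℝ}
    (hF : IsPairFactor T F) {V : Vec 2 → ℝ≥0∞} (hV : Measurable V) {β : ℝ}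
    (hβ0 : 0 ≤ β) (hβ1 : β < 1)
    (hβ : N * cellInt T ({z | F z ≠ 1}.indicator 1) ≤ ENNReal.ofReal (β * T ^ 2)) :
    ∃ ψ, IsTrialState 2 N T ψ ∧
      ENNReal.ofReal (T ^ 2) * (ENNReal.ofReal (1 - β) ^ 2 *
        (kineticE 2 N T ψ + interE 2 N T V ψ)) ≤
      N * (N * ((∑ k, cellInt T (fun z => partialNorm F k z ^ 2)) +
        cellInt T (fun z => periodize 2 V T z * ENNReal.ofReal (F z) ^ 2) / 2)) := by
  classical
  set w : Vec 2 → ℝ≥0∞ := fun z => ENNReal.ofReal (F z) with hw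
  have hset : {z | F z ≠ 1} = {z | w z ≠ 1} := by
    ext z
    simp only [Set.mem_ofPred_eq, hw, ne_eq, ENNReal.ofReal_eq_one]
  rw [hset] at hβ
  have hwm : Measurable w := hF.smooth.continuous.measurable.ennreal_ofReal
  have hwp : IsPeriodic T w := fun z n => by simp only [hw, hF.periodic z n]
  have hwe : ∀ z, w (-z) = w z := fun z => by simp only [hw, hF.even]
  have hw1 : ∀ z, w z ≤ 1 := fun z => by
    rw [← ENNReal.ofReal_one]; exact ENNReal.ofReal_le_ofReal (hF.le_one z)
  set Z := ∫⁻ x in cube N T, pairProd w Finset.univ x with hZ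
  obtain ⟨c, hc⟩ := exists_enorm_sq_mul_eq_one
    (lintegral_pairProd_ne_zero hT hwm hwp hwe hβ0 hβ1 hβ Finset.univ)
    (lintegral_pairProd_ne_top N hT.le hw1 Finset.univ)
  set ψ : (Fin N → Vec 2) → ℂ := fun x => ((c * jastrow F Finset.univ x : ℝ) : ℂ) with hψ
  have hbox : ∀ f : (Fin N → Vec 2) → ℝ≥0∞, ∫⁻ x in box 2 N T, f x = ∫⁻ x in cube N T, f x :=
    fun f => setLIntegral_congr (box_ae_eq_cells N T)
  have hψsq : ∀ x, ‖ψ x‖ₑ ^ 2 = ‖c‖ₑ ^ 2 * pairProd w Finset.univ x := by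
    intro x
    have e : ‖ψ x‖ₑ = ‖c‖ₑ * ENNReal.ofReal (jastrow F Finset.univ x) := by
      rw [hψ, ← ofReal_norm, Complex.norm_real, norm_mul, ENNReal.ofReal_mul (norm_nonneg _),
        ofReal_norm, Real.norm_of_nonneg (jastrow_nonneg hF.nonneg _ _)]
    rw [e, mul_pow, ofReal_jastrow_sq hF.nonneg hF.even]
  have hPm : Measurable (pairProd (N := N) w Finset.univ) := measurable_pairProd hwm _
  refine ⟨ψ, ⟨?_, ?_, ?_, ?_⟩, ?_⟩
  · exact Complex.ofRealCLM.contDiff.comp (contDiff_const.mul (contDiff_jastrow hF.smooth _))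
  · intro x v
    simp only [hψ, jastrow_periodic hF.periodic]
  · intro σ x
    simp only [hψ, jastrow_comp_perm hF.nonneg hF.even]
  · simp only [← enorm_eq_nnnorm, hbox, hψsq]
    rw [lintegral_const_mul _ hPm, hc]
  set τ := ENNReal.ofReal (T ^ 2) with hτ
  set X := ENNReal.ofReal (1 - β) with hX
  set I := cellInt T (fun z => periodize 2 V T z * w z ^ 2) with hI
  set G : Fin 2 → ℝ≥0∞ := fun k => cellInt T (fun z => partialNorm F k z ^ 2) with hG
  have hkin : τ * (X ^ 2 * kineticE 2 N T ψ) ≤ N * (N * ∑ k, G k) := by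
    have e : kineticE 2 N T ψ = ∑ i, ∫⁻ x in cube N T, gradAt ψ i x := by
      rw [kineticE]
      refine Finset.sum_congr rfl fun i _ => ?_
      simp only [← enorm_eq_nnnorm, hbox, gradAt]
      rw [lintegral_finsetSum]
      exact fun k _ => (measurable_fderiv_apply_const ℝ ψ _).enorm.pow_const 2
    have hi : ∀ i : Fin N, τ * (X ^ 2 * ∫⁻ x in cube N T, gradAt ψ i x) ≤ N * ∑ k, G k := by
      intro i
      have hm : ∀ k : Fin 2, Measurable fun x : Fin N → Vec 2 =>
          pairProd w (Finset.univ.erase i) x *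
          (∑ j ∈ Finset.univ.erase i, partialNorm F k (x i - x j)) ^ 2 := fun k =>
        (measurable_pairProd hwm _).mul ((Finset.measurable_sum _ fun j _ =>
          (measurable_partialNorm F k).comp
            ((measurable_pi_apply i).sub (measurable_pi_apply j))).pow_const 2)
      have h1 : ∫⁻ x in cube N T, gradAt ψ i x ≤ ∑ k, ‖c‖ₑ ^ 2 * ∫⁻ x in cube N T,
          (pairProd w (Finset.univ.erase i) x *
            (∑ j ∈ Finset.univ.erase i, partialNorm F k (x i - x j)) ^ 2) := by
        refine (lintegral_mono fun x => gradAt_const_mul_jastrow_le hF c i x).trans_eq ?_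
        rw [lintegral_finsetSum _ fun k _ => (hm k).const_mul _]
        exact Finset.sum_congr rfl fun k _ => lintegral_const_mul _ (hm k)
      calc _ ≤ τ * (X ^ 2 * ∑ k, ‖c‖ₑ ^ 2 * ∫⁻ x in cube N T,
            (pairProd w (Finset.univ.erase i) x *
              (∑ j ∈ Finset.univ.erase i, partialNorm F k (x i - x j)) ^ 2)) := by gcongr
        _ = ∑ k, ‖c‖ₑ ^ 2 * (τ * (X ^ 2 * ∫⁻ x in cube N T,
            (pairProd w (Finset.univ.erase i) x *
              (∑ j ∈ Finset.univ.erase i, partialNorm F k (x i - x j)) ^ 2))) := by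
            rw [Finset.mul_sum, Finset.mul_sum]
            exact Finset.sum_congr rfl fun k _ => by ring
        _ ≤ ∑ k, ‖c‖ₑ ^ 2 * (N * G k * Z) := by
            refine Finset.sum_le_sum fun k _ => mul_le_mul_right ?_ _
            refine lintegral_pairProd_sum_sq_le hT hwm hwp hwe hw1 (measurable_partialNorm F k)
              (hF.partialNorm_periodic k) (hF.partialNorm_neg k) ?_ hβ0 hβ1 hβ i
            rw [← hset]
            exact hF.cellInt_partialNorm_sq_le k
        _ = ∑ k, N * G k * (‖c‖ₑ ^ 2 * Z) := Finset.sum_congr rfl fun k _ => by ring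
        _ = _ := by rw [hc, Finset.mul_sum]; simp only [mul_one]
    calc _ = ∑ i, τ * (X ^ 2 * ∫⁻ x in cube N T, gradAt ψ i x) := by
          rw [e, Finset.mul_sum, Finset.mul_sum]
      _ ≤ ∑ _i : Fin N, N * ∑ k, G k := Finset.sum_le_sum fun i _ => hi i
      _ = _ := by rw [Finset.sum_const, Finset.card_univ, Fintype.card_fin, nsmul_eq_mul]
  have hInt : τ * (X ^ 2 * interE 2 N T V ψ) ≤ N * (N * (I / 2)) := by
    have hij : ∀ i j : Fin N, j ≠ i → τ * (X ^ 2 * ∫⁻ x in box 2 N T,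
        periodize 2 V T (fun k => x i k - x j k) * (‖ψ x‖₊ : ℝ≥0∞) ^ 2) ≤ I := by
      intro i j hji
      simp only [← enorm_eq_nnnorm, hbox, hψsq]
      have hm : Measurable fun x : Fin N → Vec 2 =>
          periodize 2 V T (x i - x j) * pairProd w Finset.univ x :=
        ((measurable_periodize hV T).comp
          ((measurable_pi_apply i).sub (measurable_pi_apply j))).mul hPm
      have e : ∫⁻ x in cube N T, periodize 2 V T (fun k => x i k - x j k) *
          (‖c‖ₑ ^ 2 * pairProd w Finset.univ x) = ‖c‖ₑ ^ 2 * ∫⁻ x in cube N T,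
          periodize 2 V T (x i - x j) * pairProd w Finset.univ x := by
        rw [← lintegral_const_mul _ hm]
        refine lintegral_congr fun x => ?_
        rw [mul_left_comm]; rfl
      rw [e]
      calc _ = ‖c‖ₑ ^ 2 * (τ * (X ^ 2 * ∫⁻ x in cube N T,
            periodize 2 V T (x i - x j) * pairProd w Finset.univ x)) := by ring
        _ ≤ ‖c‖ₑ ^ 2 * (I * Z) := mul_le_mul_right (lintegral_pairProd_interaction_le hT hwm hwp hwe
            hw1 (measurable_periodize hV T) (periodize_periodic V T) hβ0 hβ1 hβ hji) _
        _ = I * (‖c‖ₑ ^ 2 * Z) := by ring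
        _ = I := by rw [hc, mul_one]
    calc _ = ∑ i : Fin N, ∑ j : Fin N, τ * (X ^ 2 * if i < j then ∫⁻ x in box 2 N T,
          periodize 2 V T (fun k => x i k - x j k) * (‖ψ x‖₊ : ℝ≥0∞) ^ 2 else 0) := by
          rw [interE]
          simp_rw [Finset.mul_sum]
      _ ≤ ∑ i : Fin N, ∑ j : Fin N, if i < j then I else 0 := by
          gcongr with i _ j _
          split_ifs with h
          · exact hij i j h.ne'
          · simp
      _ = ∑ i : Fin N, ∑ _j ∈ Finset.univ.erase i, I / 2 :=
          (sum_offDiag_half (fun _ _ => I) fun _ _ => rfl).symm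
      _ ≤ ∑ i : Fin N, ∑ _j : Fin N, I / 2 :=
          Finset.sum_le_sum fun i _ => Finset.sum_le_sum_of_subset (Finset.erase_subset _ _)
      _ = _ := by
          simp only [Finset.sum_const, Finset.card_univ, Fintype.card_fin, nsmul_eq_mul]
  calc _ = τ * (X ^ 2 * kineticE 2 N T ψ) + τ * (X ^ 2 * interE 2 N T V ψ) := by ring
    _ ≤ N * (N * ∑ k, G k) + N * (N * (I / 2)) := add_le_add hkin hInt
    _ = _ := by ring

/-- A smooth truncation to `[0, 1]` that is almost a contraction. -/
lemma exists_smooth_truncation {κ : ℝ} (hκ : 1 < κ) :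
    ∃ φ : ℝ → ℝ, ContDiff ℝ (⊤ : ℕ∞) φ ∧ (∀ t, 0 ≤ φ t) ∧ (∀ t, φ t ≤ 1) ∧ φ 1 = 1 ∧
      (∀ t, |φ t| ≤ κ * |t|) ∧ ∀ t, |deriv φ t| ≤ κ := by
  have hκ0 : 0 < κ := by linarith
  have hκi : κ⁻¹ < 1 := inv_lt_one_of_one_lt₀ hκ
  let f : ContDiffBump (1 / 2 : ℝ) :=
    ⟨κ⁻¹ / 2, 1 / 2, by positivity, by linarith⟩
  set χ : ℝ → ℝ := f.normed volume with hχ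
  have hχ0 : ∀ t, 0 ≤ χ t := f.nonneg_normed
  have hχκ : ∀ t, χ t ≤ κ := by
    intro t
    refine (f.normed_le_div_measure_closedBall_rIn volume t).trans (le_of_eq ?_)
    have : f.rIn = κ⁻¹ / 2 := rfl
    rw [this, Real.volume_real_closedBall (by positivity)]
    field_simp
  have hχs : ContDiff ℝ (⊤ : ℕ∞) χ := f.contDiff_normed
  have hχc : Continuous χ := hχs.continuous
  have hχi : Integrable χ := f.integrable_normed
  have hz : ∀ t, (t ≤ 0 ∨ 1 ≤ t) → χ t = 0 := by
    intro t ht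
    have h : t ∉ Function.support χ := by
      rw [hχ, f.support_normed_eq]
      have : f.rOut = 1 / 2 := rfl
      rw [this, Metric.mem_ball, Real.dist_eq, not_lt, le_abs]
      rcases ht with h | h
      · right; linarith
      · left; linarith
    simpa using h
  have hii : ∀ s t, IntervalIntegrable χ volume s t := fun s t => hχc.intervalIntegrable s t
  set φ : ℝ → ℝ := fun t => ∫ s in (0 : ℝ)..t, χ s with hφ
  have hder : ∀ t, HasDerivAt φ (χ t) t := fun t => hχc.integral_hasStrictDerivAt 0 t |>.hasDerivAt
  have hderiv : deriv φ = χ := funext fun t => (hder t).deriv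
  have hneg : ∀ t ≤ 0, φ t = 0 := by
    intro t ht
    rw [hφ]
    dsimp only
    rw [intervalIntegral.integral_symm, intervalIntegral.integral_of_le ht,
      setIntegral_eq_zero_of_forall_eq_zero fun s hs => hz s (Or.inl hs.2), neg_zero]
  have h1 : φ 1 = 1 := by
    rw [hφ]
    dsimp only
    rw [intervalIntegral.integral_of_le zero_le_one]
    refine Eq.trans ?_ (f.integral_normed (μ := volume))
    refine setIntegral_eq_integral_of_forall_compl_eq_zero fun s hs => hz s ?_
    rw [Set.mem_Ioc, not_and_or, not_lt, not_le] at hs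
    exact hs.imp id le_of_lt
  have hmono : Monotone φ := monotone_of_deriv_nonneg (fun t => (hder t).differentiableAt)
    fun t => by rw [hderiv]; exact hχ0 t
  refine ⟨φ, contDiff_infty_iff_deriv.2 ⟨fun t => (hder t).differentiableAt, hderiv ▸ hχs⟩,
    ?_, ?_, h1, ?_, ?_⟩
  · intro t
    rcases le_total t 0 with h | h
    · exact (hneg t h).ge
    · exact (hneg 0 le_rfl).ge.trans (hmono h)
  · intro t
    rcases le_total t 1 with h | h
    · exact (hmono h).trans h1.le
    · have : φ t = φ 1 := by
        rw [← sub_eq_zero, hφ]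
        dsimp only
        rw [intervalIntegral.integral_interval_sub_left (hii _ _) (hii _ _),
          intervalIntegral.integral_of_le h,
          setIntegral_eq_zero_of_forall_eq_zero fun s hs => hz s (Or.inr hs.1.le)]
      exact (this.trans h1).le
  · intro t
    have h := intervalIntegral.norm_integral_le_of_norm_le_const (a := 0) (b := t) (f := χ)
      (C := κ) fun s _ => by rw [Real.norm_of_nonneg (hχ0 s)]; exact hχκ s
    rwa [sub_zero] at h
  · intro t
    rw [hderiv, abs_of_nonneg (hχ0 t)]
    exact hχκ t

/-- The energy density of the scattering problem. -/
def scatDens (V : Vec 2 → ℝ≥0∞) (f : Vec 2 → ℝ) (x : Vec 2) : ℝ≥0∞ :=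
  (∑ k, partialNorm f k x ^ 2) + V x * ‖f x‖ₑ ^ 2 / 2

lemma measurable_scatDens {V : Vec 2 → ℝ≥0∞} (hV : Measurable V) {f : Vec 2 → ℝ}
    (hf : Continuous f) : Measurable (scatDens V f) :=
  (Finset.measurable_sum _ fun k _ => (measurable_partialNorm f k).pow_const 2).add
    ((hV.mul (hf.measurable.enorm.pow_const 2)).div_const 2)

lemma rad_neg (x : Vec 2) : rad (-x) = rad x := by simp [rad]

lemma abs_le_rad (x : Vec 2) (k : Fin 2) : |x k| ≤ rad x := by
  rw [rad]
  refine Real.abs_le_sqrt ?_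
  exact Finset.single_le_sum (f := fun k => x k ^ 2) (fun i _ => sq_nonneg _) (Finset.mem_univ k)

lemma measurableSet_rad_lt (ℓ : ℝ) : MeasurableSet {x : Vec 2 | rad x < ℓ} :=
  continuous_rad.measurable measurableSet_Iio

lemma partialNorm_comp_neg {f : Vec 2 → ℝ} (hf : Differentiable ℝ f) (k : Fin 2) (x : Vec 2) :
    partialNorm (fun y => f (-y)) k x = partialNorm f k (-x) := by
  have h1 : HasFDerivAt (fun y : Vec 2 => -y) (-ContinuousLinearMap.id ℝ (Vec 2)) x :=
    (hasFDerivAt_id x).neg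
  have h2 := ((hf (-x)).hasFDerivAt.comp x h1).fderiv
  change fderiv ℝ (fun y : Vec 2 => f (-y)) x = _ at h2
  rw [partialNorm, h2, partialNorm]
  simp

lemma enorm_half_add_sq_le (a b : ℝ) : ‖(a + b) / 2‖ₑ ^ 2 ≤ (‖a‖ₑ ^ 2 + ‖b‖ₑ ^ 2) / 2 := by
  have h : ∀ t : ℝ, ‖t‖ₑ ^ 2 = ENNReal.ofReal (t ^ 2) := fun t => by
    rw [← ofReal_norm, ← ENNReal.ofReal_pow (norm_nonneg _), Real.norm_eq_abs, sq_abs]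
  rw [h, h, h, ← ENNReal.ofReal_add (sq_nonneg _) (sq_nonneg _)]
  have h2 : (2 : ℝ≥0∞) = ENNReal.ofReal 2 := by simp
  rw [h2, ← ENNReal.ofReal_div_of_pos two_pos]
  exact ENNReal.ofReal_le_ofReal (by nlinarith [sq_nonneg (a - b)])

/-- Averaging over the point reflection does not increase the energy density on average. -/
lemma scatDens_average_le {V : Vec 2 → ℝ≥0∞} (hVe : ∀ x, V (-x) = V x) {f : Vec 2 → ℝ}
    (hf : Differentiable ℝ f) (x : Vec 2) :
    scatDens V (fun y => (f y + f (-y)) / 2) x ≤ (scatDens V f x + scatDens V f (-x)) / 2 := by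
  have hfn : Differentiable ℝ fun y => f (-y) := fun y =>
    (hf (-y)).comp y differentiableAt_id.neg
  have hk : ∀ k, partialNorm (fun y => (f y + f (-y)) / 2) k x ^ 2 ≤
      (partialNorm f k x ^ 2 + partialNorm f k (-x) ^ 2) / 2 := by
    intro k
    rw [← partialNorm_comp_neg hf]
    have h := (((hf x).hasFDerivAt.add (hfn x).hasFDerivAt).mul_const (2 : ℝ)⁻¹).fderiv
    have e : fderiv ℝ (fun y => (f y + f (-y)) / 2) x (Pi.single k 1) =
        (fderiv ℝ f x (Pi.single k 1) + fderiv ℝ (fun y => f (-y)) x (Pi.single k 1)) / 2 := by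
      have h2 : (fun y => (f y + f (-y)) / 2) = fun y => (f y + f (-y)) * (2 : ℝ)⁻¹ :=
        funext fun y => div_eq_mul_inv _ _
      rw [h2]
      change fderiv ℝ (fun y => (f y + f (-y)) * (2 : ℝ)⁻¹) x = _ at h
      rw [h]
      simp only [smul_apply, add_apply, smul_eq_mul]
      ring
    rw [partialNorm, e]
    exact enorm_half_add_sq_le _ _
  have h2 : ‖(f x + f (-x)) / 2‖ₑ ^ 2 ≤ _ := enorm_half_add_sq_le (f x) (f (-x))
  calc scatDens V (fun y => (f y + f (-y)) / 2) x
      ≤ (∑ k, (partialNorm f k x ^ 2 + partialNorm f k (-x) ^ 2) / 2) +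
        V x * ((‖f x‖ₑ ^ 2 + ‖f (-x)‖ₑ ^ 2) / 2) / 2 := by
        rw [scatDens]
        gcongr with k
        exact hk k
    _ = _ := by
        rw [scatDens, scatDens, hVe]
        simp only [div_eq_mul_inv, Fin.sum_univ_two]
        ring

lemma lintegral_disc_comp_neg (ℓ : ℝ) (g : Vec 2 → ℝ≥0∞) :
    ∫⁻ x in {x | rad x < ℓ}, g (-x) = ∫⁻ x in {x | rad x < ℓ}, g x := by
  rw [← lintegral_indicator (measurableSet_rad_lt ℓ),
    ← lintegral_indicator (measurableSet_rad_lt ℓ),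
    ← lintegral_neg_eq_self]
  refine lintegral_congr fun x => ?_
  simp only [Set.indicator_apply, Set.mem_ofPred_eq, rad_neg, neg_neg]

/-- Truncation increases the energy density at most by the square of the Lipschitz constant. -/
lemma scatDens_comp_le (V : Vec 2 → ℝ≥0∞) {f : Vec 2 → ℝ} (hf : Differentiable ℝ f) {φ : ℝ → ℝ}
    (hφ : Differentiable ℝ φ) {κ : ℝ} (hκ : 0 ≤ κ) (h1 : ∀ t, |φ t| ≤ κ * |t|)
    (h2 : ∀ t, |deriv φ t| ≤ κ) (x : Vec 2) :
    scatDens V (fun y => φ (f y)) x ≤ ENNReal.ofReal (κ ^ 2) * scatDens V f x := by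
  have hk : ∀ k, partialNorm (fun y => φ (f y)) k x ≤ ENNReal.ofReal κ * partialNorm f k x := by
    intro k
    have h := ((hφ (f x)).hasDerivAt.comp_hasFDerivAt x (hf x).hasFDerivAt).fderiv
    change fderiv ℝ (fun y => φ (f y)) x = _ at h
    rw [partialNorm, h, smul_apply, enorm_smul]
    refine mul_le_mul_left ?_ _
    rw [← ofReal_norm]
    exact ENNReal.ofReal_le_ofReal (h2 _)
  have h0 : ‖φ (f x)‖ₑ ≤ ENNReal.ofReal κ * ‖f x‖ₑ := by
    rw [← ofReal_norm, ← ofReal_norm, ← ENNReal.ofReal_mul hκ]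
    exact ENNReal.ofReal_le_ofReal (h1 _)
  calc _ ≤ (∑ k, (ENNReal.ofReal κ * partialNorm f k x) ^ 2) +
        V x * (ENNReal.ofReal κ * ‖f x‖ₑ) ^ 2 / 2 := by
        rw [scatDens]
        gcongr with k
        exact hk k
    _ = _ := by
        rw [scatDens, ENNReal.ofReal_pow hκ]
        simp only [div_eq_mul_inv, Fin.sum_univ_two]
        ring

/-- An admissible scattering function may be taken even, with values in `[0, 1]`, and equal to one
outside the disc, at almost no cost in energy. -/
lemma exists_disc_profile {V : Vec 2 → ℝ≥0∞} (hV : Measurable V) (hVe : ∀ x, V (-x) = V x)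
    {ℓ : ℝ} {E : ℝ≥0∞} (hE : E ∈ scatSet2 V ℓ) {κ : ℝ} (hκ : 1 < κ) :
    ∃ H : Vec 2 → ℝ, ContDiff ℝ (⊤ : ℕ∞) H ∧ (∀ x, H (-x) = H x) ∧ (∀ x, 0 ≤ H x) ∧
      (∀ x, H x ≤ 1) ∧ (∀ x, ℓ ≤ rad x → H x = 1) ∧
      ∫⁻ x in {x | rad x < ℓ}, scatDens V H x ≤ ENNReal.ofReal (κ ^ 2) * E := by
  obtain ⟨f, hf, ⟨ε, hε, hf1⟩, rfl⟩ := hE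
  have hf1 : ∀ x, |rad x - ℓ| < ε → f x = 1 := hf1
  change ∃ H : Vec 2 → ℝ, _ ∧ _ ∧ _ ∧ _ ∧ _ ∧ _ ≤ ENNReal.ofReal (κ ^ 2) *
    ∫⁻ x in {x | rad x < ℓ}, scatDens V f x
  obtain ⟨φ, hφ, hφ0, hφ1, hφ11, hφa, hφd⟩ := exists_smooth_truncation hκ
  have hfd := hf.differentiable (by simp)
  have hfa : ContDiff ℝ (⊤ : ℕ∞) fun y => (f y + f (-y)) / 2 :=
    (hf.add (hf.comp contDiff_neg)).div_const 2
  set g : Vec 2 → ℝ := fun y => φ ((f y + f (-y)) / 2) with hg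
  have hgs : ContDiff ℝ (⊤ : ℕ∞) g := hφ.comp hfa
  have hg1 : ∀ x, |rad x - ℓ| < ε → g x = 1 := by
    intro x hx
    rw [hg]
    dsimp only
    rw [hf1 x hx, hf1 (-x) (by rwa [rad_neg])]
    norm_num [hφ11]
  set H : Vec 2 → ℝ := fun x => if rad x < ℓ then g x else 1 with hH
  have hHg : ∀ x, rad x < ℓ → H =ᶠ[nhds x] g := by
    intro x hx
    filter_upwards [continuous_rad.continuousAt.eventually_lt_const hx] with y hy
    simp only [hH, if_pos hy]
  refine ⟨H, ?_, ?_, ?_, ?_, ?_, ?_⟩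
  · rw [contDiff_iff_contDiffAt]
    intro x
    rcases lt_or_ge (rad x) ℓ with hx | hx
    · exact hgs.contDiffAt.congr_of_eventuallyEq (hHg x hx)
    · refine (contDiffAt_const (c := (1 : ℝ))).congr_of_eventuallyEq ?_
      have hlt : ℓ - ε < rad x := by linarith
      filter_upwards [continuous_rad.continuousAt.eventually_const_lt hlt] with y hy
      simp only [hH]
      split_ifs with h
      · exact hg1 y (by rw [abs_lt]; constructor <;> linarith)
      · rfl
  · intro x
    simp only [hH, rad_neg, hg, neg_neg, add_comm]
  · intro x
    simp only [hH]
    split_ifs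
    · exact hφ0 _
    · exact zero_le_one
  · intro x
    simp only [hH]
    split_ifs
    · exact hφ1 _
    · exact le_rfl
  · intro x hx
    simp only [hH, if_neg (not_lt.2 hx)]
  · have hm := measurable_scatDens hV hf.continuous
    have hmn : Measurable fun x => scatDens V f (-x) := hm.comp measurable_neg
    calc ∫⁻ x in {x | rad x < ℓ}, scatDens V H x
        ≤ ∫⁻ x in {x | rad x < ℓ}, ENNReal.ofReal (κ ^ 2) *
            ((scatDens V f x + scatDens V f (-x)) / 2) := by
          refine setLIntegral_mono' (measurableSet_rad_lt ℓ) fun x hx => ?_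
          have e : scatDens V H x = scatDens V g x := by
            simp only [scatDens, partialNorm, (hHg x hx).fderiv_eq, (hHg x hx).eq_of_nhds]
          rw [e]
          refine (scatDens_comp_le V (hfa.differentiable (by simp)) (hφ.differentiable (by simp))
            (by linarith) hφa hφd x).trans ?_
          gcongr
          exact scatDens_average_le hVe hfd x
      _ = ENNReal.ofReal (κ ^ 2) * ∫⁻ x in {x | rad x < ℓ}, scatDens V f x := by
          have hma : Measurable fun x => (scatDens V f x + scatDens V f (-x)) / 2 :=
            (hm.add hmn).div_const 2
          rw [lintegral_const_mul _ hma]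
          simp only [div_eq_mul_inv]
          have hms : Measurable fun x => scatDens V f x + scatDens V f (-x) := hm.add hmn
          rw [lintegral_mul_const _ hms, lintegral_add_left hm, lintegral_disc_comp_neg,
            ← two_mul, mul_comm (2 : ℝ≥0∞), mul_assoc,
            ENNReal.mul_inv_cancel two_ne_zero ENNReal.ofNat_ne_top, mul_one]

section

/-- The representative of `z` in the centered cell. -/
def wrapCell (T : ℝ) (z : Vec 2) : Vec 2 := fun k => z k - T * round (z k / T)

lemma abs_wrapCell_le {T : ℝ} (hT : 0 < T) (z : Vec 2) (k : Fin 2) : |wrapCell T z k| ≤ T / 2 := by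
  have h := abs_sub_round (z k / T)
  have e : wrapCell T z k = T * (z k / T - round (z k / T)) := by
    rw [wrapCell]; field_simp
  rw [e, abs_mul, abs_of_pos hT]
  nlinarith

lemma wrapCell_add {T : ℝ} (hT : 0 < T) (z : Vec 2) (n : Fin 2 → ℤ) :
    wrapCell T (fun k => z k + T * n k) = wrapCell T z := by
  funext k
  have e : (z k + T * n k) / T = z k / T + n k := by field_simp
  rw [wrapCell, wrapCell, e, round_add_intCast]
  push_cast
  ring

variable {T ℓ : ℝ} {H : Vec 2 → ℝ}

/-- A shifted representative with coordinates at most `T - ℓ` may replace the centered one. -/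
lemma comp_wrapCell_eq (hT : 0 < T) (hℓ : 2 * ℓ < T) (h1 : ∀ x, ℓ ≤ rad x → H x = 1)
    {z : Vec 2} {n : Fin 2 → ℤ} (hz : ∀ k, |z k + T * n k| ≤ T - ℓ) :
    H (wrapCell T z) = H fun k => z k + T * n k := by
  rw [← wrapCell_add hT z n]
  set u : Vec 2 := fun k => z k + T * n k with hu
  by_cases h : ∀ k, round (u k / T) = 0
  · congr 1
    funext k
    rw [wrapCell, h k]
    simp
  · push Not at h
    obtain ⟨k, hk⟩ := h
    have hw := abs_wrapCell_le hT u k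
    have hm : (1 : ℝ) ≤ |(round (u k / T) : ℝ)| := by
      exact_mod_cast Int.one_le_abs hk
    have hTm : T ≤ |T * (round (u k / T) : ℝ)| := by
      rw [abs_mul, abs_of_pos hT]; nlinarith
    have e : T * (round (u k / T) : ℝ) = u k - wrapCell T u k := by rw [wrapCell]; ring
    rw [e] at hTm
    have h3 := hTm.trans (abs_sub _ _)
    have huk : |u k| ≤ T - ℓ := hz k
    rw [h1 u (by linarith [abs_le_rad u k]), h1 _ (by linarith [abs_le_rad (wrapCell T u) k])]

lemma comp_wrapCell_self (hT : 0 < T) (hℓ : 2 * ℓ < T) (h1 : ∀ x, ℓ ≤ rad x → H x = 1)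
    {z : Vec 2} (hz : ∀ k, |z k| ≤ T - ℓ) : H (wrapCell T z) = H z := by
  have h := comp_wrapCell_eq hT hℓ h1 (z := z) (n := 0) (by simpa using hz)
  simpa using h

lemma comp_wrapCell_eventuallyEq (hT : 0 < T) (hℓ : 2 * ℓ < T) (h1 : ∀ x, ℓ ≤ rad x → H x = 1)
    {z : Vec 2} {n : Fin 2 → ℤ} (hz : ∀ k, |z k + T * n k| ≤ T / 2) :
    (fun y => H (wrapCell T y)) =ᶠ[nhds z] fun y => H fun k => y k + T * n k := by
  have h : ∀ k : Fin 2, ∀ᶠ y : Vec 2 in nhds z, |y k + T * n k| < T - ℓ := by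
    intro k
    have hc : Continuous fun y : Vec 2 => |y k + T * n k| := by fun_prop
    exact hc.continuousAt.eventually_lt_const ((hz k).trans_lt (by linarith))
  filter_upwards [eventually_all.2 h] with y hy
  exact comp_wrapCell_eq hT hℓ h1 fun k => (hy k).le

lemma isPairFactor_comp_wrapCell (hT : 0 < T) (hℓ : 2 * ℓ < T) (hH : ContDiff ℝ (⊤ : ℕ∞) H)
    (he : ∀ x, H (-x) = H x) (h0 : ∀ x, 0 ≤ H x) (hle : ∀ x, H x ≤ 1)
    (h1 : ∀ x, ℓ ≤ rad x → H x = 1) : IsPairFactor T fun z => H (wrapCell T z) where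
  smooth := by
    rw [contDiff_iff_contDiffAt]
    intro z
    refine ContDiffAt.congr_of_eventuallyEq ?_
      (comp_wrapCell_eventuallyEq hT hℓ h1 (z := z) (n := fun k => -round (z k / T)) fun k => ?_)
    · refine (hH.comp ?_).contDiffAt
      exact contDiff_pi.2 fun k => (contDiff_apply ℝ ℝ k).add contDiff_const
    · have h := abs_wrapCell_le hT z k
      rw [wrapCell] at h
      push_cast
      rwa [mul_neg, ← sub_eq_add_neg]
  periodic := fun z n => by simp only [wrapCell_add hT]
  even := by
    intro z
    have hn : (fun k => (-z) k + T * ((round (z k / T) : ℤ) : ℝ)) = -wrapCell T z := by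
      funext k
      simp only [Pi.neg_apply, wrapCell]
      ring
    have hb : ∀ k, |(-z) k + T * ((round (z k / T) : ℤ) : ℝ)| ≤ T - ℓ := by
      intro k
      have h2 : (-z) k + T * ((round (z k / T) : ℤ) : ℝ) = (-wrapCell T z) k := congrFun hn k
      rw [h2, Pi.neg_apply, abs_neg]
      exact (abs_wrapCell_le hT z k).trans (by linarith)
    rw [comp_wrapCell_eq hT hℓ h1 hb, hn, he]
  nonneg := fun z => h0 _
  le_one := fun z => hle _

lemma abs_le_of_mem_square {z : Vec 2} (hz : z ∈ square (fun _ => -T / 2) T) (k : Fin 2) :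
    |z k| ≤ T / 2 := by
  have h := hz k trivial
  simp only [Set.mem_Ico] at h
  rw [abs_le]
  constructor <;> linarith [h.1, h.2]

lemma periodize_eq_of_mem_square {V : Vec 2 → ℝ≥0∞} {ℓ₀ : ℝ} (hsupp : ∀ x, V x ≠ 0 → rad x < ℓ₀)
    (hT : 0 < T) (hℓ : 2 * ℓ₀ < T) {z : Vec 2} (hz : z ∈ square (fun _ => -T / 2) T) :
    periodize 2 V T z = V z := by
  rw [periodize, tsum_eq_single (0 : Fin 2 → ℤ)]
  · simp
  · intro n hn
    by_contra h
    have hr := hsupp _ h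
    obtain ⟨k, hk⟩ := Function.ne_iff.1 hn
    have hm : (1 : ℝ) ≤ |(n k : ℝ)| := by exact_mod_cast Int.one_le_abs hk
    have h1 : T ≤ |T * (n k : ℝ)| := by rw [abs_mul, abs_of_pos hT]; nlinarith
    have h2 := abs_le_rad (fun k => z k + T * (n k : ℝ)) k
    have h3 := abs_le_of_mem_square hz k
    have h4 : |T * (n k : ℝ)| ≤ |z k + T * (n k : ℝ)| + |z k| := by
      have := abs_sub (z k + T * (n k : ℝ)) (z k)
      rwa [add_sub_cancel_left] at this
    linarith

lemma cellInt_ne_one_le (hT : 0 < T) (hℓ0 : 0 ≤ ℓ) (hℓ : 2 * ℓ < T)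
    (h1 : ∀ x, ℓ ≤ rad x → H x = 1) :
    cellInt T ({z | H (wrapCell T z) ≠ 1}.indicator 1) ≤ ENNReal.ofReal (4 * ℓ ^ 2) := by
  have hle : ∀ z ∈ square (fun _ => -T / 2) T,
      {z | H (wrapCell T z) ≠ 1}.indicator (1 : Vec 2 → ℝ≥0∞) z ≤
        (square (fun _ => -ℓ) (2 * ℓ)).indicator 1 z := by
    intro z hz
    by_cases hzH : H (wrapCell T z) = 1
    · rw [Set.indicator_of_notMem (by simpa using hzH)]
      exact zero_le
    · have hzs : z ∈ square (fun _ => -ℓ) (2 * ℓ) := by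
        intro k _
        have h2 : H (wrapCell T z) = H z := comp_wrapCell_self hT hℓ h1 fun k =>
          (abs_le_of_mem_square hz k).trans (by linarith)
        have h3 : rad z < ℓ := by
          by_contra h
          exact hzH (h2.trans (h1 z (not_lt.1 h)))
        have h4 := abs_lt.1 ((abs_le_rad z k).trans_lt h3)
        simp only [Set.mem_Ico]
        constructor <;> linarith [h4.1, h4.2]
      rw [Set.indicator_of_mem hzs]
      exact Set.indicator_le_self' (fun _ _ => zero_le) z
  calc _ ≤ ∫⁻ z in square (fun _ => -T / 2) T,
        (square (fun _ => -ℓ) (2 * ℓ)).indicator 1 z :=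
        setLIntegral_mono' (measurableSet_square _ _) hle
    _ ≤ ∫⁻ z, (square (fun _ => -ℓ) (2 * ℓ)).indicator 1 z := setLIntegral_le_lintegral _ _
    _ = _ := by
        rw [lintegral_indicator_one (measurableSet_square _ _), volume_square _ (by linarith)]
        congr 1
        ring

/-- On the cell the energy of the periodized profile is the scattering energy of the profile. -/
lemma cellInt_energy_le {V : Vec 2 → ℝ≥0∞} (hV : Measurable V) {ℓ₀ : ℝ}
    (hsupp : ∀ x, V x ≠ 0 → rad x < ℓ₀) (hℓ₀ : ℓ₀ ≤ ℓ) (hT : 0 < T) (hℓ : 2 * ℓ < T)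
    (hH : ContDiff ℝ (⊤ : ℕ∞) H) (h0 : ∀ x, 0 ≤ H x) (hle : ∀ x, H x ≤ 1)
    (h1 : ∀ x, ℓ ≤ rad x → H x = 1) :
    (∑ k, cellInt T (fun z => partialNorm (fun z => H (wrapCell T z)) k z ^ 2)) +
      cellInt T (fun z => periodize 2 V T z * ENNReal.ofReal (H (wrapCell T z)) ^ 2) / 2 ≤
      ∫⁻ x in {x | rad x < ℓ}, scatDens V H x := by
  have hm : ∀ k, Measurable fun z => partialNorm H k z ^ 2 := fun k =>
    (measurable_partialNorm H k).pow_const 2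
  have hmV : Measurable fun z => V z * ‖H z‖ₑ ^ 2 :=
    hV.mul (hH.continuous.measurable.enorm.pow_const 2)
  have hin : ∀ z ∈ square (fun _ => -T / 2) T, ∀ k, |z k| ≤ T - ℓ := fun z hz k =>
    (abs_le_of_mem_square hz k).trans (by linarith)
  have e1 : ∀ k, cellInt T (fun z => partialNorm (fun z => H (wrapCell T z)) k z ^ 2) =
      ∫⁻ z in square (fun _ => -T / 2) T, partialNorm H k z ^ 2 := by
    intro k
    refine setLIntegral_congr_fun (measurableSet_square _ _) fun z hz => ?_
    have h := comp_wrapCell_eventuallyEq hT hℓ h1 (z := z) (n := 0) fun k => by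
      simpa using abs_le_of_mem_square hz k
    simp only [Pi.zero_apply, Int.cast_zero, mul_zero, add_zero] at h
    simp only [partialNorm, h.fderiv_eq]
  have e2 : cellInt T (fun z => periodize 2 V T z * ENNReal.ofReal (H (wrapCell T z)) ^ 2) =
      ∫⁻ z in square (fun _ => -T / 2) T, V z * ‖H z‖ₑ ^ 2 := by
    refine setLIntegral_congr_fun (measurableSet_square _ _) fun z hz => ?_
    rw [periodize_eq_of_mem_square hsupp hT (by linarith) hz,
      comp_wrapCell_self hT hℓ h1 (hin z hz), ← ofReal_norm, Real.norm_of_nonneg (h0 z)]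
  have e3 : (∑ k, ∫⁻ z in square (fun _ => -T / 2) T, partialNorm H k z ^ 2) +
      (∫⁻ z in square (fun _ => -T / 2) T, V z * ‖H z‖ₑ ^ 2) / 2 =
      ∫⁻ z in square (fun _ => -T / 2) T, scatDens V H z := by
    have hms : Measurable fun z => ∑ k, partialNorm H k z ^ 2 :=
      Finset.measurable_sum _ fun k _ => hm k
    simp only [scatDens]
    rw [lintegral_add_left hms, lintegral_finsetSum _ fun k _ => hm k]
    congr 1
    simp only [div_eq_mul_inv]
    rw [lintegral_mul_const _ hmV]
  simp only [e1, e2]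
  rw [e3]
  refine (setLIntegral_le_lintegral _ _).trans (le_of_eq ?_)
  rw [← lintegral_indicator (measurableSet_rad_lt ℓ)]
  refine lintegral_congr fun z => ?_
  rw [Set.indicator_apply]
  split_ifs with hz
  · rfl
  · have hz : ℓ ≤ rad z := not_lt.1 hz
    have hV0 : V z = 0 := by
      by_contra h
      linarith [hsupp z h]
    have hd : fderiv ℝ H z = 0 :=
      IsLocalMax.fderiv_eq_zero (Eventually.of_forall fun y => by rw [h1 z hz]; exact hle y)
    simp [scatDens, partialNorm, hd, hV0]

end

/-- Upper bound for the energy by means of a Jastrow trial state of range `ℓ`. -/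
lemma exists_trialState_le_scattering {V : Vec 2 → ℝ≥0∞} {a ℓ₀ : ℝ} (hV : ScatteringBound V a ℓ₀)
    {ℓ : ℝ} (hℓ : ℓ₀ ≤ ℓ) (hup : sInf (scatSet2 V ℓ) ≤ ENNReal.ofReal (2 * π / Real.log (ℓ / a)))
    {κ : ℝ} (hκ : 1 < κ) {N : ℕ} {T : ℝ} (hT : 2 * ℓ < T) {β : ℝ} (hβ0 : 0 ≤ β) (hβ1 : β < 1)
    (hβ : N * (4 * ℓ ^ 2) ≤ β * T ^ 2) :
    ∃ ψ, IsTrialState 2 N T ψ ∧ kineticE 2 N T ψ + interE 2 N T V ψ ≤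
      ENNReal.ofReal (N ^ 2 * (κ ^ 3 * (2 * π / Real.log (ℓ / a))) / (T ^ 2 * (1 - β) ^ 2)) := by
  have ha := hV.pos
  have hℓa : a < ℓ := hV.lt.trans_le hℓ
  have hℓ0 : 0 < ℓ := ha.trans hℓa
  have hT0 : 0 < T := by linarith
  have hlog : 0 < Real.log (ℓ / a) := Real.log_pos ((one_lt_div ha).2 hℓa)
  set s := 2 * π / Real.log (ℓ / a) with hs
  have hs0 : 0 < s := by positivity
  have hVe : ∀ x, V (-x) = V x := fun x => hV.radial _ _ (by simp)
  obtain ⟨E, hE, hElt⟩ := sInf_lt_iff.1 (hup.trans_lt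
    ((ENNReal.ofReal_lt_ofReal_iff (by positivity)).2 (show s < κ * s by nlinarith)))
  obtain ⟨H, hH, he, h0, hle, h1, hEn⟩ := exists_disc_profile hV.meas hVe hE hκ
  have hF := isPairFactor_comp_wrapCell hT0 hT hH he h0 hle h1
  have hb := cellInt_ne_one_le (H := H) hT0 hℓ0.le hT h1
  obtain ⟨ψ, hψ, hψE⟩ := exists_trialState_energy_le (N := N) hT0 hF hV.meas hβ0 hβ1 (by
    refine (mul_le_mul_right hb _).trans ?_
    rw [← ENNReal.ofReal_natCast, ← ENNReal.ofReal_mul (by positivity)]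
    exact ENNReal.ofReal_le_ofReal hβ)
  refine ⟨ψ, hψ, ?_⟩
  have h2 := cellInt_energy_le hV.meas hV.supp hℓ hT0 hT hH h0 hle h1
  have h3 : (N : ℝ≥0∞) * (N * ((∑ k, cellInt T
      (fun z => partialNorm (fun z => H (wrapCell T z)) k z ^ 2)) +
      cellInt T (fun z => periodize 2 V T z * ENNReal.ofReal (H (wrapCell T z)) ^ 2) / 2)) ≤
      ENNReal.ofReal (N ^ 2 * (κ ^ 3 * s)) := by
    calc _ ≤ (N : ℝ≥0∞) * (N * (ENNReal.ofReal (κ ^ 2) * ENNReal.ofReal (κ * s))) := by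
          gcongr
          exact (h2.trans hEn).trans (by gcongr)
      _ = _ := by
          rw [← ENNReal.ofReal_natCast, ← ENNReal.ofReal_mul (by positivity),
            ← ENNReal.ofReal_mul (by positivity), ← ENNReal.ofReal_mul (by positivity)]
          congr 1
          ring
  have h4 := hψE.trans h3
  have hd : 0 < T ^ 2 * (1 - β) ^ 2 := by
    have : 0 < 1 - β := by linarith
    positivity
  rw [← mul_assoc, ← ENNReal.ofReal_pow (by linarith), ← ENNReal.ofReal_mul (by positivity)] at h4
  rw [ENNReal.ofReal_div_of_pos hd, ENNReal.le_div_iff_mul_le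
    (Or.inl (ENNReal.ofReal_pos.2 hd).ne') (Or.inl ENNReal.ofReal_ne_top), mul_comm]
  exact h4

/-- Upper bound for the energy per area at fixed small density. -/
lemma energy_upper_density {V : Vec 2 → ℝ≥0∞} {a ℓ₀ : ℝ} (hV : ScatteringBound V a ℓ₀)
    (hup : ∀ ℓ ≥ ℓ₀, sInf (scatSet2 V ℓ) ≤ ENNReal.ofReal (2 * π / Real.log (ℓ / a)))
    {κ : ℝ} (hκ : 1 < κ) :
    ∀ᶠ ρ : ℝ in nhdsWithin 0 (Set.Ioi 0), ∀ N : ℕ, 1 ≤ N → ∃ ψ : (Fin N → Vec 2) → ℂ,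
      IsTrialState 2 N (sideLength 2 ρ N) ψ ∧
      kineticE 2 N (sideLength 2 ρ N) ψ + interE 2 N (sideLength 2 ρ N) V ψ ≤
        ENNReal.ofReal (κ ^ 6 * (4 * π * ρ ^ 2 * bParam a ρ) * sideLength 2 ρ N ^ 2) := by
  have ha := hV.pos
  have hκ0 : 0 < κ := by linarith
  set β := 1 - κ⁻¹ with hβ
  have hκi : κ⁻¹ < 1 := inv_lt_one_of_one_lt₀ hκ
  have hκi0 : 0 < κ⁻¹ := inv_pos.2 hκ0
  have hβ0 : 0 < β := by linarith
  have hβ1 : β < 1 := by linarith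
  set ε := √β / 2 with hε
  have hε0 : 0 < ε := by positivity
  have hε2 : 4 * ε ^ 2 = β := by
    rw [hε, div_pow, Real.sq_sqrt hβ0.le]; ring
  have hε1 : 2 * ε < 1 := by
    have : (2 * ε) ^ 2 < 1 ^ 2 := by linarith [show (2 * ε) ^ 2 = 4 * ε ^ 2 by ring]
    exact lt_of_pow_lt_pow_left₀ 2 zero_le_one this
  have hℓev : ∀ᶠ ρ : ℝ in nhdsWithin 0 (Set.Ioi 0), ℓ₀ ≤ ε * (√ρ)⁻¹ :=
    (tendsto_inv_sqrt_nhdsGT_zero.const_mul_atTop hε0).eventually_ge_atTop ℓ₀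
  have hlogev := (tendsto_log_const_mul_inv_sqrt (inv_pos.2 ha)).eventually_ge_atTop
    (-Real.log ε / β)
  have hlogpos := (tendsto_log_const_mul_inv_sqrt (inv_pos.2 ha)).eventually_gt_atTop 0
  filter_upwards [hℓev, hlogev, hlogpos, self_mem_nhdsWithin] with ρ hℓ hlog hlog0 hρ N hN
  have hρ : 0 < ρ := hρ
  have hsq : 0 < √ρ := Real.sqrt_pos.2 hρ
  have hN0 : (1 : ℝ) ≤ N := by exact_mod_cast hN
  set T := sideLength 2 ρ N with hTdef
  have hT2 : T ^ 2 = N / ρ := sideLength_sq hρ N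
  have hTn : 0 ≤ T := sideLength_nonneg hρ N
  set ℓ := ε * (√ρ)⁻¹ with hℓdef
  have hℓsq : ℓ ^ 2 = ε ^ 2 / ρ := by
    rw [hℓdef, mul_pow, inv_pow, Real.sq_sqrt hρ.le, div_eq_mul_inv]
  have hT : 2 * ℓ < T := by
    refine lt_of_pow_lt_pow_left₀ 2 hTn ?_
    rw [mul_pow, hℓsq, hT2, ← mul_div_assoc]
    refine div_lt_div_of_pos_right ?_ hρ
    nlinarith
  obtain ⟨ψ, hψ, hE⟩ := exists_trialState_le_scattering hV hℓ (hup ℓ hℓ) hκ (N := N) hT hβ0.le hβ1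
    (by rw [hℓsq, hT2, ← hε2]; exact le_of_eq (by ring))
  refine ⟨ψ, hψ, hE.trans (ENNReal.ofReal_le_ofReal ?_)⟩
  set x := Real.log (a⁻¹ * (√ρ)⁻¹) with hx
  have hxb : bParam a ρ = (2 * x)⁻¹ := by
    have e : Real.log (ρ * a ^ 2) = -(2 * x) := by
      rw [hx, Real.log_mul (by positivity) (by positivity),
        Real.log_mul (by positivity) (by positivity), Real.log_inv, Real.log_inv, Real.log_pow,
        Real.log_sqrt hρ.le]
      push_cast
      ring
    rw [bParam, e, abs_neg, abs_of_pos (by linarith)]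
  have hlogℓ : x / κ ≤ Real.log (ℓ / a) := by
    have e : Real.log (ℓ / a) = Real.log ε + x := by
      rw [hx, ← Real.log_mul (by positivity) (by positivity)]
      congr 1
      rw [hℓdef]; ring
    rw [div_le_iff₀ hβ0] at hlog
    rw [e, div_eq_mul_inv]
    have : x * β = x - x * κ⁻¹ := by rw [hβ]; ring
    linarith
  have h1β : 1 - β = κ⁻¹ := by rw [hβ]; ring
  have hTpos : 0 < T ^ 2 := by rw [hT2]; positivity
  have hNT : (N : ℝ) = ρ * T ^ 2 := by rw [hT2]; field_simp
  calc (N : ℝ) ^ 2 * (κ ^ 3 * (2 * π / Real.log (ℓ / a))) / (T ^ 2 * (1 - β) ^ 2)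
      ≤ N ^ 2 * (κ ^ 3 * (2 * π / (x / κ))) / (T ^ 2 * (1 - β) ^ 2) := by
        have : 0 < x / κ := by positivity
        gcongr
    _ = κ ^ 6 * (4 * π * ρ ^ 2 * bParam a ρ) * T ^ 2 := by
        rw [hxb, h1β, hNT]
        field_simp
        ring

lemma exists_scatteringBound {V : Vec 2 → ℝ≥0∞} (hVmeas : Measurable V)
    (hVrad : ∀ x y : Vec 2, ∑ k, (x k) ^ 2 = ∑ k, (y k) ^ 2 → V x = V y)
    (hVsupp : HasCompactSupport V) {a : ℝ} (ha : 0 < a)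
    (hscat : ∀ ℓ : ℝ,
      (∀ x y : Vec 2, V x ≠ 0 → V y ≠ 0 → Real.sqrt (∑ k, (x k - y k) ^ 2) < ℓ) →
      sInf (scatSet2 V ℓ) = ENNReal.ofReal (2 * π / Real.log (ℓ / a))) :
    ∃ ℓ₀, ScatteringBound V a ℓ₀ ∧
      ∀ ℓ ≥ ℓ₀, sInf (scatSet2 V ℓ) = ENNReal.ofReal (2 * π / Real.log (ℓ / a)) := by
  obtain ⟨C, hC0, hC⟩ := hVsupp.isBounded.exists_pos_norm_le
  have hCk : ∀ x, V x ≠ 0 → ∀ k, |x k| ≤ C := fun x hx k =>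
    (norm_le_pi_norm x k).trans (hC x (subset_tsupport V hx))
  have hsqrt : ∀ (z : Vec 2) (B : ℝ), 0 ≤ B → (∀ k, |z k| ≤ B) → rad z ≤ 2 * B := by
    intro z B hB hz
    rw [rad, Fin.sum_univ_two]
    refine Real.sqrt_le_iff.2 ⟨by positivity, ?_⟩
    have h0 := sq_le_sq' (abs_le.1 (hz 0)).1 (abs_le.1 (hz 0)).2
    have h1 := sq_le_sq' (abs_le.1 (hz 1)).1 (abs_le.1 (hz 1)).2
    nlinarith
  have heq : ∀ ℓ ≥ 4 * C + a + 1,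
      sInf (scatSet2 V ℓ) = ENNReal.ofReal (2 * π / Real.log (ℓ / a)) := by
    intro ℓ hℓ
    refine hscat ℓ fun x y hx hy => ?_
    have := hsqrt (fun k => x k - y k) (2 * C) (by positivity) fun k =>
      (abs_sub _ _).trans (by linarith [hCk x hx k, hCk y hy k])
    rw [rad] at this
    linarith
  refine ⟨4 * C + a + 1, ⟨hVmeas, hVrad, ha, by linarith, fun x hx => ?_, fun ℓ hℓ => ?_⟩, heq⟩
  · have := hsqrt x C hC0.le (hCk x hx)
    linarith
  · rw [heq ℓ hℓ, ← ENNReal.ofReal_mul (by positivity), mul_one_div]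

/-- Two-sided bounds on the ground state energy per area pass to `eMinus` and `ePlus`. -/
lemma eMinus_ePlus_mem_Icc {V : Vec 2 → ℝ≥0∞} {ρ lo hi : ℝ}
    (h : ∀ᶠ N : ℕ in atTop,
      gsEnergy 2 N (sideLength 2 ρ N) V / sideLength 2 ρ N ^ 2 ∈ Set.Icc lo hi) :
    eMinus 2 V ρ ∈ Set.Icc lo hi ∧ ePlus 2 V ρ ∈ Set.Icc lo hi := by
  have hl := h.mono fun _ hN => hN.1
  have hu := h.mono fun _ hN => hN.2
  have hbu : IsBoundedUnder (· ≤ ·) atTop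
      fun N : ℕ => gsEnergy 2 N (sideLength 2 ρ N) V / sideLength 2 ρ N ^ 2 := ⟨hi, hu⟩
  have hbl : IsBoundedUnder (· ≥ ·) atTop
      fun N : ℕ => gsEnergy 2 N (sideLength 2 ρ N) V / sideLength 2 ρ N ^ 2 := ⟨lo, hl⟩
  have h1 : lo ≤ eMinus 2 V ρ := le_liminf_of_le hbu.isCoboundedUnder_ge hl
  have h2 : ePlus 2 V ρ ≤ hi := limsup_le_of_le hbl.isCoboundedUnder_le hu
  have h3 : eMinus 2 V ρ ≤ ePlus 2 V ρ := liminf_le_limsup hbu hbl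
  exact ⟨⟨h1, h3.trans h2⟩, h1.trans h3, h2⟩

lemma gsEnergy_div_mem_Icc {V : Vec 2 → ℝ≥0∞} {N : ℕ} {T lo hi : ℝ} (hT : 0 < T) (hhi : 0 ≤ hi)
    (hlow : ∀ ψ : (Fin N → Vec 2) → ℂ, IsTrialState 2 N T ψ →
      kineticE 2 N T ψ + interE 2 N T V ψ ≠ ⊤ →
      lo * T ^ 2 ≤ (kineticE 2 N T ψ + interE 2 N T V ψ).toReal)
    (hupp : ∃ ψ : (Fin N → Vec 2) → ℂ, IsTrialState 2 N T ψ ∧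
      kineticE 2 N T ψ + interE 2 N T V ψ ≤ ENNReal.ofReal (hi * T ^ 2)) :
    gsEnergy 2 N T V / T ^ 2 ∈ Set.Icc lo hi := by
  obtain ⟨ψ, hψ, hE⟩ := hupp
  have htop := ne_top_of_le_ne_top ENNReal.ofReal_ne_top hE
  have hT2 : 0 < T ^ 2 := by positivity
  constructor
  · rw [le_div_iff₀ hT2]
    refine le_csInf ⟨_, ψ, hψ, htop, rfl⟩ ?_
    rintro _ ⟨φ, hφ, hφt, rfl⟩
    exact hlow φ hφ hφt
  · rw [div_le_iff₀ hT2]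
    refine LE.le.trans ?_ (ENNReal.toReal_le_of_le_ofReal (by positivity) hE)
    refine csInf_le ⟨0, ?_⟩ ⟨ψ, hψ, htop, rfl⟩
    rintro _ ⟨φ, -, -, rfl⟩
    exact ENNReal.toReal_nonneg

lemma exists_lower_constant {l : ℝ} (hl : l < 1) :
    ∃ (K : ℕ) (η : ℝ), 2 ≤ K ∧ 0 < η ∧ l < (1 - 2 / (K : ℝ) ^ 2) / (1 + 3 * η) := by
  have h1 : Tendsto (fun K : ℕ => (1 - 2 / (K : ℝ) ^ 2) / (1 + 3 * (1 / ((K : ℝ) + 1)))) atTop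
      (nhds ((1 - 0) / (1 + 3 * 0))) := by
    refine (tendsto_const_nhds.sub ?_).div
      (tendsto_const_nhds.add (tendsto_one_div_add_atTop_nhds_zero_nat.const_mul 3)) (by norm_num)
    exact tendsto_const_nhds.div_atTop
      ((tendsto_pow_atTop two_ne_zero).comp tendsto_natCast_atTop_atTop)
  obtain ⟨K, hK, hlK⟩ := ((eventually_ge_atTop 2).and
    (h1.eventually_const_lt (by simpa using hl))).exists
  exact ⟨K, 1 / ((K : ℝ) + 1), hK, by positivity, hlK⟩

lemma exists_upper_constant {u : ℝ} (hu : 1 < u) : ∃ κ : ℝ, 1 < κ ∧ κ ^ 6 < u := by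
  have h : Tendsto (fun κ : ℝ => κ ^ 6) (nhdsWithin 1 (Set.Ioi 1)) (nhds 1) := by
    simpa using ((continuous_pow 6).tendsto (1 : ℝ)).mono_left
      (nhdsWithin_le_nhds (s := Set.Ioi 1))
  obtain ⟨κ, hκu, hκ⟩ := ((h.eventually_lt_const hu).and self_mem_nhdsWithin).exists
  exact ⟨κ, hκ, hκu⟩

lemma eventually_bParam_pos {a : ℝ} (ha : 0 < a) :
    ∀ᶠ ρ : ℝ in nhdsWithin 0 (Set.Ioi 0), 0 < bParam a ρ := by
  filter_upwards [Ioo_mem_nhdsGT (show (0 : ℝ) < (a ^ 2)⁻¹ by positivity)] with ρ hρ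
  have h0 := hρ.1
  have h1 : ρ * a ^ 2 < 1 := by
    have := hρ.2
    rwa [← one_div, lt_div_iff₀ (by positivity)] at this
  exact inv_pos.2 (abs_pos.2 (Real.log_neg (by positivity) h1).ne)

lemma eventually_energy_ratio_mem_Icc {V : Vec 2 → ℝ≥0∞} {a ℓ₀ : ℝ} (hV : ScatteringBound V a ℓ₀)
    (hup : ∀ ℓ ≥ ℓ₀, sInf (scatSet2 V ℓ) ≤ ENNReal.ofReal (2 * π / Real.log (ℓ / a)))
    {l u : ℝ} (hl : l < 1) (hu : 1 < u) :
    ∀ᶠ ρ : ℝ in nhdsWithin 0 (Set.Ioi 0),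
      eMinus 2 V ρ / (4 * π * ρ ^ 2 * bParam a ρ) ∈ Set.Ioo l u ∧
      ePlus 2 V ρ / (4 * π * ρ ^ 2 * bParam a ρ) ∈ Set.Ioo l u := by
  obtain ⟨K, η, hK, hη, hlK⟩ := exists_lower_constant hl
  obtain ⟨κ, hκ, hκu⟩ := exists_upper_constant hu
  filter_upwards [energy_lower_density hV hη hK, energy_upper_density hV hup hκ,
    eventually_bParam_pos hV.pos, self_mem_nhdsWithin] with ρ hlow hupp hb hρ
  have hρ : 0 < ρ := hρ
  have hD : 0 < 4 * π * ρ ^ 2 * bParam a ρ := by positivity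
  obtain ⟨h1, h2⟩ := eMinus_ePlus_mem_Icc (V := V) (ρ := ρ) (by
    filter_upwards [eventually_ge_atTop (K ^ 2), eventually_ge_atTop 1] with N hN hN1
    have hT : 0 < sideLength 2 ρ N := by
      have : (0 : ℝ) < N := by exact_mod_cast hN1
      exact Real.rpow_pos_of_pos (by positivity) _
    exact gsEnergy_div_mem_Icc hT (by positivity) (hlow N hN) (hupp N hN1))
  constructor
  · exact ⟨hlK.trans_le ((le_div_iff₀ hD).2 h1.1), ((div_le_iff₀ hD).2 h1.2).trans_lt hκu⟩
  · exact ⟨hlK.trans_le ((le_div_iff₀ hD).2 h2.1), ((div_le_iff₀ hD).2 h2.2).trans_lt hκu⟩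

/-- **Leading order of the ground state energy in two dimensions (Lieb–Yngvason).**
For a measurable, radial, compactly supported `V : ℝ² → [0,∞]` with two-dimensional
scattering length `a > 0`, setting `b(ρ) = 1/|log(ρa²)|`, one has
`lim_{ρ→0⁺} e₂^±(ρ)/(4πρ²b(ρ)) = 1` both for the liminf and the limsup versions. -/
theorem leading_order_2d
    (V : Vec 2 → ℝ≥0∞) (hVmeas : Measurable V)
    (hVrad : ∀ x y : Vec 2, ∑ k, (x k) ^ 2 = ∑ k, (y k) ^ 2 → V x = V y)
    (hVsupp : HasCompactSupport V)
    (a : ℝ) (ha : 0 < a)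
    (hscat : ∀ ℓ : ℝ,
      (∀ x y : Vec 2, V x ≠ 0 → V y ≠ 0 → Real.sqrt (∑ k, (x k - y k) ^ 2) < ℓ) →
      sInf (scatSet2 V ℓ) = ENNReal.ofReal (2 * π / Real.log (ℓ / a))) :
    Tendsto (fun ρ : ℝ => eMinus 2 V ρ / (4 * π * ρ ^ 2 * bParam a ρ))
        (nhdsWithin 0 (Set.Ioi 0)) (nhds 1) ∧
    Tendsto (fun ρ : ℝ => ePlus 2 V ρ / (4 * π * ρ ^ 2 * bParam a ρ))
        (nhdsWithin 0 (Set.Ioi 0)) (nhds 1) := by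
  obtain ⟨ℓ₀, hV, heq⟩ := exists_scatteringBound hVmeas hVrad hVsupp ha hscat
  have hup := fun ℓ hℓ => (heq ℓ hℓ).le
  constructor <;> refine tendsto_order.2 ⟨fun l hl => ?_, fun u hu => ?_⟩
  · exact (eventually_energy_ratio_mem_Icc hV hup hl one_lt_two).mono fun _ h => h.1.1
  · exact (eventually_energy_ratio_mem_Icc hV hup zero_lt_one hu).mono fun _ h => h.1.2
  · exact (eventually_energy_ratio_mem_Icc hV hup hl one_lt_two).mono fun _ h => h.2.1
  · exact (eventually_energy_ratio_mem_Icc hV hup zero_lt_one hu).mono fun _ h => h.2.2
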